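/- arXiv:1107.1386 — 3 statements merged into one kernel-verified Lean document; each statement's English description precedes it below -/
import Mathlib

section
/- Let Q = ℕ → [0,1] be the Hilbert cube with the product topology and the metric d(x,y) = Σₙ 2⁻ⁿ |xₙ − yₙ|. There exists an assignment E sending each pair (φ, L), where K and L are Z-sets in Q and φ : K → L is continuous, to a continuous map E(φ,L) : Q → Q, such that for all such pairs: (a) E(id_L, L) = id_Q, and E(ψ ∘ φ, M) = E(ψ,M) ∘ E(φ,L) for every Z-set M and continuous ψ : L → M; (b) E(φ,L)(x) = φ(x) for all x ∈ K; (c) φ is injective if and only if E(φ,L) is injective, φ is surjective onto L if and only if E(φ,L) is surjective onto Q, and φ is a topological embedding if and only if E(φ,L) is a topological embedding; in particular, if φ is a homeomorphism of K onto L then E(φ,L) is a homeomorphism of Q onto Q. -/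
open Topology Set

/-- The Hilbert cube `Q = ℕ → [0,1]`, with the product topology. -/
abbrev HCube : Type := ℕ → unitInterval

/-- The metric `d(x,y) = Σₙ 2⁻ⁿ |xₙ - yₙ|` on the Hilbert cube. -/
noncomputable def hDist (x y : HCube) : ℝ :=
  ∑' n : ℕ, (2 : ℝ)⁻¹ ^ n * |(x n : ℝ) - (y n : ℝ)|

/-- `A` is of type `Z` in `Q`: every continuous map of `Q` into `Q` can be uniformly
approximated by continuous maps of `Q` into `Q \ A`. -/
def IsZType (A : Set HCube) : Prop :=
  ∀ ε > (0 : ℝ), ∀ f : HCube → HCube, Continuous f →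
    ∃ g : HCube → HCube, Continuous g ∧ Set.range g ∩ A = ∅ ∧ ∀ q, hDist (f q) (g q) < ε

/-- A `Z`-set in `Q` is a closed set of type `Z`. -/
def IsZSet (A : Set HCube) : Prop := IsClosed A ∧ IsZType A

/-! ### Increasing homeomorphisms of the unit interval -/

/-- The monotone piecewise linear map of `[0,1]` onto itself collapsing `[a,b]` to `s`. -/
noncomputable def plateau (a b s x : ℝ) : ℝ :=
  s * min (x / a) 1 + (1 - s) * max 0 ((x - b) / (1 - b))

theorem plateau_zero {a b s : ℝ} (hb : 0 < b) (hb1 : b < 1) : plateau a b s 0 = 0 := by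
  have : max 0 ((0 - b) / (1 - b)) = 0 :=
    max_eq_left (div_nonpos_of_nonpos_of_nonneg (by linarith) (by linarith))
  rw [plateau, this]; simp

theorem plateau_one {a b s : ℝ} (ha : 0 < a) (ha1 : a < 1) (hb1 : b < 1) :
    plateau a b s 1 = 1 := by
  have h1 : min (1 / a) 1 = 1 := min_eq_right ((one_le_div ha).2 ha1.le)
  have h2 : (1 - b) / (1 - b) = 1 := div_self (by linarith)
  rw [plateau, h1, h2]; simp

theorem plateau_eq {a b s x : ℝ} (ha : 0 < a) (hb1 : b < 1) (hax : a ≤ x) (hxb : x ≤ b) :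
    plateau a b s x = s := by
  have h1 : min (x / a) 1 = 1 := min_eq_right ((one_le_div ha).2 hax)
  have h2 : max 0 ((x - b) / (1 - b)) = 0 :=
    max_eq_left (div_nonpos_of_nonpos_of_nonneg (by linarith) (by linarith))
  rw [plateau, h1, h2]; simp

theorem plateau_monotone {a b s : ℝ} (ha : 0 < a) (hb1 : b < 1) (hs : s ∈ Icc (0 : ℝ) 1) :
    Monotone (plateau a b s) := by
  intro x y hxy
  have h1 : min (x / a) 1 ≤ min (y / a) 1 := by gcongr
  have h2 : max 0 ((x - b) / (1 - b)) ≤ max 0 ((y - b) / (1 - b)) := by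
    have : 0 ≤ 1 - b := by linarith
    gcongr
  exact add_le_add (mul_le_mul_of_nonneg_left h1 hs.1)
    (mul_le_mul_of_nonneg_left h2 (by linarith [hs.2]))

theorem plateau_mem {a b s x : ℝ} (ha : 0 < a) (ha1 : a < 1) (hb : 0 < b) (hb1 : b < 1)
    (hs : s ∈ Icc (0 : ℝ) 1) (hx : x ∈ Icc (0 : ℝ) 1) : plateau a b s x ∈ Icc (0 : ℝ) 1 := by
  constructor
  · rw [← plateau_zero (a := a) (s := s) hb hb1]; exact plateau_monotone ha hb1 hs hx.1
  · rw [← plateau_one (s := s) ha ha1 hb1]; exact plateau_monotone ha hb1 hs hx.2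

theorem plateau_strictMono {a s : ℝ} (ha : 0 < a) (ha1 : a < 1) (hs : 0 < s) (hs1 : s < 1) :
    StrictMono (plateau a a s) := by
  intro x y hxy
  have ha' : 0 < 1 - a := by linarith
  have hs' : 0 < 1 - s := by linarith
  have h1 : min (x / a) 1 ≤ min (y / a) 1 := by gcongr
  have h2 : max 0 ((x - a) / (1 - a)) ≤ max 0 ((y - a) / (1 - a)) := by gcongr
  rcases lt_or_ge x a with h | h
  · have : min (x / a) 1 < min (y / a) 1 := by
      have hx1 : x / a < 1 := (div_lt_one ha).2 h
      rw [min_eq_left hx1.le]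
      exact lt_min (by gcongr) hx1
    exact add_lt_add_of_lt_of_le (mul_lt_mul_of_pos_left this hs)
      (mul_le_mul_of_nonneg_left h2 hs'.le)
  · have : max 0 ((x - a) / (1 - a)) < max 0 ((y - a) / (1 - a)) := by
      rw [max_eq_right (div_nonneg (by linarith) ha'.le)]
      exact lt_max_of_lt_right (by gcongr)
    exact add_lt_add_of_le_of_lt (mul_le_mul_of_nonneg_left h1 hs.le)
      (mul_lt_mul_of_pos_left this hs')

theorem abs_plateau_sub_self_le {a s x : ℝ} (ha : 0 < a) (ha1 : a < 1)
    (hx : x ∈ Icc (0 : ℝ) 1) : |plateau a a s x - x| ≤ |s - a| := by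
  have ha' : 0 < 1 - a := by linarith
  rcases le_total x a with h | h
  · have h1 : min (x / a) 1 = x / a := min_eq_left ((div_le_one ha).2 h)
    have h2 : max 0 ((x - a) / (1 - a)) = 0 :=
      max_eq_left (div_nonpos_of_nonpos_of_nonneg (by linarith) ha'.le)
    have : plateau a a s x - x = (s - a) * (x / a) := by
      rw [plateau, h1, h2]; field_simp; ring
    rw [this, abs_mul, abs_of_nonneg (div_nonneg hx.1 ha.le)]
    exact mul_le_of_le_one_right (abs_nonneg _) ((div_le_one ha).2 h)
  · have h1 : min (x / a) 1 = 1 := min_eq_right ((one_le_div ha).2 h)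
    have h2 : max 0 ((x - a) / (1 - a)) = (x - a) / (1 - a) :=
      max_eq_right (div_nonneg (by linarith) ha'.le)
    have : plateau a a s x - x = (s - a) * ((1 - x) / (1 - a)) := by
      rw [plateau, h1, h2]; field_simp; ring
    rw [this, abs_mul, abs_of_nonneg (div_nonneg (by linarith [hx.2]) ha'.le)]
    exact mul_le_of_le_one_right (abs_nonneg _) ((div_le_one ha').2 (by linarith))

theorem abs_plateau_sub_le {a s c x y : ℝ} (hc : 0 < c) (hca : c ≤ a) (hac : a ≤ 1 - c)
    (hs : s ∈ Icc (0 : ℝ) 1) : |plateau a a s x - plateau a a s y| ≤ |x - y| / c := by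
  wlog hxy : y ≤ x generalizing x y
  · rw [abs_sub_comm, abs_sub_comm x]; exact this (le_of_not_ge hxy)
  rw [abs_of_nonneg (sub_nonneg.2 (plateau_monotone (by linarith) (by linarith) hs hxy)),
    abs_of_nonneg (sub_nonneg.2 hxy)]
  have hd : 0 ≤ x - y := sub_nonneg.2 hxy
  have h1 : min (x / a) 1 ≤ min (y / a) 1 + (x - y) / c := by
    have h : x / a ≤ y / a + (x - y) / c := by
      have : (x - y) / a ≤ (x - y) / c := by gcongr
      rw [sub_div] at this; linarith
    rcases min_cases (y / a) 1 with ⟨e, _⟩ | ⟨e, _⟩ <;> rw [e]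
    · exact (min_le_left _ _).trans h
    · exact (min_le_right _ _).trans (by have := div_nonneg hd hc.le; linarith)
  have h2 : max 0 ((x - a) / (1 - a)) ≤ max 0 ((y - a) / (1 - a)) + (x - y) / c := by
    have h : (x - a) / (1 - a) ≤ (y - a) / (1 - a) + (x - y) / c := by
      have : (x - y) / (1 - a) ≤ (x - y) / c := by gcongr; linarith
      have e : (x - a) / (1 - a) = (y - a) / (1 - a) + (x - y) / (1 - a) := by ring
      linarith
    refine max_le (add_nonneg (le_max_left _ _) (div_nonneg hd hc.le)) (h.trans ?_)
    gcongr
    exact le_max_right _ _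
  have h3 := mul_le_mul_of_nonneg_left h1 hs.1
  have h4 := mul_le_mul_of_nonneg_left h2 (sub_nonneg.2 hs.2)
  unfold plateau
  linarith

/-- The piecewise linear homeomorphism of `[0,1]` moving `a` to `b`. -/
noncomputable def bend (a b x : unitInterval) : unitInterval :=
  projIcc 0 1 zero_le_one (plateau a a b x)

section bend

variable {a b : unitInterval}

theorem coe_bend (ha : 0 < a) (ha1 : a < 1) (x : unitInterval) :
    (bend a b x : ℝ) = plateau a a b x := by
  rw [bend, projIcc_of_mem zero_le_one (plateau_mem ha ha1 ha ha1 b.2 x.2)]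

theorem bend_strictMono (ha : 0 < a) (ha1 : a < 1) (hb : 0 < b) (hb1 : b < 1) :
    StrictMono (bend a b) := fun x y hxy => by
  rw [← Subtype.coe_lt_coe, coe_bend ha ha1, coe_bend ha ha1]
  exact plateau_strictMono ha ha1 hb hb1 hxy

theorem bend_zero (ha : 0 < a) (ha1 : a < 1) : bend a b 0 = 0 :=
  Subtype.ext <| by rw [coe_bend ha ha1]; exact plateau_zero ha ha1

theorem bend_one (ha : 0 < a) (ha1 : a < 1) : bend a b 1 = 1 :=
  Subtype.ext <| by rw [coe_bend ha ha1]; exact plateau_one ha ha1 ha1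

theorem bend_self (ha : 0 < a) (ha1 : a < 1) : bend a b a = b :=
  Subtype.ext <| by rw [coe_bend ha ha1]; exact plateau_eq ha ha1 le_rfl le_rfl

theorem continuous_bend {T : Type*} [TopologicalSpace T] {u v x : T → unitInterval}
    (hv : Continuous v) (hu : Continuous u) (hx : Continuous x) (hv0 : ∀ t, 0 < v t)
    (hv1 : ∀ t, v t < 1) : Continuous fun t => bend (v t) (u t) (x t) := by
  have h0 : ∀ t, (v t : ℝ) ≠ 0 := fun t => (show (0 : ℝ) < v t from hv0 t).ne'
  have h1 : ∀ t, 1 - (v t : ℝ) ≠ 0 := fun t => (sub_pos.2 (show (v t : ℝ) < 1 from hv1 t)).ne'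
  unfold bend plateau
  refine continuous_projIcc.comp ?_
  fun_prop (disch := assumption)

end bend

/-- A homeomorphism of `[0,1]` moving `[c,1-c]` into the `l`-neighbourhood of `s`. -/
noncomputable def compress (l c : ℝ) (s x : unitInterval) : unitInterval :=
  projIcc 0 1 zero_le_one (l * x + (1 - l) * plateau c (1 - c) s x)

section compress

variable {l c : ℝ} {s : unitInterval}

theorem coe_compress (hl : 0 < l) (hl1 : l < 1) (hc : 0 < c) (hc1 : c < 1) (x : unitInterval) :
    (compress l c s x : ℝ) = l * x + (1 - l) * plateau c (1 - c) s x := by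
  have h := plateau_mem (b := 1 - c) hc hc1 (by linarith) (by linarith) s.2 x.2
  have hx := x.2
  rw [compress, projIcc_of_mem zero_le_one]
  constructor
  · have := mul_nonneg hl.le hx.1
    have := mul_nonneg (sub_nonneg.2 hl1.le) h.1
    linarith
  · have := mul_le_mul_of_nonneg_left hx.2 hl.le
    have := mul_le_mul_of_nonneg_left h.2 (sub_nonneg.2 hl1.le)
    linarith

theorem compress_strictMono (hl : 0 < l) (hl1 : l < 1) (hc : 0 < c) (hc1 : c < 1) :
    StrictMono (compress l c s) := fun x y hxy => by
  rw [← Subtype.coe_lt_coe, coe_compress hl hl1 hc hc1, coe_compress hl hl1 hc hc1]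
  exact add_lt_add_of_lt_of_le (mul_lt_mul_of_pos_left hxy hl) (mul_le_mul_of_nonneg_left
    (plateau_monotone hc (by linarith) s.2 (Subtype.coe_le_coe.2 hxy.le)) (by linarith))

theorem compress_zero (hl : 0 < l) (hl1 : l < 1) (hc : 0 < c) (hc1 : c < 1) :
    compress l c s 0 = 0 :=
  Subtype.ext <| by
    have := plateau_zero (a := c) (b := 1 - c) (s := s) (by linarith) (by linarith)
    rw [coe_compress hl hl1 hc hc1]; simp [this]

theorem compress_one (hl : 0 < l) (hl1 : l < 1) (hc : 0 < c) (hc1 : c < 1) :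
    compress l c s 1 = 1 :=
  Subtype.ext <| by
    have := plateau_one (a := c) (b := 1 - c) (s := s) hc hc1 (by linarith)
    rw [coe_compress hl hl1 hc hc1]; simp [this]

theorem abs_compress_sub_le (hl : 0 < l) (hl1 : l < 1) (hc : 0 < c) (hc1 : c < 1)
    {x : unitInterval} (hx : c ≤ x) (hx1 : x ≤ 1 - c) : |(compress l c s x : ℝ) - s| ≤ l := by
  rw [coe_compress hl hl1 hc hc1, plateau_eq hc (by linarith) hx hx1]
  have : l * (x : ℝ) + (1 - l) * s - s = l * (x - s) := by ring
  rw [this, abs_mul, abs_of_pos hl]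
  exact mul_le_of_le_one_right hl.le (abs_sub_le_iff.2
    ⟨by linarith [x.2.2, s.2.1], by linarith [x.2.1, s.2.2]⟩)

theorem continuous_compress (l c : ℝ) {T : Type*} [TopologicalSpace T] {u x : T → unitInterval}
    (hu : Continuous u) (hx : Continuous x) : Continuous fun t => compress l c (u t) (x t) := by
  unfold compress plateau
  refine continuous_projIcc.comp ?_
  fun_prop

end compress

theorem StrictMono.unitInterval_bijective {f : unitInterval → unitInterval} (hm : StrictMono f)
    (hc : Continuous f) (h0 : f 0 = 0) (h1 : f 1 = 1) : Function.Bijective f := by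
  refine ⟨hm.injective, fun y => ?_⟩
  have := intermediate_value_univ (0 : unitInterval) 1 hc
  rw [h0, h1] at this
  exact this ⟨unitInterval.nonneg', unitInterval.le_one'⟩

theorem unitInterval_pos_of_strictMono {f : unitInterval → unitInterval} (hm : StrictMono f)
    (h0 : f 0 = 0) (h1 : f 1 = 1) {x : unitInterval} (hx : 0 < x ∧ x < 1) :
    0 < f x ∧ f x < 1 := by
  have h := hm hx.1
  have h' := hm hx.2
  rw [h0] at h; rw [h1] at h'
  exact ⟨h, h'⟩

/-- If each coordinate `i ∈ P` is moved by an increasing homeomorphism of the interval that depends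
continuously on the coordinates outside of `P`, the result is a homeomorphism of the cube. -/
theorem exists_triangular_homeomorph {ι : Type*} (P : Set ι)
    (f : ι → (ι → unitInterval) → unitInterval → unitInterval)
    (hc : ∀ i ∈ P, Continuous fun q : (ι → unitInterval) × unitInterval => f i q.1 q.2)
    (hdep : ∀ i ∈ P, ∀ x y : ι → unitInterval, (∀ j ∉ P, x j = y j) → f i x = f i y)
    (hm : ∀ i ∈ P, ∀ x, StrictMono (f i x)) (h0 : ∀ i ∈ P, ∀ x, f i x 0 = 0)
    (h1 : ∀ i ∈ P, ∀ x, f i x 1 = 1) :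
    ∃ Φ : (ι → unitInterval) ≃ₜ (ι → unitInterval),
      (∀ x, ∀ i ∈ P, Φ x i = f i x (x i)) ∧ ∀ x, ∀ i ∉ P, Φ x i = x i := by
  classical
  let F : (ι → unitInterval) → (ι → unitInterval) := fun x i =>
    if i ∈ P then f i x (x i) else x i
  have hF : ∀ x, ∀ i ∈ P, F x i = f i x (x i) := fun x i hi => if_pos hi
  have hF' : ∀ x, ∀ i ∉ P, F x i = x i := fun x i hi => if_neg hi
  have hbij : ∀ i ∈ P, ∀ x, Function.Bijective (f i x) := fun i hi x =>
    (hm i hi x).unitInterval_bijective ((hc i hi).comp (by fun_prop : Continuous fun t => (x, t)))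
      (h0 i hi x) (h1 i hi x)
  have hcont : Continuous F := by
    refine continuous_pi fun i => ?_
    by_cases hi : i ∈ P
    · simp only [hF _ i hi]
      exact (hc i hi).comp (by fun_prop : Continuous fun x : ι → unitInterval => (x, x i))
    · simp only [hF' _ i hi]; fun_prop
  have hinj : Function.Injective F := by
    intro x y hxy
    have hoff : ∀ j ∉ P, x j = y j := fun j hj => by
      rw [← hF' x j hj, ← hF' y j hj, hxy]
    funext i
    by_cases hi : i ∈ P
    · have := congrFun hxy i
      rw [hF _ i hi, hF _ i hi, hdep i hi x y hoff] at this
      exact (hm i hi y).injective this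
    · exact hoff i hi
  have hsurj : Function.Surjective F := by
    intro y
    choose! g hg using fun i (hi : i ∈ P) => (hbij i hi y).2 (y i)
    let x : ι → unitInterval := fun i => if i ∈ P then g i else y i
    have hx : ∀ j ∉ P, x j = y j := fun j hj => if_neg hj
    refine ⟨x, funext fun i => ?_⟩
    by_cases hi : i ∈ P
    · rw [hF _ i hi, hdep i hi x y hx, show x i = g i from if_pos hi, hg i hi]
    · rw [hF' _ i hi, hx i hi]
  refine ⟨Continuous.homeoOfEquivCompactToT2 (f := Equiv.ofBijective F ⟨hinj, hsurj⟩) hcont,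
    hF, hF'⟩

/-! ### Extending homeomorphisms between sets of infinite deficiency -/

/-- The midpoint of the unit interval. -/
noncomputable def midpt : unitInterval := ⟨2⁻¹, by norm_num, by norm_num⟩

theorem midpt_mem : 0 < midpt ∧ midpt < 1 := by
  constructor <;> rw [← Subtype.coe_lt_coe] <;> norm_num [midpt]

/-- Permutation of the coordinates of a cube. -/
def reindex {α β : Type*} (e : α ≃ β) : (β → unitInterval) ≃ₜ (α → unitInterval) where
  toFun x i := x (e i)
  invFun x i := x (e.symm i)
  left_inv x := by simp
  right_inv x := by simp
  continuous_toFun := by fun_prop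
  continuous_invFun := by fun_prop

theorem exists_homeomorph_graph {α β : Type*} {V U : (α → unitInterval) → (β → unitInterval)}
    (hV : Continuous V) (hU : Continuous U) (hV' : ∀ a i, 0 < V a i ∧ V a i < 1)
    (hU' : ∀ a i, 0 < U a i ∧ U a i < 1) :
    ∃ Φ : (α ⊕ β → unitInterval) ≃ₜ (α ⊕ β → unitInterval),
      ∀ a, Φ (Sum.elim a (V a)) = Sum.elim a (U a) := by
  obtain ⟨Φ, h, h'⟩ := exists_triangular_homeomorph (range (Sum.inr : β → α ⊕ β))
    (fun i x t => Sum.elim (fun _ => t)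
      (fun j => bend (V (fun k => x (.inl k)) j) (U (fun k => x (.inl k)) j) t) i)
    (by
      rintro _ ⟨j, rfl⟩
      exact continuous_bend (by fun_prop) (by fun_prop) (by fun_prop) (fun _ => (hV' _ _).1)
        (fun _ => (hV' _ _).2))
    (by
      rintro _ ⟨j, rfl⟩ x y hxy
      have : (fun k => x (.inl k)) = fun k => y (.inl k) := funext fun k => hxy _ (by simp)
      funext t
      simp only [Sum.elim_inr, this])
    (by
      rintro _ ⟨j, rfl⟩ x
      exact bend_strictMono (hV' _ _).1 (hV' _ _).2 (hU' _ _).1 (hU' _ _).2)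
    (by rintro _ ⟨j, rfl⟩ x; exact bend_zero (hV' _ _).1 (hV' _ _).2)
    (by rintro _ ⟨j, rfl⟩ x; exact bend_one (hV' _ _).1 (hV' _ _).2)
  refine ⟨Φ, fun a => funext fun i => ?_⟩
  rcases i with i | j
  · rw [h' _ _ (by simp)]; simp
  · rw [h _ _ (mem_range_self j)]
    exact bend_self (hV' _ _).1 (hV' _ _).2

theorem exists_extension_interior {A α β : Type*} [TopologicalSpace A] [CompactSpace A]
    {p : A → α → unitInterval} {q : A → β → unitInterval} (hp : Continuous p)
    (hpi : Function.Injective p) (hq : Continuous q) (hq' : ∀ a i, 0 < q a i ∧ q a i < 1) :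
    ∃ U : (α → unitInterval) → (β → unitInterval), Continuous U ∧
      (∀ t i, 0 < U t i ∧ U t i < 1) ∧ ∀ a, U (p a) = q a := by
  have hpe := hp.isClosedEmbedding hpi
  have H : ∀ i, ∃ g : C(α → unitInterval, ℝ), (∀ t, g t ∈ Ioo (0 : ℝ) 1) ∧
      g ∘ p = fun a => (q a i : ℝ) := fun i =>
    ContinuousMap.exists_extension_forall_mem_of_isClosedEmbedding
      ⟨fun a => (q a i : ℝ), by fun_prop⟩ (t := Ioo (0 : ℝ) 1) (hq' · i)
      ⟨2⁻¹, by norm_num, by norm_num⟩ hpe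
  choose g hg hgq using H
  refine ⟨fun t i => ⟨g i t, (hg i t).1.le, (hg i t).2.le⟩, by fun_prop, fun t i => hg i t,
    fun a => funext fun i => Subtype.ext (congrFun (hgq i) a)⟩

/-- `K` can be moved by a homeomorphism to a set all of whose points have infinitely many
coordinates equal to `1/2` and the remaining ones in the interior of the interval. -/
def IsDeficient (K : Set HCube) : Prop :=
  ∃ Θ : HCube ≃ₜ (ℕ ⊕ ℕ → unitInterval), ∀ x ∈ K,
    (∀ i, 0 < Θ x (.inl i) ∧ Θ x (.inl i) < 1) ∧ ∀ i, Θ x (.inr i) = midpt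

/-- Klee's trick: homeomorphisms between compacta of infinite deficiency extend. -/
theorem IsDeficient.exists_extension {K L : Set HCube} (hK : IsDeficient K) (hL : IsDeficient L)
    (hKc : IsClosed K) (φ : K ≃ₜ L) : ∃ Φ : HCube ≃ₜ HCube, ∀ x : K, Φ x = φ x := by
  obtain ⟨S, hS⟩ := hK
  obtain ⟨T, hT⟩ := hL
  have : CompactSpace K := isCompact_iff_compactSpace.1 hKc.isCompact
  let p : K → ℕ → unitInterval := fun x i => S x (.inl i)
  let q : K → ℕ → unitInterval := fun x i => T (φ x) (.inl i)
  have hSp : ∀ x : K, S x = Sum.elim (p x) fun _ => midpt := fun x => funext fun i => by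
    rcases i with i | i
    · rfl
    · exact (hS x x.2).2 i
  have hTq : ∀ x : K, T (φ x) = Sum.elim (q x) fun _ => midpt := fun x => funext fun i => by
    rcases i with i | i
    · rfl
    · exact (hT _ (φ x).2).2 i
  have hp : Continuous p := by fun_prop
  have hq : Continuous q := by fun_prop
  have hpi : Function.Injective p := fun x y h =>
    Subtype.ext (S.injective (by rw [hSp, hSp, h]))
  have hqi : Function.Injective q := fun x y h =>
    φ.injective (Subtype.ext (T.injective (by rw [hTq, hTq, h])))
  obtain ⟨U, hU, hU', hUp⟩ := exists_extension_interior hp hpi hq fun x i => (hT _ (φ x).2).1 i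
  obtain ⟨V, hV, hV', hVq⟩ := exists_extension_interior hq hqi hp fun x i => (hS _ x.2).1 i
  have hm : ∀ (_ : ℕ → unitInterval) (_ : ℕ), 0 < midpt ∧ midpt < 1 := fun _ _ => midpt_mem
  obtain ⟨A, hA⟩ := exists_homeomorph_graph (V := fun _ _ => midpt) continuous_const hU hm hU'
  obtain ⟨B, hB⟩ := exists_homeomorph_graph (U := fun _ _ => midpt) hV continuous_const hV' hm
  refine ⟨((S.trans A).trans ((reindex (Equiv.sumComm ℕ ℕ)).trans B)).trans T.symm, fun x => ?_⟩
  have hswap : reindex (Equiv.sumComm ℕ ℕ) (Sum.elim (p x) (q x)) = Sum.elim (q x) (p x) :=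
    funext fun i => by rcases i with i | i <;> rfl
  have hA' := hA (p x)
  have hB' := hB (q x)
  rw [hUp] at hA'
  rw [hVq] at hB'
  simp only [Homeomorph.trans_apply]
  rw [hSp, hA', hswap, hB', ← hTq, Homeomorph.symm_apply_apply]

theorem exists_pos_le_of_isCompact {X : Type*} [TopologicalSpace X] {K : Set X}
    (hK : IsCompact K) {f : X → unitInterval} (hf : Continuous f)
    (h : ∀ x ∈ K, 0 < f x ∧ f x < 1) :
    ∃ c : ℝ, 0 < c ∧ c < 1 ∧ ∀ x ∈ K, c ≤ f x ∧ (f x : ℝ) ≤ 1 - c := by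
  rcases K.eq_empty_or_nonempty with rfl | hne
  · exact ⟨2⁻¹, by norm_num, by norm_num, by simp⟩
  have hg : Continuous fun x => min (f x : ℝ) (1 - f x) := by fun_prop
  obtain ⟨x₀, hx₀, hmin⟩ := hK.exists_isMinOn hne hg.continuousOn
  have h0 : (0 : ℝ) < f x₀ := (h x₀ hx₀).1
  have h1 : (f x₀ : ℝ) < 1 := (h x₀ hx₀).2
  refine ⟨min (f x₀ : ℝ) (1 - f x₀), lt_min h0 (by linarith), min_lt_of_left_lt h1,
    fun x hx => ?_⟩
  have := isMinOn_iff.1 hmin x hx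
  exact ⟨this.trans (min_le_left _ _), by linarith [this.trans (min_le_right _ _)]⟩

/-- A compact subset of the pseudo-interior has infinite deficiency. -/
theorem isDeficient_of_interior {K : Set HCube} (hK : IsClosed K)
    (h : ∀ x ∈ K, ∀ i, 0 < x i ∧ x i < 1) : IsDeficient K := by
  have : CompactSpace K := isCompact_iff_compactSpace.1 hK.isCompact
  let e : ℕ ⊕ ℕ × ℕ ≃ ℕ := (Equiv.sumCongr (.refl ℕ) Nat.pairEquiv).trans Equiv.natSumNatEquivNat
  have hc' := fun i => exists_pos_le_of_isCompact hK.isCompact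
    (continuous_apply i : Continuous fun x : HCube => x i) fun x hx => h x hx i
  choose c hc hc1 hcK using hc'
  let l : ℕ → ℝ := fun m => 1 / ((m : ℝ) + 2)
  have hl : ∀ m, 0 < l m := fun m => by positivity
  have hl1 : ∀ m, l m < 1 := fun m => by
    rw [div_lt_one (by positivity)]; linarith [m.cast_nonneg (α := ℝ)]
  obtain ⟨Ψ, hΨ, hΨ'⟩ := exists_triangular_homeomorph
    (range (Sum.inr : ℕ × ℕ → ℕ ⊕ ℕ × ℕ))
    (fun i x t => Sum.elim (fun _ => t)
      (fun j => compress (l j.2) (c (e (.inr j))) (x (.inl j.1)) t) i)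
    (by rintro _ ⟨j, rfl⟩; exact continuous_compress _ _ (by fun_prop) (by fun_prop))
    (by
      rintro _ ⟨j, rfl⟩ x y hxy
      funext t
      simp only [Sum.elim_inr, hxy (.inl j.1) (by simp)])
    (by rintro _ ⟨j, rfl⟩ x; exact compress_strictMono (hl _) (hl1 _) (hc _) (hc1 _))
    (by rintro _ ⟨j, rfl⟩ x; exact compress_zero (hl _) (hl1 _) (hc _) (hc1 _))
    (by rintro _ ⟨j, rfl⟩ x; exact compress_one (hl _) (hl1 _) (hc _) (hc1 _))
  let R := (reindex e).trans Ψ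
  have hinl : ∀ (x : HCube) j, R x (.inl j) = x (e (.inl j)) := fun x j => hΨ' _ _ (by simp)
  have hinr : ∀ (x : HCube) j, R x (.inr j) =
      compress (l j.2) (c (e (.inr j))) (x (e (.inl j.1))) (x (e (.inr j))) := fun x j =>
    hΨ _ _ (mem_range_self j)
  let p : K → ℕ × ℕ → unitInterval := fun x j => R x (.inr j)
  let q : K → ℕ → unitInterval := fun x j => R x (.inl j)
  have hpi : Function.Injective p := by
    intro x y hxy
    have hleft : ∀ j, (x : HCube) (e (.inl j)) = (y : HCube) (e (.inl j)) := by
      intro j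
      refine Subtype.ext (eq_of_abs_sub_le_all fun ε hε => ?_)
      obtain ⟨m, hm⟩ := exists_nat_one_div_lt (half_pos hε)
      have hlm : l m < ε / 2 := lt_of_le_of_lt (by unfold l; gcongr; norm_num) hm
      have hx := abs_compress_sub_le (s := (x : HCube) (e (.inl j))) (hl m) (hl1 m)
        (hc (e (.inr (j, m)))) (hc1 _) (hcK _ x x.2).1 (hcK _ x x.2).2
      have hy := abs_compress_sub_le (s := (y : HCube) (e (.inl j))) (hl m) (hl1 m)
        (hc (e (.inr (j, m)))) (hc1 _) (hcK _ y y.2).1 (hcK _ y y.2).2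
      have hxy' : R x (.inr (j, m)) = R y (.inr (j, m)) := congrFun hxy (j, m)
      rw [hinr, hinr] at hxy'
      rw [hxy'] at hx
      rw [abs_le] at *
      constructor <;> linarith [hx.1, hx.2, hy.1, hy.2]
    refine Subtype.ext (R.injective (funext fun i => ?_))
    rcases i with j | j
    · rw [hinl, hinl, hleft]
    · exact congrFun hxy j
  obtain ⟨U, hU, hU', hUp⟩ := exists_extension_interior (p := p) (q := q) (by fun_prop) hpi
    (by fun_prop) fun x i => by
      simp only [q, hinl]; exact h x x.2 _
  obtain ⟨A, hA⟩ := exists_homeomorph_graph (U := fun _ _ => midpt) hU continuous_const hU'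
    fun _ _ => midpt_mem
  refine ⟨R.trans ((reindex (Equiv.sumComm (ℕ × ℕ) ℕ)).trans
    (A.trans (reindex (Equiv.sumCongr Nat.pairEquiv.symm (.refl ℕ))))), fun x hx => ?_⟩
  have hRx : reindex (Equiv.sumComm (ℕ × ℕ) ℕ) (R x) =
      Sum.elim (p ⟨x, hx⟩) (U (p ⟨x, hx⟩)) := by
    rw [hUp]; exact funext fun i => by rcases i with i | i <;> rfl
  have hall : A (reindex (Equiv.sumComm (ℕ × ℕ) ℕ) (R x)) =
      Sum.elim (p ⟨x, hx⟩) fun _ => midpt := by rw [hRx, hA]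
  simp only [Homeomorph.trans_apply, hall]
  refine ⟨fun i => ?_, fun i => rfl⟩
  change 0 < R x (.inr _) ∧ R x (.inr _) < 1
  rw [hinr]
  exact unitInterval_pos_of_strictMono (compress_strictMono (hl _) (hl1 _) (hc _) (hc1 _))
    (compress_zero (hl _) (hl1 _) (hc _) (hc1 _)) (compress_one (hl _) (hl1 _) (hc _) (hc1 _))
    (h x hx _)

/-! ### Pushing Z-sets into the pseudo-interior -/

theorem exists_corner_homeomorph {c d : ℝ} (hc : 0 < c) (hc1 : c < 1) (hd : 0 < d) (hd1 : d < 1) :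
    ∃ κ : unitInterval × unitInterval ≃ₜ unitInterval × unitInterval,
      (∀ q, |((κ q).1 : ℝ) - q.1| ≤ c ∧ |((κ q).2 : ℝ) - q.2| ≤ d) ∧
      (∀ y : unitInterval, (y : ℝ) ≤ d → ((κ (0, y)).1 : ℝ) = c * (1 - y / d)) ∧
      ∀ x : unitInterval, ((κ (x, 0)).1 : ℝ) = c + (1 - c) * x ∧ (κ (x, 0)).2 = 0 := by
  let l : ℝ → ℝ := fun y => c * max 0 (1 - y / d)
  let f : ℝ → ℝ := fun x => d * max 0 (1 - x / c)
  have hlc : Continuous l := by fun_prop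
  have hfc : Continuous f := by fun_prop
  have hl0 : ∀ y, 0 ≤ l y := fun y => mul_nonneg hc.le (le_max_left _ _)
  have hf0 : ∀ y, 0 ≤ f y := fun y => mul_nonneg hd.le (le_max_left _ _)
  have hlle : ∀ y, 0 ≤ y → l y ≤ c := fun y hy => mul_le_of_le_one_right hc.le
    (max_le zero_le_one (by have := div_nonneg hy hd.le; linarith))
  have hfle : ∀ x, 0 ≤ x → f x ≤ d := fun x hx => mul_le_of_le_one_right hd.le
    (max_le zero_le_one (by have := div_nonneg hx hc.le; linarith))
  have hlf : ∀ x y, 0 ≤ x → l y ≤ x → 0 ≤ y → f x ≤ y := by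
    intro x y hx hxy hy
    have h1 : c * (1 - y / d) ≤ x := (mul_le_mul_of_nonneg_left (le_max_right _ _) hc.le).trans hxy
    have h2 : 1 - x / c ≤ y / d := by
      have : 1 - y / d ≤ x / c := by rw [le_div_iff₀ hc]; linarith
      linarith
    have h3 : max 0 (1 - x / c) ≤ y / d := max_le (div_nonneg hy hd.le) h2
    calc f x ≤ d * (y / d) := mul_le_mul_of_nonneg_left h3 hd.le
      _ = y := by field_simp
  have hfl : ∀ x y, 0 ≤ x → f x ≤ y → l y ≤ x := by
    intro x y hx hxy
    have h1 : d * (1 - x / c) ≤ y := (mul_le_mul_of_nonneg_left (le_max_right _ _) hd.le).trans hxy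
    have h2 : 1 - y / d ≤ x / c := by
      have : 1 - x / c ≤ y / d := by rw [le_div_iff₀ hd]; linarith
      linarith
    have h3 : max 0 (1 - y / d) ≤ x / c := max_le (div_nonneg hx hc.le) h2
    calc l y ≤ c * (x / c) := mul_le_mul_of_nonneg_left h3 hc.le
      _ = x := by field_simp
  let X : ℝ → ℝ → ℝ := fun x y => l y + (1 - l y) * x
  let Y : ℝ → ℝ → ℝ := fun x y => (y - f x) / (1 - f x)
  let X' : ℝ → ℝ → ℝ := fun x y => (x - l y) / (1 - l y)
  let Y' : ℝ → ℝ → ℝ := fun x y => f x + (1 - f x) * y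
  have hX : ∀ x ∈ Icc (0 : ℝ) 1, ∀ y ∈ Icc (0 : ℝ) 1, X x y ∈ Icc (0 : ℝ) 1 ∧ l y ≤ X x y := by
    intro x hx y hy
    have h1 := hl0 y
    have h2 := hlle y hy.1
    have h3 : 0 ≤ (1 - l y) * x := mul_nonneg (by linarith) hx.1
    have h4 : (1 - l y) * x ≤ 1 - l y := mul_le_of_le_one_right (by linarith) hx.2
    exact ⟨⟨by dsimp only [X]; linarith, by dsimp only [X]; linarith⟩, by dsimp only [X]; linarith⟩
  have hY : ∀ x ∈ Icc (0 : ℝ) 1, ∀ y ∈ Icc (0 : ℝ) 1, l y ≤ x → Y x y ∈ Icc (0 : ℝ) 1 := by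
    intro x hx y hy h
    have h1 := hlf x y hx.1 h hy.1
    have h2 := hfle x hx.1
    have h3 : 0 < 1 - f x := by linarith
    exact ⟨div_nonneg (by linarith) h3.le, (div_le_one h3).2 (by linarith [hy.2])⟩
  have hY' : ∀ x ∈ Icc (0 : ℝ) 1, ∀ y ∈ Icc (0 : ℝ) 1, Y' x y ∈ Icc (0 : ℝ) 1 ∧ f x ≤ Y' x y := by
    intro x hx y hy
    have h1 := hf0 x
    have h2 := hfle x hx.1
    have h3 : 0 ≤ (1 - f x) * y := mul_nonneg (by linarith) hy.1
    have h4 : (1 - f x) * y ≤ 1 - f x := mul_le_of_le_one_right (by linarith) hy.2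
    exact ⟨⟨by dsimp only [Y']; linarith, by dsimp only [Y']; linarith⟩,
      by dsimp only [Y']; linarith⟩
  have hX' : ∀ x ∈ Icc (0 : ℝ) 1, ∀ y ∈ Icc (0 : ℝ) 1, f x ≤ y → X' x y ∈ Icc (0 : ℝ) 1 := by
    intro x hx y hy h
    have h1 := hfl x y hx.1 h
    have h2 := hlle y hy.1
    have h3 : 0 < 1 - l y := by linarith
    exact ⟨div_nonneg (by linarith) h3.le, (div_le_one h3).2 (by linarith [hx.2])⟩
  have hl1 : ∀ y ∈ Icc (0 : ℝ) 1, 1 - l y ≠ 0 := fun y hy => by linarith [hlle y hy.1]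
  have hf1 : ∀ x ∈ Icc (0 : ℝ) 1, 1 - f x ≠ 0 := fun x hx => by linarith [hfle x hx.1]
  let κ : unitInterval × unitInterval ≃ unitInterval × unitInterval :=
    { toFun q := (⟨X q.1 q.2, (hX _ q.1.2 _ q.2.2).1⟩, ⟨Y (X q.1 q.2) q.2,
        hY _ (hX _ q.1.2 _ q.2.2).1 _ q.2.2 (hX _ q.1.2 _ q.2.2).2⟩)
      invFun q := (⟨X' q.1 (Y' q.1 q.2), hX' _ q.1.2 _ (hY' _ q.1.2 _ q.2.2).1
        (hY' _ q.1.2 _ q.2.2).2⟩, ⟨Y' q.1 q.2, (hY' _ q.1.2 _ q.2.2).1⟩)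
      left_inv q := by
        have e : Y' (X q.1 q.2) (Y (X q.1 q.2) q.2) = q.2 := by
          have := hf1 _ (hX _ q.1.2 _ q.2.2).1
          dsimp only [Y', Y]
          rw [mul_div_cancel₀ _ this]; ring
        refine Prod.ext (Subtype.ext ?_) (Subtype.ext e)
        have := hl1 _ q.2.2
        dsimp only
        rw [e]
        dsimp only [X', X]
        field_simp
        ring
      right_inv q := by
        have e : X (X' q.1 (Y' q.1 q.2)) (Y' q.1 q.2) = q.1 := by
          have := hl1 _ (hY' _ q.1.2 _ q.2.2).1
          dsimp only [X, X']
          rw [mul_div_cancel₀ _ this]; ring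
        refine Prod.ext (Subtype.ext e) (Subtype.ext ?_)
        have := hf1 _ q.1.2
        dsimp only
        rw [e]
        dsimp only [Y', Y]
        field_simp
        ring }
  have hκ : Continuous κ := by
    have hXc : Continuous fun q : unitInterval × unitInterval => X q.1 q.2 := by fun_prop
    refine (hXc.subtype_mk _).prodMk (Continuous.subtype_mk ?_ _)
    exact ((by fun_prop : Continuous fun q : unitInterval × unitInterval => (q.2 : ℝ)).sub
      (hfc.comp hXc)).div (continuous_const.sub (hfc.comp hXc))
      fun q => hf1 _ (hX _ q.1.2 _ q.2.2).1
  refine ⟨hκ.homeoOfEquivCompactToT2, fun q => ⟨?_, ?_⟩, fun y hy => ?_, fun x => ?_⟩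
  · change |X q.1 q.2 - q.1| ≤ c
    have h1 := hl0 q.2
    have h2 := hlle q.2 q.2.2.1
    have : X q.1 q.2 - q.1 = l q.2 * (1 - q.1) := by dsimp only [X]; ring
    have h3 : (0 : ℝ) ≤ 1 - q.1 := sub_nonneg.2 q.1.2.2
    rw [this, abs_of_nonneg (mul_nonneg h1 h3)]
    exact (mul_le_of_le_one_right h1 (by linarith [q.1.2.1])).trans h2
  · change |Y (X q.1 q.2) q.2 - q.2| ≤ d
    obtain ⟨hx, hlx⟩ := hX _ q.1.2 _ q.2.2
    set x := X q.1 q.2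
    have h1 := hf0 x
    have h2 := hfle x hx.1
    have h3 : 0 < 1 - f x := by linarith
    have h4 := hlf x q.2 hx.1 hlx q.2.2.1
    have : Y x q.2 - q.2 = - (f x * ((1 - q.2) / (1 - f x))) := by
      dsimp only [Y]; field_simp; ring
    have h5 : 0 ≤ (1 - (q.2 : ℝ)) / (1 - f x) := div_nonneg (sub_nonneg.2 q.2.2.2) h3.le
    rw [this, abs_neg, abs_of_nonneg (mul_nonneg h1 h5)]
    exact (mul_le_of_le_one_right h1 ((div_le_one h3).2 (by linarith))).trans h2
  · change c * max 0 (1 - y / d) + (1 - c * max 0 (1 - y / d)) * 0 = _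
    rw [max_eq_right (by rw [sub_nonneg, div_le_one hd]; exact hy)]; ring
  · have e : X x 0 = c + (1 - c) * x := by simp [X, l]
    have e' : f (c + (1 - c) * x) = 0 := by
      have : 1 - (c + (1 - c) * x) / c ≤ 0 := by
        rw [sub_nonpos, one_le_div hc]
        have := mul_nonneg (by linarith : 0 ≤ 1 - c) x.2.1
        linarith
      dsimp only [f]
      rw [max_eq_left this, mul_zero]
    refine ⟨e, Subtype.ext ?_⟩
    change Y (X x 0) 0 = 0
    rw [e]
    simp [Y, e']

theorem exists_inset_homeomorph {ε : ℝ} (hε : 0 < ε) :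
    ∃ θ : unitInterval × unitInterval ≃ₜ unitInterval × unitInterval, ∃ c : ℝ, 0 < c ∧
      (∀ q, |((θ q).1 : ℝ) - q.1| ≤ ε ∧ |((θ q).2 : ℝ) - q.2| ≤ ε) ∧
      ∀ x : unitInterval, c ≤ (θ (x, 0)).1 ∧ ((θ (x, 0)).1 : ℝ) ≤ 1 - c ∧ (θ (x, 0)).2 = 0 := by
  let c := min (ε / 2) 2⁻¹
  have hc : 0 < c := lt_min (half_pos hε) (by norm_num)
  have hc1 : c < 1 := (min_le_right _ _).trans_lt (by norm_num)
  have hcε : c ≤ ε / 2 := min_le_left _ _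
  obtain ⟨κ, hκ, -, hκ0⟩ := exists_corner_homeomorph hc hc1 hc hc1
  let F : unitInterval × unitInterval ≃ₜ unitInterval × unitInterval :=
    unitInterval.symmHomeomorph.prodCongr (Homeomorph.refl _)
  have hF1 : ∀ q, ((F q).1 : ℝ) = 1 - q.1 := fun q => rfl
  have hF2 : ∀ q, (F q).2 = q.2 := fun q => rfl
  refine ⟨(κ.trans F).trans (κ.trans F), (1 - c) * c, mul_pos (by linarith) hc,
    fun q => ⟨?_, ?_⟩, fun x => ?_⟩
  · have h1 := abs_le.1 (hκ q).1
    have h2 := abs_le.1 (hκ (F (κ q))).1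
    simp only [Homeomorph.trans_apply, hF1] at *
    exact abs_le.2 ⟨by linarith, by linarith⟩
  · have h1 := abs_le.1 (hκ q).2
    have h2 := abs_le.1 (hκ (F (κ q))).2
    simp only [Homeomorph.trans_apply, hF2] at *
    exact abs_le.2 ⟨by linarith, by linarith⟩
  · obtain ⟨h1, h2⟩ := hκ0 x
    have e : F (κ (x, 0)) = ((F (κ (x, 0))).1, 0) := Prod.ext rfl ((hF2 _).trans h2)
    obtain ⟨h3, h4⟩ := hκ0 (F (κ (x, 0))).1
    rw [← e] at h3 h4
    simp only [Homeomorph.trans_apply, hF2, hF1, h3, h4, h1, and_true]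
    have h0 := x.2.1
    have hx1 := x.2.2
    constructor
    · nlinarith [mul_nonneg (mul_nonneg (by linarith : 0 ≤ 1 - c) (by linarith : 0 ≤ 1 - c)) h0]
    · nlinarith [mul_nonneg (mul_nonneg (by linarith : 0 ≤ 1 - c) (by linarith : 0 ≤ 1 - c))
        (sub_nonneg.2 hx1), mul_pos hc hc]

/-- A homeomorphism of the square acting on the coordinates `i` and `j` of the cube. -/
theorem exists_homeomorph_pair {i j : ℕ} (hij : i ≠ j)
    (κ : unitInterval × unitInterval ≃ₜ unitInterval × unitInterval) :
    ∃ Φ : HCube ≃ₜ HCube, ∀ x, Φ x i = (κ (x i, x j)).1 ∧ Φ x j = (κ (x i, x j)).2 ∧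
      ∀ k, k ≠ i → k ≠ j → Φ x k = x k := by
  have inv : ∀ (κ κ' : unitInterval × unitInterval ≃ₜ unitInterval × unitInterval),
      (∀ q, κ' (κ q) = q) → ∀ x : HCube,
      (fun x : HCube => Function.update (Function.update x i (κ' (x i, x j)).1) j
        (κ' (x i, x j)).2) (Function.update (Function.update x i (κ (x i, x j)).1) j
        (κ (x i, x j)).2) = x := by
    intro κ κ' h x
    funext k
    by_cases hj : k = j
    · subst hj; simp [hij, h]
    · by_cases hi : k = i
      · subst hi; simp [hij, h]
      · simp [hi, hj]
  refine ⟨{ toFun x := Function.update (Function.update x i (κ (x i, x j)).1) j (κ (x i, x j)).2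
            invFun x := Function.update (Function.update x i (κ.symm (x i, x j)).1) j
              (κ.symm (x i, x j)).2
            left_inv := inv κ κ.symm κ.symm_apply_apply
            right_inv := inv κ.symm κ κ.apply_symm_apply
            continuous_toFun := by fun_prop
            continuous_invFun := by fun_prop }, fun x => ⟨?_, ?_, fun k hi hj => ?_⟩⟩
  · simp [hij]
  · simp
  · simp [hi, hj]

theorem exists_spread_face (i₀ r : ℕ) {ε : ℝ} (hε : 0 < ε) :
    ∃ k : HCube ≃ₜ HCube, ∃ c : ℝ, 0 < c ∧ (∀ x i, |(k x i : ℝ) - x i| ≤ ε) ∧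
      ∀ x : HCube, x i₀ = 0 → k x i₀ = 0 ∧
        ∀ i < r, i ≠ i₀ → c ≤ k x i ∧ (k x i : ℝ) ≤ 1 - c := by
  induction r generalizing ε with
  | zero => exact ⟨.refl _, 1, one_pos, by simp [hε.le], by simp⟩
  | succ r ih =>
    by_cases hr : r = i₀
    · obtain ⟨k, c, hc, hk, hk'⟩ := ih hε
      refine ⟨k, c, hc, hk, fun x hx => ⟨(hk' x hx).1, fun i hi hne => (hk' x hx).2 i ?_ hne⟩⟩
      omega
    · obtain ⟨k, c, hc, hk, hk'⟩ := ih (half_pos hε)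
      obtain ⟨θ, c', hc', hθ, hθ'⟩ := exists_inset_homeomorph (half_pos hε)
      obtain ⟨Φ, hΦ⟩ := exists_homeomorph_pair hr θ
      refine ⟨k.trans Φ, min c c', lt_min hc hc', fun x i => ?_, fun x hx => ?_⟩
      · refine (abs_sub_le _ (k x i : ℝ) _).trans ?_
        have : |(Φ (k x) i : ℝ) - k x i| ≤ ε / 2 := by
          by_cases h1 : i = r
          · rw [h1, (hΦ _).1]; exact (hθ _).1
          · by_cases h2 : i = i₀
            · rw [h2, (hΦ _).2.1]; exact (hθ _).2
            · rw [(hΦ _).2.2 i h1 h2, sub_self, abs_zero]; positivity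
        rw [Homeomorph.trans_apply]
        linarith [hk x i]
      · obtain ⟨h0, h1⟩ := hk' x hx
        rw [Homeomorph.trans_apply]
        have h2 := hθ' (k x r)
        rw [← h0] at h2
        refine ⟨by rw [(hΦ _).2.1, h2.2.2, h0], fun i hi hne => ?_⟩
        by_cases h3 : i = r
        · rw [h3, (hΦ _).1]
          exact ⟨(min_le_right _ _).trans h2.1, h2.2.1.trans (by linarith [min_le_right c c'])⟩
        · rw [(hΦ _).2.2 i h3 hne]
          obtain ⟨h4, h5⟩ := h1 i (by omega) hne
          exact ⟨(min_le_left _ _).trans h4, h5.trans (by linarith [min_le_left c c'])⟩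

theorem exists_push_face {i₀ r : ℕ} (hi₀ : i₀ < r) {ε : ℝ} (hε : 0 < ε) :
    ∃ k : HCube ≃ₜ HCube, ∃ c : ℝ, 0 < c ∧ (∀ x, ∀ i < r, |(k x i : ℝ) - x i| ≤ ε) ∧
      ∀ x : HCube, x i₀ = 0 → ∀ i < r, c ≤ k x i ∧ (k x i : ℝ) ≤ 1 - c := by
  obtain ⟨k, c, hc, hk, hk'⟩ := exists_spread_face i₀ (r + 1) (half_pos hε)
  let b := min c 2⁻¹
  have hb : 0 < b := lt_min hc (by norm_num)
  have hb1 : b ≤ 2⁻¹ := min_le_right _ _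
  have hbc : b ≤ c := min_le_left _ _
  let e := min (ε / 2) 2⁻¹
  have he : 0 < e := lt_min (half_pos hε) (by norm_num)
  have he1 : e ≤ 2⁻¹ := min_le_right _ _
  have hd : 0 < 1 - b / 2 := by linarith
  obtain ⟨κ, hκ, hκ0, -⟩ := exists_corner_homeomorph he (he1.trans_lt (by norm_num)) hd
    (by linarith : 1 - b / 2 < 1)
  obtain ⟨Φ, hΦ⟩ := exists_homeomorph_pair hi₀.ne κ
  have hpos : 0 < e * (b / 2) := by positivity
  refine ⟨k.trans Φ, min c (e * (b / 2)), lt_min hc hpos, fun x i hi => ?_, fun x hx i hi => ?_⟩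
  · refine (abs_sub_le _ (k x i : ℝ) _).trans ?_
    have : |(Φ (k x) i : ℝ) - k x i| ≤ ε / 2 := by
      by_cases h1 : i = i₀
      · rw [h1, (hΦ _).1]; exact (hκ _).1.trans (min_le_left _ _)
      · rw [(hΦ _).2.2 i h1 hi.ne, sub_self, abs_zero]; positivity
    rw [Homeomorph.trans_apply]
    linarith [hk x i]
  · obtain ⟨h0, h1⟩ := hk' x hx
    rw [Homeomorph.trans_apply]
    by_cases h3 : i = i₀
    · obtain ⟨-, h5⟩ := h1 r (by omega) hi₀.ne'
      have hy : (k x r : ℝ) ≤ 1 - b := h5.trans (by linarith)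
      have hy0 := (k x r).2.1
      rw [h3, (hΦ _).1, h0, hκ0 _ (by linarith)]
      have h6 : b / 2 ≤ 1 - (k x r : ℝ) / (1 - b / 2) := by
        have : (k x r : ℝ) / (1 - b / 2) ≤ 1 - b / 2 := by
          rw [div_le_iff₀ hd]; nlinarith
        linarith
      have h7 : 1 - (k x r : ℝ) / (1 - b / 2) ≤ 1 := by
        have := div_nonneg hy0 hd.le; linarith
      constructor
      · exact (min_le_right _ _).trans (mul_le_mul_of_nonneg_left h6 he.le)
      · have h8 : e * (1 - (k x r : ℝ) / (1 - b / 2)) ≤ e := mul_le_of_le_one_right he.le h7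
        have h9 : e * (b / 2) ≤ e * 1 := mul_le_mul_of_nonneg_left (by linarith) he.le
        linarith [min_le_right c (e * (b / 2))]
    · rw [(hΦ _).2.2 i h3 hi.ne]
      obtain ⟨h4, h5⟩ := h1 i (by omega) h3
      exact ⟨(min_le_left _ _).trans h4, h5.trans (by linarith [min_le_left c (e * (b / 2))])⟩

/-- Uniform separation: a closed relation avoiding the diagonal is separated from it by finitely
many coordinates. -/
theorem exists_separation {C : Set (HCube × HCube)} (hC : IsClosed C) (h : ∀ x, (x, x) ∉ C) :
    ∃ m : ℕ, ∃ δ : ℝ, 0 < δ ∧ ∀ p ∈ C, ∃ i < m, δ ≤ |(p.1 i : ℝ) - p.2 i| := by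
  let S : ℕ → Set (HCube × HCube) := fun k => {p | ∀ i < k, |(p.1 i : ℝ) - p.2 i| ≤ 1 / (k + 1)}
  have hS : ∀ k, IsClosed (S k) := fun k => by
    simp only [S, ofPred_forall]
    exact isClosed_iInter fun i => isClosed_iInter fun _ =>
      isClosed_le (by fun_prop) continuous_const
  have hanti : Antitone S := fun k l hkl p hp i hi =>
    (hp i (hi.trans_le hkl)).trans (by gcongr)
  have hemp : C ∩ ⋂ k, S k = ∅ := by
    refine eq_empty_of_forall_notMem fun p hp => h p.1 ?_
    have : p.2 = p.1 := by
      funext i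
      have h0 : |(p.1 i : ℝ) - p.2 i| ≤ 0 := by
        refine ge_of_tendsto (tendsto_one_div_add_atTop_nhds_zero_nat (𝕜 := ℝ)) ?_
        filter_upwards [Filter.eventually_gt_atTop i] with k hk
        exact mem_iInter.1 hp.2 k i hk
      exact Subtype.ext (sub_eq_zero.1 (abs_eq_zero.1 (le_antisymm h0 (abs_nonneg _)))).symm
    have h1 : (p.1, p.1) = p := Prod.ext rfl this.symm
    rw [h1]; exact hp.1
  obtain ⟨m, hm⟩ := hC.isCompact.elim_directed_family_closed S hS hemp
    (directed_of_isDirected_le fun _ _ hij => hanti hij)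
  refine ⟨m, 1 / (m + 1), by positivity, fun p hp => ?_⟩
  by_contra! hcon
  exact eq_empty_iff_forall_notMem.1 hm p ⟨hp, fun i hi => (hcon i hi).le⟩

theorem exists_modulus {h : HCube → HCube} (hh : Continuous h) (n : ℕ) {ε : ℝ} (hε : 0 < ε) :
    ∃ m : ℕ, ∃ δ : ℝ, 0 < δ ∧ ∀ x y : HCube, (∀ i < m, |(x i : ℝ) - y i| < δ) →
      ∀ i < n, |(h x i : ℝ) - h y i| < ε := by
  have hC : IsClosed {p : HCube × HCube | ∃ i < n, ε ≤ |(h p.1 i : ℝ) - h p.2 i|} := by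
    have : {p : HCube × HCube | ∃ i < n, ε ≤ |(h p.1 i : ℝ) - h p.2 i|} =
        ⋃ i ∈ Iio n, {p : HCube × HCube | ε ≤ |(h p.1 i : ℝ) - h p.2 i|} := by ext; simp
    rw [this]
    exact (finite_Iio n).isClosed_biUnion fun i _ => isClosed_le continuous_const (by fun_prop)
  obtain ⟨m, δ, hδ, H⟩ := exists_separation hC fun x ⟨i, _, hi⟩ => by
    rw [sub_self, abs_zero] at hi; exact hε.not_ge hi
  refine ⟨m, δ, hδ, fun x y hxy i hi => ?_⟩
  by_contra! hcon
  obtain ⟨j, hj, hj'⟩ := H (x, y) ⟨i, hi, hcon⟩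
  exact (hxy j hj).not_ge hj'

/-- A closed set from which the cube can be displaced by maps close to the identity. -/
def IsZLike (K : Set HCube) : Prop :=
  IsClosed K ∧ ∀ n : ℕ, ∀ ε > (0 : ℝ), ∃ g : HCube → HCube, Continuous g ∧ (∀ x, g x ∉ K) ∧
    ∀ x, ∀ i < n, |(g x i : ℝ) - x i| < ε

theorem le_hDist (x y : HCube) (i : ℕ) : (2 : ℝ)⁻¹ ^ i * |(x i : ℝ) - y i| ≤ hDist x y := by
  refine Summable.le_tsum (f := fun i => (2 : ℝ)⁻¹ ^ i * |(x i : ℝ) - y i|) ?_ i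
    fun j _ => by positivity
  refine Summable.of_nonneg_of_le (fun j => by positivity) (fun j => ?_)
    (summable_geometric_of_lt_one (r := (2 : ℝ)⁻¹) (by norm_num) (by norm_num))
  refine mul_le_of_le_one_right (by positivity) (abs_le.2 ?_)
  constructor <;> linarith [(x j).2.1, (x j).2.2, (y j).2.1, (y j).2.2]

theorem IsZSet.isZLike {K : Set HCube} (hK : IsZSet K) : IsZLike K := by
  refine ⟨hK.1, fun n ε hε => ?_⟩
  obtain ⟨g, hg, hgK, hd⟩ := hK.2 (2⁻¹ ^ n * ε) (by positivity) id continuous_id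
  refine ⟨g, hg, fun x hx => eq_empty_iff_forall_notMem.1 hgK _ ⟨mem_range_self x, hx⟩,
    fun x i hi => ?_⟩
  have h1 : (2 : ℝ)⁻¹ ^ n * |(x i : ℝ) - g x i| ≤ 2⁻¹ ^ i * |(x i : ℝ) - g x i| := by
    refine mul_le_mul_of_nonneg_right ?_ (abs_nonneg _)
    exact pow_le_pow_of_le_one (by norm_num) (by norm_num) hi.le
  rw [abs_sub_comm]
  exact lt_of_mul_lt_mul_left ((h1.trans (le_hDist x (g x) i)).trans_lt (hd x)) (by positivity)

theorem IsZLike.image {K : Set HCube} (hK : IsZLike K) (h : HCube ≃ₜ HCube) :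
    IsZLike (h '' K) := by
  refine ⟨(h.isClosed_image).2 hK.1, fun n ε hε => ?_⟩
  obtain ⟨m, δ, hδ, H⟩ := exists_modulus h.continuous n hε
  obtain ⟨g, hg, hgK, hd⟩ := hK.2 m δ hδ
  refine ⟨h ∘ g ∘ h.symm, by fun_prop, ?_, fun x i hi => ?_⟩
  · rintro x ⟨y, hy, hyx⟩
    exact hgK _ (h.injective hyx ▸ hy)
  · simpa using H (g (h.symm x)) (h.symm x) (hd _) i hi

/-- Truncation of the unit interval to `[a, 1 - a]`. -/
noncomputable def clamp (a t : unitInterval) : unitInterval := max a (min t (unitInterval.symm a))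

section clamp

variable {a t : unitInterval}

theorem coe_clamp : (clamp a t : ℝ) = max (a : ℝ) (min (t : ℝ) (1 - a)) := by
  simp [clamp]

theorem le_clamp : (a : ℝ) ≤ clamp a t := by
  rw [coe_clamp]; exact le_max_left _ _

theorem clamp_le (ha : (a : ℝ) ≤ 2⁻¹) : (clamp a t : ℝ) ≤ 1 - a := by
  rw [coe_clamp]; exact max_le (by linarith) (min_le_right _ _)

theorem abs_clamp_sub_le : |(clamp a t : ℝ) - t| ≤ a := by
  rw [coe_clamp]
  have := a.2.1
  have := t.2.1
  have := t.2.2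
  rcases max_cases (a : ℝ) (min (t : ℝ) (1 - a)) with h | h <;>
  rcases min_cases (t : ℝ) (1 - a) with h' | h' <;> rw [abs_le] <;> constructor <;> linarith

theorem abs_sub_clamp_le {s : unitInterval} (hs : (a : ℝ) ≤ s) (hs1 : (s : ℝ) ≤ 1 - a) :
    |(s : ℝ) - clamp a t| ≤ |(s : ℝ) - t| := by
  rw [coe_clamp]
  have := le_abs_self ((s : ℝ) - t)
  have := neg_abs_le ((s : ℝ) - t)
  rcases max_cases (a : ℝ) (min (t : ℝ) (1 - a)) with h | h <;>
  rcases min_cases (t : ℝ) (1 - a) with h' | h' <;> rw [abs_le] <;> constructor <;> linarith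

theorem clamp_mem (ha : 0 < (a : ℝ)) (ha1 : (a : ℝ) ≤ 2⁻¹) : 0 < clamp a t ∧ clamp a t < 1 :=
  ⟨ha.trans_le le_clamp, (clamp_le ha1).trans_lt (by linarith : 1 - (a : ℝ) < 1)⟩

end clamp

theorem continuous_clamp (a : unitInterval) : Continuous (clamp a) := by
  unfold clamp; fun_prop

theorem exists_avoid_zero_face {K : Set HCube} (hK : IsZLike K) (i₀ n : ℕ) {ε : ℝ} (hε : 0 < ε) :
    ∃ k : HCube ≃ₜ HCube, (∀ x ∈ K, k x i₀ ≠ 0) ∧ ∀ x, ∀ i < n, |(k x i : ℝ) - x i| < ε := by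
  obtain ⟨g, hg, hgK, hgε⟩ := hK.2 n (ε / 4) (by positivity)
  obtain ⟨m₀, δ, hδ, hsep⟩ := exists_separation
    ((isCompact_range hg).isClosed.prod hK.1) fun x ⟨⟨y, hy⟩, hx⟩ => hgK y (hy ▸ hx)
  obtain ⟨m, hm₀, hmn, hmi⟩ : ∃ m, m₀ ≤ m ∧ n ≤ m ∧ i₀ < m :=
    ⟨max (max m₀ n) (i₀ + 1), by omega, by omega, by omega⟩
  obtain ⟨k₁, c, hc, hk₁, hk₁c⟩ :=
    exists_push_face (i₀ := i₀) (r := 2 * m) (by omega) (by positivity : 0 < ε / 4)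
  obtain ⟨a, ha, hac, haδ, haε, ha4⟩ :
      ∃ a : ℝ, 0 < a ∧ a ≤ c ∧ a ≤ δ / 4 ∧ a ≤ ε / 4 ∧ a ≤ 1 / 4 :=
    ⟨min (min c (δ / 4)) (min (ε / 4) (1 / 4)), by positivity,
      (min_le_left _ _).trans (min_le_left _ _), (min_le_left _ _).trans (min_le_right _ _),
      (min_le_right _ _).trans (min_le_left _ _), (min_le_right _ _).trans (min_le_right _ _)⟩
  have ha1 : a < 1 := by linarith
  have haa : 0 < a * a := by positivity
  have haa1 : a * a < 1 := by nlinarith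
  let b : unitInterval := ⟨a, ha.le, ha1.le⟩
  have hb2 : (b : ℝ) ≤ 2⁻¹ := by change a ≤ 2⁻¹; linarith
  let T : HCube → HCube := fun x i => clamp b (x (m + i))
  have hT : Continuous T := continuous_pi fun i => (continuous_clamp b).comp (continuous_apply _)
  let q : HCube → HCube := fun x j => if j < m then T x j else 0
  have hq : Continuous q := continuous_pi fun j => by
    by_cases hj : j < m
    · simp only [q, hj, if_true]; exact (continuous_apply j).comp hT
    · simp only [q, hj, if_false]; exact continuous_const
  let G : HCube → HCube := fun x i => clamp b (g (q x) i)
  have hG : Continuous G := continuous_pi fun i =>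
    (continuous_clamp b).comp ((continuous_apply i).comp (hg.comp hq))
  obtain ⟨A, hA, hA'⟩ := exists_triangular_homeomorph {i | m ≤ i ∧ i < 2 * m}
    (fun i (x : HCube) t => compress (a * a) a (x (i - m)) t)
    (fun i _ => continuous_compress _ _ (by fun_prop) continuous_snd)
    (fun i hi x y hxy => by
      funext t
      rw [hxy (i - m) fun h => by have := h.1; have := hi.2; omega])
    (fun i _ x => compress_strictMono haa haa1 ha ha1)
    (fun i _ x => compress_zero haa haa1 ha ha1) (fun i _ x => compress_one haa haa1 ha ha1)
  have hTm := fun (x : HCube) i => clamp_mem (a := b) (t := x (m + i)) ha hb2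
  have hGm := fun (x : HCube) i => clamp_mem (a := b) (t := g (q x) i) ha hb2
  obtain ⟨B, hB, hB'⟩ := exists_triangular_homeomorph (Iio m)
    (fun i (x : HCube) t => bend (T x i) (G x i) t)
    (fun i _ => continuous_bend ((continuous_apply i).comp (hT.comp continuous_fst))
      ((continuous_apply i).comp (hG.comp continuous_fst)) continuous_snd
      (fun p => (hTm p.1 i).1) (fun p => (hTm p.1 i).2))
    (fun i _ x y hxy => by
      have h1 : T x = T y := funext fun j => by
        simp only [T]; rw [hxy (m + j) (by simp)]
      have h2 : q x = q y := by simp only [q, h1]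
      simp only [G, h1, h2])
    (fun i _ x => bend_strictMono (hTm x i).1 (hTm x i).2 (hGm x i).1 (hGm x i).2)
    (fun i _ x => bend_zero (hTm x i).1 (hTm x i).2)
    (fun i _ x => bend_one (hTm x i).1 (hTm x i).2)
  let k := (k₁.trans A).trans B
  have hkapp : ∀ x, k x = B (A (k₁ x)) := fun x => rfl
  have hdisp : ∀ x, ∀ i < n, |(k x i : ℝ) - x i| < ε := fun x i hi => by
    set y := A (k₁ x) with hy
    have him : i < m := by omega
    have h1 : |(k₁ x i : ℝ) - x i| ≤ ε / 4 := hk₁ x i (by omega)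
    have h2 : y i = k₁ x i := hA' _ i (by simp [him])
    have h3 : |(k x i : ℝ) - y i| ≤ |(G y i : ℝ) - T y i| := by
      rw [hkapp, ← hy, hB _ i him, coe_bend (hTm y i).1 (hTm y i).2]
      exact abs_plateau_sub_self_le (hTm y i).1 (hTm y i).2 (y i).2
    have h4 : |(G y i : ℝ) - g (q y) i| ≤ a := abs_clamp_sub_le
    have h5 : |(g (q y) i : ℝ) - T y i| < ε / 4 := by
      have := hgε (q y) i hi
      simpa only [q, him, if_true] using this
    rw [h2] at h3
    have h6 := abs_sub_le (k x i : ℝ) (k₁ x i) (x i)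
    have h7 := abs_sub_le (G y i : ℝ) (g (q y) i) (T y i)
    linarith
  have hface : ∀ x : HCube, x i₀ = 0 → k x ∉ K := fun x hx hxK => by
    set y := A (k₁ x) with hy
    obtain ⟨i, hi, hi'⟩ := hsep (g (q y), k x) ⟨mem_range_self _, hxK⟩
    have him : i < m := by omega
    have h2 : y i = k₁ x i := hA' _ i (by simp [him])
    have h3 := hk₁c x hx i (by omega)
    have h4 := hk₁c x hx (m + i) (by omega)
    have h5 : |(y (m + i) : ℝ) - y i| ≤ a * a := by
      rw [hy, hA _ (m + i) ⟨by omega, by omega⟩, ← hy, h2, Nat.add_sub_cancel_left]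
      exact abs_compress_sub_le haa haa1 ha ha1 (by linarith) (by linarith)
    have h6 : |(y i : ℝ) - T y i| ≤ a * a := by
      rw [abs_sub_comm] at h5
      refine (abs_sub_clamp_le (a := b) ?_ ?_).trans h5
      · rw [h2]; exact hac.trans h3.1
      · rw [h2]; exact h3.2.trans (by change 1 - c ≤ 1 - a; linarith)
    have h7 : |(k x i : ℝ) - G y i| ≤ a := by
      have h8 := abs_plateau_sub_le (x := y i) (y := T y i) ha (le_clamp : (b : ℝ) ≤ T y i)
        (clamp_le hb2) (G y i).2
      rw [← coe_bend (hTm y i).1 (hTm y i).2, ← coe_bend (hTm y i).1 (hTm y i).2,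
        bend_self (hTm y i).1 (hTm y i).2] at h8
      rw [hkapp, ← hy, hB _ i him]
      refine h8.trans ((div_le_iff₀ ha).2 h6)
    have h8 : |(G y i : ℝ) - g (q y) i| ≤ a := abs_clamp_sub_le
    have h9 := abs_sub_le (k x i : ℝ) (G y i) (g (q y) i)
    rw [abs_sub_comm] at hi'
    simp only at hi'
    linarith
  refine ⟨k.symm, fun x hx h0 => hface _ h0 (by simpa using hx), fun x i hi => ?_⟩
  have := hdisp (k.symm x) i hi
  rwa [k.apply_symm_apply, abs_sub_comm] at this

theorem exists_avoid_face {K : Set HCube} (hK : IsZLike K) (b : Bool) (i₀ n : ℕ) {ε : ℝ}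
    (hε : 0 < ε) :
    ∃ k : HCube ≃ₜ HCube, (∀ x ∈ K, k x i₀ ≠ bif b then 1 else 0) ∧
      ∀ x, ∀ i < n, |(k x i : ℝ) - x i| < ε := by
  cases b with
  | false => exact exists_avoid_zero_face hK i₀ n hε
  | true =>
    let F : HCube ≃ₜ HCube := Homeomorph.piCongrRight fun _ => unitInterval.symmHomeomorph
    have hF : ∀ x i, F x i = unitInterval.symm (x i) := fun x i => rfl
    have hF' : ∀ x i, F.symm x i = unitInterval.symm (x i) := fun x i => rfl
    obtain ⟨k, hk, hkε⟩ := exists_avoid_zero_face (hK.image F) i₀ n hε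
    refine ⟨(F.trans k).trans F.symm, fun x hx h1 => hk (F x) ⟨x, hx, rfl⟩ ?_, fun x i hi => ?_⟩
    · have : unitInterval.symm (k (F x) i₀) = 1 := h1
      rw [← unitInterval.symm_symm (k (F x) i₀), this, unitInterval.symm_one]
    · have := hkε (F x) i hi
      rw [hF, abs_sub_comm] at this
      change |(unitInterval.symm (k (F x) i) : ℝ) - x i| < ε
      rw [unitInterval.coe_symm_eq] at this ⊢
      convert this using 2
      ring

theorem tendsto_id_of_near {F : ℕ → C(HCube, HCube)}
    (hF : ∀ n x, ∀ i < n, |(F n x i : ℝ) - x i| < 1 / (n + 1)) :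
    Filter.Tendsto F Filter.atTop (𝓝 (ContinuousMap.id HCube)) := by
  rw [ContinuousMap.tendsto_iff_tendstoUniformly, tendstoUniformly_iff_tendsto, Pi.uniformity,
    Filter.tendsto_iInf]
  intro i
  rw [Filter.tendsto_comap_iff]
  have : TendstoUniformly (fun n (x : HCube) => F n x i) (fun x => x i) Filter.atTop := by
    rw [Metric.tendstoUniformly_iff]
    intro ε hε
    filter_upwards [(tendsto_one_div_add_atTop_nhds_zero_nat (𝕜 := ℝ)).eventually_lt_const hε,
      Filter.eventually_gt_atTop i] with n hn hi x
    rw [dist_comm]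
    exact (hF n x i hi).trans hn
  exact tendstoUniformly_iff_tendsto.1 this

/-- Self-homeomorphisms of the cube, as pairs of mutually inverse continuous maps. -/
def homeoPairs : Set (C(HCube, HCube) × C(HCube, HCube)) :=
  {p | p.1.comp p.2 = .id HCube ∧ p.2.comp p.1 = .id HCube}

theorem isClosed_homeoPairs : IsClosed homeoPairs :=
  (isClosed_eq (continuous_fst.compCM continuous_snd) continuous_const).inter
    (isClosed_eq (continuous_snd.compCM continuous_fst) continuous_const)

instance : BaireSpace homeoPairs :=
  have : CompleteSpace homeoPairs := isClosed_homeoPairs.completeSpace_coe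
  inferInstance

theorem homeomorph_mem_homeoPairs (h : HCube ≃ₜ HCube) :
    ((h : C(HCube, HCube)), (h.symm : C(HCube, HCube))) ∈ homeoPairs := by
  constructor <;> ext <;> simp

def homeoPairs.toHomeomorph (p : homeoPairs) : HCube ≃ₜ HCube where
  toFun := p.1.1
  invFun := p.1.2
  left_inv x := DFunLike.congr_fun p.2.2 x
  right_inv x := DFunLike.congr_fun p.2.1 x

theorem dense_avoid_face {K : Set HCube} (hK : IsZLike K) (b : Bool) (i : ℕ) :
    Dense {p : homeoPairs | MapsTo p.1.1 K {x | x i ≠ bif b then 1 else 0}} := by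
  intro p
  let h := homeoPairs.toHomeomorph p
  choose k hkK hk using fun n : ℕ =>
    exists_avoid_face (hK.image h) b i n (by positivity : (0 : ℝ) < 1 / (n + 1))
  have hk1 : Filter.Tendsto (fun n => (k n : C(HCube, HCube))) Filter.atTop
      (𝓝 (ContinuousMap.id HCube)) := tendsto_id_of_near hk
  have hk2 : Filter.Tendsto (fun n => ((k n).symm : C(HCube, HCube))) Filter.atTop
      (𝓝 (ContinuousMap.id HCube)) := tendsto_id_of_near fun n x j hj => by
    have := hk n ((k n).symm x) j hj
    rwa [(k n).apply_symm_apply, abs_sub_comm] at this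
  let P : ℕ → homeoPairs := fun n => ⟨_, homeomorph_mem_homeoPairs (h.trans (k n))⟩
  refine mem_closure_of_tendsto (f := P) (b := Filter.atTop) ?_
    (Filter.Eventually.of_forall fun n x hx => hkK n _ ⟨x, hx, rfl⟩)
  rw [tendsto_subtype_rng]
  have h1 := hk1.compCM (tendsto_const_nhds (x := p.1.1))
  have h2 := (tendsto_const_nhds (x := p.1.2)).compCM hk2
  rw [ContinuousMap.id_comp] at h1
  rw [ContinuousMap.comp_id] at h2
  exact h1.prodMk_nhds h2

theorem IsZLike.exists_homeomorph_interior {K : Set HCube} (hK : IsZLike K) :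
    ∃ h : HCube ≃ₜ HCube, ∀ x ∈ K, ∀ i, 0 < h x i ∧ h x i < 1 := by
  obtain ⟨p, hp⟩ := (dense_iInter_of_isOpen (X := homeoPairs)
    (f := fun q : Bool × ℕ => {p | MapsTo p.1.1 K {x | x q.2 ≠ bif q.1 then 1 else 0}})
    (fun q => (ContinuousMap.isOpen_setOfPred_mapsTo hK.1.isCompact
      (isOpen_ne_fun (continuous_apply q.2) continuous_const)).preimage
        (continuous_fst.comp continuous_subtype_val))
    (fun q => dense_avoid_face hK q.1 q.2)).nonempty_iff.2
      ⟨_, homeomorph_mem_homeoPairs (.refl _)⟩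
  rw [mem_iInter] at hp
  exact ⟨homeoPairs.toHomeomorph p, fun x hx i =>
    ⟨unitInterval.pos_iff_ne_zero.2 (hp (false, i) hx), unitInterval.lt_one_iff_ne_one.2
      (hp (true, i) hx)⟩⟩

theorem IsZLike.isDeficient {K : Set HCube} (hK : IsZLike K) : IsDeficient K := by
  obtain ⟨h, hh⟩ := hK.exists_homeomorph_interior
  obtain ⟨Θ, hΘ⟩ := isDeficient_of_interior ((h.isClosed_image).2 hK.1)
    (forall_mem_image.2 hh)
  exact ⟨h.trans Θ, fun x hx => hΘ (h x) ⟨x, hx, rfl⟩⟩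

/-- Homeomorphisms between `Z`-sets of the cube extend to the cube. -/
theorem IsZLike.exists_extension {K L : Set HCube} (hK : IsZLike K) (hL : IsZLike L)
    (φ : K ≃ₜ L) : ∃ Φ : HCube ≃ₜ HCube, ∀ x : K, Φ x = φ x :=
  hK.isDeficient.exists_extension hL.isDeficient hK.1 φ

/-! ### Spaces of nonexpansive functions -/

theorem sqrt_dist_triangle {M : Type*} [PseudoMetricSpace M] (a b c : M) :
    √(dist a c) ≤ √(dist a b) + √(dist b c) := by
  refine Real.sqrt_le_iff.2 ⟨by positivity, (dist_triangle a b c).trans ?_⟩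
  nlinarith [Real.sq_sqrt (dist_nonneg (x := a) (y := b)), Real.sqrt_nonneg (dist a b),
    Real.sq_sqrt (dist_nonneg (x := b) (y := c)), Real.sqrt_nonneg (dist b c)]

theorem sqrt_dist_triangle_lt {M : Type*} [MetricSpace M] {a b c : M} (hab : a ≠ b) (hbc : b ≠ c) :
    √(dist a c) < √(dist a b) + √(dist b c) := by
  have h1 := Real.sqrt_pos.2 (dist_pos.2 hab)
  have h2 := Real.sqrt_pos.2 (dist_pos.2 hbc)
  refine (Real.sqrt_lt' (by positivity)).2 ((dist_triangle a b c).trans_lt ?_)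
  nlinarith [Real.sq_sqrt (dist_nonneg (x := a) (y := b)),
    Real.sq_sqrt (dist_nonneg (x := b) (y := c)), mul_pos h1 h2]

/-- The functions into `[0,1]` that are nonexpansive for the square root of the metric. -/
def lipFun (M : Type*) [PseudoMetricSpace M] : Set (M → unitInterval) :=
  {u | ∀ a b, |(u a : ℝ) - u b| ≤ √(dist a b)}

/-- McShane's extension theorem. -/
theorem exists_lipFun_extension {A M : Type*} [PseudoMetricSpace M] (i : A → M)
    (u : A → unitInterval) (h : ∀ a b, |(u a : ℝ) - u b| ≤ √(dist (i a) (i b))) :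
    ∃ v ∈ lipFun M, ∀ a, v (i a) = u a := by
  rcases isEmpty_or_nonempty A with hA | hA
  · exact ⟨0, fun a b => by simp, fun a => isEmptyElim a⟩
  let w : M → ℝ := fun m => ⨅ a, ((u a : ℝ) + √(dist (i a) m))
  have hb : ∀ m, BddBelow (range fun a => (u a : ℝ) + √(dist (i a) m)) := fun m =>
    ⟨0, forall_mem_range.2 fun a => add_nonneg (u a).2.1 (Real.sqrt_nonneg _)⟩
  have hle : ∀ m m', w m ≤ w m' + √(dist m m') := fun m m' => by
    rw [← sub_le_iff_le_add]
    refine le_ciInf fun a => ?_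
    rw [sub_le_iff_le_add]
    refine (ciInf_le (hb m) a).trans ?_
    have := sqrt_dist_triangle (i a) m' m
    rw [dist_comm m' m] at this
    linarith
  refine ⟨fun m => projIcc 0 1 zero_le_one (w m), fun m m' => ?_, fun a => ?_⟩
  · refine (abs_projIcc_sub_projIcc zero_le_one).trans (abs_le.2 ⟨?_, ?_⟩)
    · have := hle m' m
      rw [dist_comm] at this
      linarith
    · linarith [hle m m']
  · have : w (i a) = u a := by
      refine le_antisymm ((ciInf_le (hb (i a)) a).trans (by simp)) (le_ciInf fun b => ?_)
      have := h a b
      rw [dist_comm] at this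
      linarith [(abs_le.1 this).2]
    simp only [this, projIcc_val]

theorem lipFun.continuous {M : Type*} [PseudoMetricSpace M] {u : M → unitInterval}
    (hu : u ∈ lipFun M) : Continuous u := by
  refine continuous_iff_continuousAt.2 fun a => ?_
  rw [ContinuousAt, tendsto_iff_dist_tendsto_zero]
  have : Filter.Tendsto (fun b => √(dist b a)) (𝓝 a) (𝓝 0) := by
    have : Continuous fun b => √(dist b a) := by fun_prop
    simpa using this.tendsto a
  exact squeeze_zero (fun _ => dist_nonneg) (fun b => hu b a) this

theorem isClosed_lipFun (M : Type*) [PseudoMetricSpace M] : IsClosed (lipFun M) := by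
  simp only [lipFun, ofPred_forall]
  exact isClosed_iInter fun a => isClosed_iInter fun b =>
    isClosed_le (by fun_prop) continuous_const

instance (M : Type*) [PseudoMetricSpace M] : CompactSpace (lipFun M) :=
  isCompact_iff_compactSpace.1 (isClosed_lipFun M).isCompact

theorem exists_seq_of_recursion {α : Type*} [Nonempty α] (s : ℕ → (ℕ → α) → α)
    (hs : ∀ n u v, (∀ i < n, u i = v i) → s n u = s n v) : ∃ u : ℕ → α, ∀ n, u n = s n u := by
  classical
  obtain ⟨a⟩ := ‹Nonempty α›
  let F : ∀ n, (∀ m, m < n → α) → α := fun n ih => s n fun i => if h : i < n then ih i h else a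
  refine ⟨fun n => Nat.strongRec (motive := fun _ => α) F n, fun n => ?_⟩
  change Nat.strongRec (motive := fun _ => α) F n = _
  rw [Nat.strongRec_eq]
  exact hs n _ _ fun i hi => by simp [hi]

/-- The least value at `n` compatible with the values below `n`. -/
noncomputable def lowerBound (ρ : ℕ → ℕ → ℝ) (n : ℕ) (u : HCube) : unitInterval :=
  (Finset.range n).sup fun i => projIcc 0 1 zero_le_one ((u i : ℝ) - ρ i n)

/-- The greatest value at `n` compatible with the values below `n`. -/
noncomputable def upperBound (ρ : ℕ → ℕ → ℝ) (n : ℕ) (u : HCube) : unitInterval :=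
  (Finset.range n).inf fun i => projIcc 0 1 zero_le_one ((u i : ℝ) + ρ i n)

section bounds

variable {ρ : ℕ → ℕ → ℝ} {n : ℕ} {u v : HCube}

theorem continuous_lowerBound : Continuous (lowerBound ρ n) :=
  Continuous.finset_sup_apply fun i _ => continuous_projIcc.comp (by fun_prop)

theorem continuous_upperBound : Continuous (upperBound ρ n) :=
  Continuous.finset_inf_apply fun i _ => continuous_projIcc.comp (by fun_prop)

theorem lowerBound_congr (h : ∀ i < n, u i = v i) : lowerBound ρ n u = lowerBound ρ n v :=
  Finset.sup_congr rfl fun i hi => by rw [h i (Finset.mem_range.1 hi)]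

theorem upperBound_congr (h : ∀ i < n, u i = v i) : upperBound ρ n u = upperBound ρ n v :=
  Finset.inf_congr rfl fun i hi => by rw [h i (Finset.mem_range.1 hi)]

theorem lowerBound_le_iff (hρ : ∀ i < n, 0 ≤ ρ i n) {t : unitInterval} :
    lowerBound ρ n u ≤ t ↔ ∀ i < n, (u i : ℝ) - ρ i n ≤ t := by
  rw [lowerBound, Finset.sup_le_iff]
  refine forall_congr' fun i => imp_congr Finset.mem_range Iff.rfl |>.trans <|
    imp_congr_right fun hi => ?_
  rw [← Subtype.coe_le_coe, coe_projIcc, min_eq_right (by linarith [(u i).2.2, hρ i hi]),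
    max_le_iff]
  exact and_iff_right t.2.1

theorem le_upperBound_iff (hρ : ∀ i < n, 0 ≤ ρ i n) {t : unitInterval} :
    t ≤ upperBound ρ n u ↔ ∀ i < n, (t : ℝ) ≤ u i + ρ i n := by
  rw [upperBound, Finset.le_inf_iff]
  refine forall_congr' fun i => imp_congr Finset.mem_range Iff.rfl |>.trans <|
    imp_congr_right fun hi => ?_
  rw [← Subtype.coe_le_coe, coe_projIcc, max_eq_right
    (le_min zero_le_one (by linarith [(u i).2.1, hρ i hi])), le_min_iff]
  exact and_iff_right t.2.2

theorem lowerBound_lt_upperBound (hρ : ∀ i < n, 0 < ρ i n)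
    (h : ∀ i < n, ∀ j < n, (u i : ℝ) - u j < ρ i n + ρ j n) :
    lowerBound ρ n u < upperBound ρ n u := by
  have hl : ∀ i < n, (projIcc 0 1 zero_le_one ((u i : ℝ) - ρ i n) : unitInterval) < 1 :=
    fun i hi => by
      rw [← Subtype.coe_lt_coe, coe_projIcc]
      refine max_lt zero_lt_one (min_lt_of_right_lt ?_)
      have := hρ i hi
      have := (u i).2.2
      change (u i : ℝ) - ρ i n < 1
      linarith
  have hr : ∀ i < n, (0 : unitInterval) < projIcc 0 1 zero_le_one ((u i : ℝ) + ρ i n) :=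
    fun i hi => by
      rw [← Subtype.coe_lt_coe, coe_projIcc]
      refine lt_max_of_lt_right (lt_min zero_lt_one ?_)
      have := hρ i hi
      have := (u i).2.1
      change 0 < (u i : ℝ) + ρ i n
      linarith
  have h01 : (0 : unitInterval) < 1 := zero_lt_one
  rw [upperBound, Finset.lt_inf_iff]
  · intro j hj
    rw [lowerBound, Finset.sup_lt_iff]
    · intro i hi
      rw [Finset.mem_range] at hi hj
      have := h i hi j hj
      rw [← Subtype.coe_lt_coe, coe_projIcc, coe_projIcc]
      have h1 := hρ i hi
      have h2 := hρ j hj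
      have h3 := (u i).2.2
      have h4 := (u j).2.1
      rw [min_eq_right (by linarith), max_eq_right (le_min zero_le_one (by linarith))]
      exact max_lt (lt_min zero_lt_one (by linarith)) (lt_min (by linarith) (by linarith))
    · exact hr j (Finset.mem_range.1 hj)
  · rw [lowerBound]
    exact (Finset.sup_lt_iff h01).2 fun i hi => hl i (Finset.mem_range.1 hi)

end bounds

theorem exists_injective_denseRange {M : Type*} [TopologicalSpace M] [T1Space M]
    [TopologicalSpace.SeparableSpace M] [Infinite M] (m₀ : M) :
    ∃ d : ℕ → M, Function.Injective d ∧ DenseRange d ∧ d 0 = m₀ := by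
  obtain ⟨s, hsc, hsd⟩ := TopologicalSpace.exists_countable_dense M
  have hd : Dense (insert m₀ s) := hsd.mono (subset_insert _ _)
  have : Countable ↥(insert m₀ s) := (hsc.insert m₀).to_subtype
  have : Infinite ↥(insert m₀ s) := infinite_coe_iff.2 fun hfin => by
    have h1 := hfin.isClosed.closure_eq
    rw [hd.closure_eq] at h1
    exact infinite_univ (h1 ▸ hfin)
  obtain ⟨e⟩ := nonempty_equiv_of_countable (α := ↥(insert m₀ s)) (β := ℕ)
  let z : ↥(insert m₀ s) := ⟨m₀, mem_insert _ _⟩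
  let e' := (Equiv.swap 0 (e z)).trans e.symm
  refine ⟨fun n => e' n, Subtype.val_injective.comp e'.injective, ?_, ?_⟩
  · have : range (fun n => (e' n : M)) = insert m₀ s :=
      (e'.surjective.range_comp _).trans Subtype.range_coe
    rw [DenseRange, this]
    exact hd
  · simp [e', z]

/-- The space of nonexpansive functions is a Hilbert cube. -/
theorem exists_homeomorph_lipFun {M : Type*} [MetricSpace M] [TopologicalSpace.SeparableSpace M]
    [Infinite M] (m₀ : M) : ∃ Θ : HCube ≃ₜ lipFun M, ∀ t, (Θ t).1 m₀ = t 0 := by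
  obtain ⟨d, hdi, hdd, hd0⟩ := exists_injective_denseRange m₀
  let ρ : ℕ → ℕ → ℝ := fun i j => √(dist (d i) (d j))
  have hρ : ∀ n, ∀ i < n, 0 < ρ i n := fun n i hi =>
    Real.sqrt_pos.2 (dist_pos.2 (hdi.ne hi.ne))
  have hlt : ∀ n (u : HCube), (∀ i < n, ∀ j < n, |(u i : ℝ) - u j| ≤ ρ i j) →
      lowerBound ρ n u < upperBound ρ n u := fun n u hu =>
    lowerBound_lt_upperBound (hρ n) fun i hi j hj => by
      refine ((le_abs_self _).trans (hu i hi j hj)).trans_lt ?_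
      have := sqrt_dist_triangle_lt (hdi.ne hi.ne) (hdi.ne hj.ne')
      simp only [ρ]
      rwa [dist_comm (d j)]
  let r : lipFun M → HCube := fun u i => u.1 (d i)
  have hr : Continuous r :=
    continuous_pi fun i => (continuous_apply (d i)).comp continuous_subtype_val
  have hru : ∀ u i j, |(r u i : ℝ) - r u j| ≤ ρ i j := fun u i j => u.2 _ _
  have hru' : ∀ u n, (lowerBound ρ n (r u) : ℝ) < upperBound ρ n (r u) := fun u n =>
    hlt n _ fun i _ j _ => hru u i j
  have hlow : ∀ u n, (lowerBound ρ n (r u) : ℝ) ≤ r u n := fun u n =>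
    (lowerBound_le_iff fun i hi => (hρ n i hi).le).2 fun i _ => by
      linarith [(abs_le.1 (hru u i n)).2]
  have hupp : ∀ u n, (r u n : ℝ) ≤ upperBound ρ n (r u) := fun u n =>
    (le_upperBound_iff fun i hi => (hρ n i hi).le).2 fun i _ => by
      linarith [(abs_le.1 (hru u i n)).1]
  let q : lipFun M → ℕ → ℝ := fun u n => ((r u n : ℝ) - lowerBound ρ n (r u)) /
    (upperBound ρ n (r u) - lowerBound ρ n (r u))
  have hq : ∀ u n, q u n ∈ Icc (0 : ℝ) 1 := fun u n =>
    ⟨div_nonneg (sub_nonneg.2 (hlow u n)) (sub_pos.2 (hru' u n)).le,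
      (div_le_one (sub_pos.2 (hru' u n))).2 (sub_le_sub_right (hupp u n) _)⟩
  let G : lipFun M → HCube := fun u n => ⟨q u n, hq u n⟩
  have hG : Continuous G := by
    have hl := fun n => (continuous_lowerBound (ρ := ρ) (n := n)).comp hr
    have hu := fun n => (continuous_upperBound (ρ := ρ) (n := n)).comp hr
    refine continuous_pi fun n => Continuous.subtype_mk (Continuous.div ?_ ?_ fun u =>
      (sub_pos.2 (hru' u n)).ne') _
    · exact (continuous_subtype_val.comp ((continuous_apply n).comp hr)).sub
        (continuous_subtype_val.comp (hl n))
    · exact (continuous_subtype_val.comp (hu n)).sub (continuous_subtype_val.comp (hl n))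
  have hval : ∀ u n, (r u n : ℝ) = lowerBound ρ n (r u) +
      G u n * (upperBound ρ n (r u) - lowerBound ρ n (r u)) := fun u n => by
    have := (sub_pos.2 (hru' u n)).ne'
    change (r u n : ℝ) = lowerBound ρ n (r u) + q u n * _
    simp only [q]
    field_simp
    ring
  have hinj : Function.Injective G := fun u v huv => by
    have h1 : ∀ n, r u n = r v n := fun n => by
      induction n using Nat.strong_induction_on with
      | _ n ih =>
        refine Subtype.ext ?_
        rw [hval, hval, huv, lowerBound_congr ih, upperBound_congr ih]
    refine Subtype.ext (hdd.equalizer (lipFun.continuous u.2) (lipFun.continuous v.2) ?_)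
    exact funext h1
  have hsurj : Function.Surjective G := fun t => by
    let s : ℕ → HCube → ℝ := fun n u => lowerBound ρ n u +
      t n * (upperBound ρ n u - lowerBound ρ n u)
    obtain ⟨u, hu⟩ := exists_seq_of_recursion (fun n u => projIcc (0 : ℝ) 1 zero_le_one (s n u))
      fun n u v huv => by simp only [s, lowerBound_congr huv, upperBound_congr huv]
    have hus : ∀ n, (lowerBound ρ n u : ℝ) < upperBound ρ n u →
        (u n : ℝ) = s n u ∧ (lowerBound ρ n u : ℝ) ≤ u n ∧ (u n : ℝ) ≤ upperBound ρ n u :=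
      fun n h1 => by
        have h2 : (lowerBound ρ n u : ℝ) ≤ s n u :=
          le_add_of_nonneg_right (mul_nonneg (t n).2.1 (sub_pos.2 h1).le)
        have h3 : s n u ≤ upperBound ρ n u := by
          have := mul_le_of_le_one_left (sub_pos.2 h1).le (t n).2.2
          simp only [s]
          linarith
        have h4 : (u n : ℝ) = s n u := by
          rw [hu n, projIcc_of_mem zero_le_one
            ⟨(lowerBound ρ n u).2.1.trans h2, h3.trans (upperBound ρ n u).2.2⟩]
        exact ⟨h4, h4 ▸ h2, h4 ▸ h3⟩
    have hS : ∀ n, ∀ i < n, ∀ j < n, |(u i : ℝ) - u j| ≤ ρ i j := fun n => by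
      induction n with
      | zero => intro i hi; omega
      | succ n ih =>
        obtain ⟨-, h2, h3⟩ := hus n (hlt n u ih)
        have h5 := (lowerBound_le_iff fun i hi => (hρ n i hi).le).1 (Subtype.coe_le_coe.1 h2)
        have h6 := (le_upperBound_iff fun i hi => (hρ n i hi).le).1 (Subtype.coe_le_coe.1 h3)
        have h7 : ∀ i < n, |(u i : ℝ) - u n| ≤ ρ i n := fun i hi =>
          abs_le.2 ⟨by linarith [h6 i hi], by linarith [h5 i hi]⟩
        intro i hi j hj
        rcases Nat.lt_succ_iff_lt_or_eq.1 hi with hi | rfl <;>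
        rcases Nat.lt_succ_iff_lt_or_eq.1 hj with hj | rfl
        · exact ih i hi j hj
        · exact h7 i hi
        · rw [abs_sub_comm]
          simp only [ρ]
          rw [dist_comm]
          exact h7 j hj
        · simp [ρ]
    obtain ⟨v, hv, hvu⟩ := exists_lipFun_extension d u fun i j =>
      hS (max i j + 1) i (by omega) j (by omega)
    have hrv : r ⟨v, hv⟩ = u := funext hvu
    refine ⟨⟨v, hv⟩, funext fun n => Subtype.ext ?_⟩
    have h1 := hval ⟨v, hv⟩ n
    have h2 := hru' ⟨v, hv⟩ n
    rw [hrv] at h1 h2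
    rw [(hus n h2).1] at h1
    exact (mul_right_cancel₀ (sub_pos.2 h2).ne' (add_left_cancel h1)).symm
  let Θ : lipFun M ≃ₜ HCube :=
    Continuous.homeoOfEquivCompactToT2 (f := Equiv.ofBijective G ⟨hinj, hsurj⟩) hG
  refine ⟨Θ.symm, fun t => ?_⟩
  have h1 : ∀ u, G u 0 = u.1 m₀ := fun u => Subtype.ext <| by
    have := hval u 0
    have h2 : ((⊥ : unitInterval) : ℝ) = 0 := rfl
    have h3 : ((⊤ : unitInterval) : ℝ) = 1 := rfl
    simp only [lowerBound, upperBound, Finset.range_zero, Finset.sup_empty, Finset.inf_empty,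
      h2, h3, zero_add, sub_zero, mul_one, r, hd0] at this
    exact this.symm
  rw [← h1]
  exact congrFun (Θ.apply_symm_apply t) 0

/-! ### The functor of continuation -/

theorem isZLike_of_subset_face {K : Set HCube} (hK : IsClosed K) (h : ∀ x ∈ K, x 0 = 0) :
    IsZLike K := by
  refine ⟨hK, fun n ε hε => ?_⟩
  obtain ⟨a, ha, ha1, haε⟩ : ∃ a : ℝ, 0 < a ∧ a ≤ 1 ∧ a < ε :=
    ⟨min 1 (ε / 2), by positivity, min_le_left _ _, (min_le_right _ _).trans_lt (half_lt_self hε)⟩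
  let b : unitInterval := ⟨a, ha.le, ha1⟩
  refine ⟨fun x => Function.update x 0 (max (x 0) b),
    continuous_id.update 0 (by fun_prop), fun x hx => ?_, fun x i _ => ?_⟩
  · have h1 := h _ hx
    simp only [Function.update_self] at h1
    have h2 : b ≤ 0 := h1 ▸ le_max_right _ _
    exact ha.not_ge h2
  · by_cases hi : i = 0
    · subst hi
      simp only [Function.update_self]
      rcases max_cases (x 0) b with ⟨h1, -⟩ | ⟨h1, h2⟩ <;> rw [h1]
      · simpa
      · have h3 : (x 0 : ℝ) < a := h2
        have h4 := (x 0).2.1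
        change |a - (x 0 : ℝ)| < ε
        rw [abs_lt]
        constructor <;> linarith
    · simpa [Function.update_of_ne hi]

theorem exists_map_eq_zero_one {X : Type*} [TopologicalSpace X]
    [CompletelyRegularSpace X] {s : Set X} (hs : IsClosed s) {x : X}
    (hx : x ∉ s) : ∃ g : C(X, unitInterval), g x = 0 ∧ ∀ y ∈ s, g y = 1 := by
  obtain ⟨f, hf, h0, h1⟩ := CompletelyRegularSpace.completely_regular x s hs hx
  exact ⟨⟨f, hf⟩, h0, h1⟩

section functor

variable {X Y Z : Type*} [TopologicalSpace X] [CompactSpace X] [TopologicalSpace Y] [CompactSpace Y]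
  [TopologicalSpace Z] [CompactSpace Z]

/-- Evaluation at a point, as a function on the space of functions. -/
def evalMap (x : X) : lipFun (C(X, unitInterval) × unitInterval) :=
  ⟨fun p => p.1 x, fun p q => by
    have h1 : |(p.1 x : ℝ) - q.1 x| ≤ dist p q :=
      (ContinuousMap.dist_apply_le_dist (f := p.1) (g := q.1) x).trans (le_max_left _ _)
    have h2 : |(p.1 x : ℝ) - q.1 x| ≤ 1 := by
      rw [abs_le]
      constructor <;> linarith [(p.1 x).2.1, (p.1 x).2.2, (q.1 x).2.1, (q.1 x).2.2]
    refine Real.le_sqrt_of_sq_le ?_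
    rw [sq]
    exact (mul_le_of_le_one_left (abs_nonneg _) h2).trans h1⟩

theorem continuous_evalMap : Continuous (evalMap (X := X)) :=
  Continuous.subtype_mk (continuous_pi fun p => p.1.continuous) _

theorem evalMap_injective [T2Space X] : Function.Injective (evalMap (X := X)) := by
  intro x y hxy
  by_contra hne
  obtain ⟨g, h0, h1⟩ := exists_map_eq_zero_one (isClosed_singleton (x := y)) hne
  have h2 : g x = g y := congrFun (congrArg Subtype.val hxy) (g, 0)
  rw [h0, h1 y rfl] at h2
  exact zero_ne_one h2

theorem dist_comp_le (φ : C(X, Y)) (p q : C(Y, unitInterval) × unitInterval) :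
    dist (p.1.comp φ, p.2) (q.1.comp φ, q.2) ≤ dist p q :=
  max_le_max ((ContinuousMap.dist_le dist_nonneg).2 fun x =>
    ContinuousMap.dist_apply_le_dist (φ x)) le_rfl

theorem dist_comp_eq {φ : C(X, Y)} (hφ : Function.Surjective φ)
    (p q : C(Y, unitInterval) × unitInterval) :
    dist (p.1.comp φ, p.2) (q.1.comp φ, q.2) = dist p q :=
  (dist_comp_le φ p q).antisymm <| max_le_max ((ContinuousMap.dist_le dist_nonneg).2 fun y => by
    obtain ⟨x, rfl⟩ := hφ y
    exact ContinuousMap.dist_apply_le_dist (f := p.1.comp φ) (g := q.1.comp φ) x) le_rfl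

/-- The map of function spaces induced by a continuous map. -/
def pushMap (φ : C(X, Y)) (u : lipFun (C(X, unitInterval) × unitInterval)) :
    lipFun (C(Y, unitInterval) × unitInterval) :=
  ⟨fun p => u.1 (p.1.comp φ, p.2), fun p q =>
    (u.2 _ _).trans (Real.sqrt_le_sqrt (dist_comp_le φ p q))⟩

theorem continuous_pushMap (φ : C(X, Y)) : Continuous (pushMap φ) :=
  Continuous.subtype_mk (continuous_pi fun p =>
    (continuous_apply (p.1.comp φ, p.2)).comp continuous_subtype_val) _

theorem pushMap_id : pushMap (ContinuousMap.id X) = id := rfl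

theorem pushMap_comp (ψ : C(Y, Z)) (φ : C(X, Y)) : pushMap (ψ.comp φ) = pushMap ψ ∘ pushMap φ := rfl

theorem pushMap_evalMap (φ : C(X, Y)) (x : X) : pushMap φ (evalMap x) = evalMap (φ x) := rfl

theorem pushMap_injective [T2Space Y] {φ : C(X, Y)} (hφ : Function.Injective φ) :
    Function.Injective (pushMap φ) := by
  refine fun u v huv => Subtype.ext (funext fun ⟨g, s⟩ => ?_)
  obtain ⟨g', hg'⟩ := ContinuousMap.exists_extension (φ.continuous.isClosedEmbedding hφ) g
  have h1 : g'.comp φ = g := hg'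
  rw [← h1]
  exact congrFun (congrArg Subtype.val huv) (g', s)

theorem pushMap_surjective_iff [T2Space Y] {φ : C(X, Y)} :
    Function.Surjective (pushMap φ) ↔ Function.Surjective φ := by
  refine ⟨fun h y => ?_, fun h v => ?_⟩
  · by_contra hy
    obtain ⟨g, h0, h1⟩ := exists_map_eq_zero_one (isCompact_range φ.continuous).isClosed hy
    obtain ⟨u, hu⟩ := h (evalMap y)
    have h2 : u.1 (g.comp φ, 0) = g y := congrFun (congrArg Subtype.val hu) (g, 0)
    have h3 : u.1 ((ContinuousMap.const Y 1).comp φ, 0) = 1 :=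
      congrFun (congrArg Subtype.val hu) (.const Y 1, 0)
    have h4 : g.comp φ = (ContinuousMap.const Y 1).comp φ :=
      ContinuousMap.ext fun x => h1 _ (mem_range_self x)
    rw [h4, h3, h0] at h2
    exact one_ne_zero h2
  · obtain ⟨u, hu, huv⟩ := exists_lipFun_extension
      (fun p : C(Y, unitInterval) × unitInterval => (p.1.comp φ, p.2)) v.1 fun p q => by
        rw [dist_comp_eq h]; exact v.2 p q
    exact ⟨⟨u, hu⟩, Subtype.ext (funext huv)⟩

end functor

instance : Infinite unitInterval := infinite_coe_iff.2 (Icc_infinite zero_lt_one)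

/-- The `Z`-sets of the Hilbert cube. -/
abbrev ZSet := {K : Set HCube // IsZSet K}

instance (K : ZSet) : CompactSpace K.1 := isCompact_iff_compactSpace.1 K.2.1.isCompact

theorem exists_chart (K : ZSet) :
    ∃ Θ : HCube ≃ₜ lipFun (C(K.1, unitInterval) × unitInterval), ∀ x : K.1, Θ x = evalMap x := by
  obtain ⟨Θ, hΘ⟩ := exists_homeomorph_lipFun
    ((.const _ 0, 0) : C(K.1, unitInterval) × unitInterval)
  have hemb : IsClosedEmbedding fun x : K.1 => Θ.symm (evalMap x) :=
    (Θ.symm.continuous.comp continuous_evalMap).isClosedEmbedding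
      (Θ.symm.injective.comp evalMap_injective)
  have hface : IsZLike (range fun x : K.1 => Θ.symm (evalMap x)) :=
    isZLike_of_subset_face hemb.isClosed_range <| forall_mem_range.2 fun x => by
      have h1 := hΘ (Θ.symm (evalMap x))
      rw [Θ.apply_symm_apply] at h1
      exact h1.symm
  obtain ⟨Φ, hΦ⟩ := K.2.isZLike.exists_extension hface hemb.toIsEmbedding.toHomeomorph
  refine ⟨Φ.trans Θ, fun x => ?_⟩
  rw [Homeomorph.trans_apply, hΦ]
  exact Θ.apply_symm_apply _

/-- A chart identifying the cube with the function space of a `Z`-set. -/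
noncomputable def chart (K : ZSet) : HCube ≃ₜ lipFun (C(K.1, unitInterval) × unitInterval) :=
  (exists_chart K).choose

theorem chart_apply {K : ZSet} (x : K.1) : chart K x = evalMap x :=
  (exists_chart K).choose_spec x

/-- The continuation of a continuous map between `Z`-sets. -/
noncomputable def continuation {K L : ZSet} (φ : C(K.1, L.1)) : HCube → HCube :=
  (chart L).symm ∘ pushMap φ ∘ chart K

section continuation

variable {K L M : ZSet} {φ : C(K.1, L.1)}

theorem continuous_continuation : Continuous (continuation φ) :=
  (chart L).symm.continuous.comp ((continuous_pushMap φ).comp (chart K).continuous)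

theorem continuation_id : continuation (ContinuousMap.id K.1) = id := by
  ext x; simp [continuation, pushMap_id]

theorem continuation_comp (ψ : C(L.1, M.1)) :
    continuation (ψ.comp φ) = continuation ψ ∘ continuation φ := by
  ext x; simp [continuation, pushMap_comp]

theorem continuation_apply (x : K.1) : continuation φ x = φ x := by
  rw [continuation, Function.comp_apply, Function.comp_apply, chart_apply, pushMap_evalMap,
    ← chart_apply, Homeomorph.symm_apply_apply]

theorem continuation_injective_iff :
    Function.Injective (continuation φ) ↔ Function.Injective φ := by
  refine ⟨fun h x y hxy => Subtype.ext (h ?_), fun h => ?_⟩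
  · rw [continuation_apply, continuation_apply, hxy]
  · exact (chart L).symm.injective.comp ((pushMap_injective h).comp (chart K).injective)

theorem continuation_surjective_iff :
    Function.Surjective (continuation φ) ↔ Function.Surjective φ := by
  rw [← pushMap_surjective_iff]
  exact ((chart L).symm.toEquiv.comp_surjective _).trans ((chart K).toEquiv.surjective_comp _)

end continuation

theorem isEmbedding_iff_injective {X Y : Type*} [TopologicalSpace X] [TopologicalSpace Y]
    [CompactSpace X] [T2Space Y] {f : X → Y} (hf : Continuous f) :
    IsEmbedding f ↔ Function.Injective f :=
  ⟨fun h => h.injective, fun h => (hf.isClosedEmbedding h).isEmbedding⟩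

/-- **Functor of continuation in the Hilbert cube: properties (a)-(c).**
There is an assignment `(φ, L) ↦ E φ L`, sending a continuous map `φ : K → L` between
`Z`-sets of `Q` to a continuous map `Q → Q`, which preserves identities and compositions,
extends `φ`, and preserves and reflects injectivity, surjectivity and being an embedding;
in particular it sends homeomorphisms of `K` onto `L` to homeomorphisms of `Q` onto `Q`. -/
theorem continuation_functor_hilbert_cube :
    ∃ E : ∀ K L : Set HCube, (K → L) → (HCube → HCube),
      (∀ L : Set HCube, IsZSet L → E L L id = id) ∧
      ∀ K L : Set HCube, IsZSet K → IsZSet L → ∀ φ : K → L, Continuous φ →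
        Continuous (E K L φ) ∧
        (∀ M : Set HCube, IsZSet M → ∀ ψ : L → M, Continuous ψ →
          E K M (ψ ∘ φ) = E L M ψ ∘ E K L φ) ∧
        (∀ x : K, E K L φ ↑x = ↑(φ x)) ∧
        (Function.Injective φ ↔ Function.Injective (E K L φ)) ∧
        (Function.Surjective φ ↔ Function.Surjective (E K L φ)) ∧
        (IsEmbedding φ ↔ IsEmbedding (E K L φ)) ∧
        (IsHomeomorph φ → IsHomeomorph (E K L φ)) := by
  classical
  let E : ∀ K L : Set HCube, (K → L) → (HCube → HCube) := fun K L φ =>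
    if h : (IsZSet K ∧ IsZSet L) ∧ Continuous φ then
      continuation (K := ⟨K, h.1.1⟩) (L := ⟨L, h.1.2⟩) ⟨φ, h.2⟩
    else id
  have hE : ∀ (K L : ZSet) (φ : C(K.1, L.1)), E K.1 L.1 φ = continuation φ := fun K L φ =>
    dif_pos ⟨⟨K.2, L.2⟩, φ.continuous⟩
  refine ⟨E, fun L hL => ?_, fun K L hK hL φ hφ => ?_⟩
  · exact (hE ⟨L, hL⟩ ⟨L, hL⟩ (.id L)).trans continuation_id
  · have : CompactSpace K := isCompact_iff_compactSpace.1 hK.1.isCompact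
    have h0 : E K L φ = continuation _ := hE ⟨K, hK⟩ ⟨L, hL⟩ ⟨φ, hφ⟩
    rw [h0, isEmbedding_iff_injective hφ,
      isEmbedding_iff_injective continuous_continuation, isHomeomorph_iff_continuous_bijective,
      isHomeomorph_iff_continuous_bijective]
    have hinj := continuation_injective_iff (K := ⟨K, hK⟩) (L := ⟨L, hL⟩) (φ := ⟨φ, hφ⟩)
    have hsurj := continuation_surjective_iff (K := ⟨K, hK⟩) (L := ⟨L, hL⟩) (φ := ⟨φ, hφ⟩)
    refine ⟨continuous_continuation, fun M hM ψ hψ => ?_, continuation_apply (K := ⟨K, hK⟩),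
      hinj.symm, hsurj.symm, hinj.symm, fun h => ⟨continuous_continuation,
        hinj.2 h.2.1, hsurj.2 h.2.2⟩⟩
    have h1 := hE ⟨K, hK⟩ ⟨M, hM⟩ (.comp ⟨ψ, hψ⟩ ⟨φ, hφ⟩)
    have h2 := hE ⟨L, hL⟩ ⟨M, hM⟩ ⟨ψ, hψ⟩
    exact h1.trans ((continuation_comp (K := ⟨K, hK⟩) (L := ⟨L, hL⟩) (M := ⟨M, hM⟩) _).trans
      (congrArg (· ∘ _) h2.symm))
end

section
/- Let Q = ℕ → [0,1] be the Hilbert cube with the product topology and the metric d(x,y) = Σₙ 2⁻ⁿ |xₙ − yₙ|. There exists an assignment E sending each pair (φ, L), where K and L are Z-sets in Q and φ : K → L is continuous, to a continuous map E(φ,L) : Q → Q, such that for all such pairs: (b) E(φ,L) extends φ; (d) im(E(φ,L)) ∩ L = im(φ) and closure(im(E(φ,L))) ∩ L = closure(im(φ)) (closure of im(φ) taken in L); (e) im(φ) is closed if and only if im(E(φ,L)) is closed, and im(φ) is dense in L if and only if im(E(φ,L)) is dense in Q; (f) closure(im(E(φ,L))) is homeomorphic to Q; (g) if closure(im(φ))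 ≠ L then closure(im(E(φ,L))) is a Z-set in Q, and if im(φ) ≠ L then im(E(φ,L)) is of type Z in Q. -/
open Topology Set

namespace HCube

theorem abs_sub_le_one (s t : unitInterval) : |(s : ℝ) - t| ≤ 1 :=
  abs_sub_le_iff.2 ⟨by linarith [s.2.2, t.2.1], by linarith [t.2.2, s.2.1]⟩

theorem summable_hDist (x y : HCube) :
    Summable fun n : ℕ ↦ (2 : ℝ)⁻¹ ^ n * |(x n : ℝ) - (y n : ℝ)| := by
  refine Summable.of_nonneg_of_le (fun n ↦ by positivity) (fun n ↦ ?_)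
    (summable_geometric_of_lt_one (by norm_num : (0 : ℝ) ≤ 2⁻¹) (by norm_num))
  exact mul_le_of_le_one_right (by positivity) (abs_sub_le_one _ _)

theorem hDist_mono {x y z w : HCube}
    (h : ∀ n, |(x n : ℝ) - (y n : ℝ)| ≤ |(z n : ℝ) - (w n : ℝ)|) : hDist x y ≤ hDist z w :=
  (summable_hDist x y).tsum_le_tsum
    (fun n ↦ mul_le_mul_of_nonneg_left (h n) (by positivity)) (summable_hDist z w)

theorem continuous_hDist : Continuous fun p : HCube × HCube ↦ hDist p.1 p.2 := by
  refine continuous_tsum (fun n ↦ by fun_prop)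
    (summable_geometric_of_lt_one (by norm_num : (0 : ℝ) ≤ 2⁻¹) (by norm_num)) (fun n p ↦ ?_)
  rw [Real.norm_of_nonneg (by positivity)]
  exact mul_le_of_le_one_right (by positivity) (abs_sub_le_one _ _)

theorem hDist_self (x : HCube) : hDist x x = 0 := by simp [hDist]

theorem hDist_comm (x y : HCube) : hDist x y = hDist y x := by simp only [hDist, abs_sub_comm]

theorem hDist_triangle (x y z : HCube) : hDist x z ≤ hDist x y + hDist y z := by
  unfold hDist
  rw [← (summable_hDist x y).tsum_add (summable_hDist y z)]
  refine (summable_hDist x z).tsum_le_tsum (fun n ↦ ?_)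
    ((summable_hDist x y).add (summable_hDist y z))
  rw [← mul_add]
  gcongr
  exact abs_sub_le _ _ _

theorem hDist_nonneg (x y : HCube) : 0 ≤ hDist x y := tsum_nonneg fun n ↦ by positivity

theorem eq_of_hDist_eq_zero (x y : HCube) (h : hDist x y = 0) : x = y := by
  funext n
  have h1 := (summable_hDist x y).le_tsum n (fun m _ ↦ by positivity)
  rw [show (∑' n : ℕ, (2 : ℝ)⁻¹ ^ n * |(x n : ℝ) - (y n : ℝ)|) = 0 from h] at h1
  have h2 : |(x n : ℝ) - (y n : ℝ)| ≤ 0 := by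
    by_contra! h3
    exact absurd h1 (not_le.2 (by positivity))
  exact Subtype.ext (sub_eq_zero.1 (abs_nonpos_iff.1 h2))

theorem isOpen_iff_hDist (s : Set HCube) :
    IsOpen s ↔ ∀ x ∈ s, ∃ ε > 0, ∀ y, hDist x y < ε → y ∈ s := by
  constructor
  · intro hs x hx
    rcases sᶜ.eq_empty_or_nonempty with he | hne
    · exact ⟨1, one_pos, fun y _ ↦ by simp [compl_empty_iff.1 he]⟩
    · obtain ⟨z, hz, hmin⟩ := hs.isClosed_compl.isCompact.exists_isMinOn hne
        (continuous_hDist.comp (Continuous.prodMk_right x)).continuousOn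
      refine ⟨hDist x z, (hDist_nonneg x z).lt_of_ne fun h ↦ ?_, fun y hy ↦ ?_⟩
      · exact hz (eq_of_hDist_eq_zero x z h.symm ▸ hx)
      · by_contra hys
        exact absurd (hmin hys) (not_le.2 hy)
  · intro h
    refine isOpen_iff_mem_nhds.2 fun x hx ↦ ?_
    obtain ⟨ε, hε, hs⟩ := h x hx
    have ho : IsOpen {y | hDist x y < ε} :=
      isOpen_lt (continuous_hDist.comp (Continuous.prodMk_right x)) continuous_const
    exact Filter.mem_of_superset (ho.mem_nhds (by simpa [hDist_self] using hε)) hs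

/-- The metric structure given by `hDist`; its uniformity is the product uniformity. -/
noncomputable local instance : MetricSpace HCube :=
  (MetricSpace.ofDistTopology hDist hDist_self hDist_comm hDist_triangle isOpen_iff_hDist
    eq_of_hDist_eq_zero).replaceUniformity (U := Pi.uniformSpace _) <|
      congrArg (fun U : UniformSpace HCube ↦ U.uniformity) (unique_uniformity_of_compact rfl rfl)

theorem exists_dist_lt_of_agree {ε : ℝ} (hε : 0 < ε) :
    ∃ N, ∀ m ≥ N, ∀ x y : HCube, (∀ i < m, x i = y i) → dist x y < ε := by
  have ht := tendsto_sum_nat_add fun n : ℕ ↦ (2 : ℝ)⁻¹ ^ n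
  obtain ⟨N, hN⟩ := Filter.eventually_atTop.1 (ht.eventually_lt_const hε)
  refine ⟨N, fun m hm x y h ↦ lt_of_le_of_lt ?_ (hN m hm)⟩
  have hs := summable_geometric_of_lt_one (by norm_num : (0 : ℝ) ≤ 2⁻¹) (by norm_num)
  change hDist x y ≤ _
  unfold hDist
  rw [← (summable_hDist x y).sum_add_tsum_nat_add m,
    Finset.sum_eq_zero fun i hi ↦ by simp [h i (Finset.mem_range.1 hi)], zero_add]
  refine ((summable_nat_add_iff m).2 (summable_hDist x y)).tsum_le_tsum (fun n ↦ ?_)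
    ((summable_nat_add_iff m).2 hs)
  exact mul_le_of_le_one_right (by positivity) (abs_sub_le_one _ _)

/-- The first `n` coordinates of `p` followed by the coordinates of `q`. -/
def splice (n : ℕ) (p q : HCube) : HCube := fun i ↦ if i < n then p i else q (i - n)

theorem splice_of_lt {n i : ℕ} (h : i < n) (p q : HCube) : splice n p q i = p i := if_pos h

theorem splice_add (n i : ℕ) (p q : HCube) : splice n p q (n + i) = q i := by simp [splice]

theorem splice_right_injective {n : ℕ} {p p' q q' : HCube} (h : splice n p q = splice n p' q') :
    q = q' := by
  funext i
  simpa only [splice_add] using congrFun h (n + i)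

@[fun_prop]
theorem continuous_splice {X : Type*} [TopologicalSpace X] (n : ℕ) {f g : X → HCube}
    (hf : Continuous f) (hg : Continuous g) : Continuous fun x ↦ splice n (f x) (g x) := by
  refine continuous_pi fun i ↦ ?_
  unfold splice
  split_ifs <;> fun_prop

theorem dist_splice_lt {ε : ℝ} (hε : 0 < ε) :
    ∃ N, ∀ m ≥ N, ∀ p q : HCube, dist p (splice m p q) < ε := by
  obtain ⟨N, hN⟩ := exists_dist_lt_of_agree hε
  exact ⟨N, fun m hm p q ↦ hN m hm _ _ fun i hi ↦ (splice_of_lt hi p q).symm⟩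

theorem isZType_iff_dense {A : Set HCube} :
    IsZType A ↔ Dense {f : C(HCube, HCube) | MapsTo f univ Aᶜ} := by
  rw [Metric.dense_iff]
  constructor
  · intro h f ε hε
    obtain ⟨g, hg, hgA, hfg⟩ := h ε hε f f.continuous
    refine ⟨⟨g, hg⟩, ?_, fun x _ hx ↦ hgA.subset ⟨mem_range_self x, hx⟩⟩
    rw [Metric.mem_ball, dist_comm]
    exact ContinuousMap.dist_lt_of_nonempty hfg
  · intro h ε hε f hf
    obtain ⟨g, hfg, hg⟩ := h ⟨f, hf⟩ ε hε
    refine ⟨g, g.continuous, eq_empty_of_forall_notMem ?_, fun q ↦ ?_⟩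
    · rintro _ ⟨⟨x, rfl⟩, hx⟩
      exact hg (mem_univ x) hx
    · rw [Metric.mem_ball, dist_comm] at hfg
      exact (ContinuousMap.dist_lt_iff hε).1 hfg q

theorem _root_.IsZType.mono {A B : Set HCube} (hB : IsZType B) (h : A ⊆ B) : IsZType A :=
  isZType_iff_dense.2 <| (isZType_iff_dense.1 hB).mono fun _ hf ↦
    hf.mono_right (compl_subset_compl.2 h)

theorem _root_.IsZType.ne_univ {A : Set HCube} (hA : IsZType A) : A ≠ univ := by
  rintro rfl
  obtain ⟨g, -, hg, -⟩ := hA 1 one_pos id continuous_id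
  simp at hg

theorem isZType_iUnion {ι : Type*} [Countable ι] {A : ι → Set HCube} (hc : ∀ i, IsClosed (A i))
    (hA : ∀ i, IsZType (A i)) : IsZType (⋃ i, A i) := by
  refine isZType_iff_dense.2 ((dense_iInter_of_isOpen
    (fun i ↦ ContinuousMap.isOpen_setOfPred_mapsTo isCompact_univ (hc i).isOpen_compl)
    fun i ↦ isZType_iff_dense.1 (hA i)).mono fun f hf x _ hx ↦ ?_)
  obtain ⟨i, hi⟩ := mem_iUnion.1 hx
  exact mem_iInter.1 hf i (mem_univ x) hi

theorem isZType_of_coordinates {A : Set HCube} (h : ∀ N, ∃ m ≥ N, ∀ x ∈ A, x m ≠ 1) :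
    IsZType A := by
  intro ε hε f hf
  obtain ⟨N, hN⟩ := dist_splice_lt hε
  obtain ⟨m, hm, hA⟩ := h N
  refine ⟨fun x ↦ splice m (f x) 1, by fun_prop, eq_empty_of_forall_notMem ?_,
    fun q ↦ hN m hm _ _⟩
  rintro _ ⟨⟨x, rfl⟩, hx⟩
  exact hA _ hx (splice_add m 0 _ _)

theorem exists_surjective_extension {K : Set HCube} (hK : IsClosed K) (hne : K ≠ univ)
    {ψ : K → HCube} (hψ : Continuous ψ) :
    ∃ Φ : C(HCube, HCube), (∀ x : K, Φ x = ψ x) ∧ Function.Surjective Φ := by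
  obtain ⟨p, hp⟩ := (ne_univ_iff_exists_notMem K).1 hne
  obtain ⟨ε, hε, hball⟩ := Metric.isOpen_iff.1 hK.isOpen_compl p hp
  obtain ⟨N, hN⟩ := dist_splice_lt hε
  have hdisj (q : HCube) : splice N p q ∉ K :=
    hball (by rw [Metric.mem_ball, dist_comm]; exact hN N le_rfl p q)
  have : CompactSpace K := isCompact_iff_compactSpace.1 hK.isCompact
  have he : IsClosedEmbedding (Sum.elim ((↑) : K → HCube) (splice N p)) := by
    refine Continuous.isClosedEmbedding
      (continuous_subtype_val.sumElim (continuous_splice N continuous_const continuous_id)) ?_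
    refine Subtype.val_injective.sumElim (fun q q' h ↦ splice_right_injective h) ?_
    exact fun x q h ↦ hdisj q (h ▸ x.2)
  obtain ⟨Φ, hΦ⟩ := ContinuousMap.exists_extension he ⟨Sum.elim ψ id, hψ.sumElim continuous_id⟩
  exact ⟨Φ, fun x ↦ DFunLike.congr_fun hΦ (Sum.inl x),
    fun q ↦ ⟨splice N p q, DFunLike.congr_fun hΦ (Sum.inr q)⟩⟩

theorem exists_zeroLocus_eq {M : Set HCube} (hM : IsClosed M) :
    ∃ u : C(HCube, ℝ), (∀ x, 0 ≤ u x) ∧ ∀ x, u x = 0 ↔ x ∈ M := by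
  rcases M.eq_empty_or_nonempty with rfl | hne
  · exact ⟨1, by simp⟩
  · exact ⟨⟨fun x ↦ Metric.infDist x M, Metric.continuous_infDist_pt M⟩,
      fun x ↦ Metric.infDist_nonneg, fun x ↦ (hM.mem_iff_infDist_zero hne).symm⟩

/-- Coordinatewise convex combination. -/
def mix (x y : HCube) (t : unitInterval) : HCube := fun i ↦ Icc.convexComb (x i) (y i) t

theorem dist_mix_le (x y : HCube) (t : unitInterval) : dist (mix x y t) x ≤ dist y x := by
  refine hDist_mono fun n ↦ ?_
  have : (mix x y t n : ℝ) - x n = t * (y n - x n) := by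
    simp only [mix, Icc.coe_convexComb]; ring
  rw [this, abs_mul, abs_of_nonneg t.2.1]
  exact mul_le_of_le_one_left (abs_nonneg _) t.2.2

theorem dense_fixing_of_dense {M : Set HCube} {u : C(HCube, ℝ)} (hu : ∀ x ∈ M, u x = 0) (n : ℕ)
    {P : Set C(HCube, HCube)} (hP : Dense P)
    (hcongr : ∀ f ∈ P, ∀ g : C(HCube, HCube), EqOn f g {x | 1 ≤ n * u x} → g ∈ P) :
    Dense {f : {f : C(HCube, HCube) // EqOn f id M} | f.1 ∈ P} := by
  rw [Metric.dense_iff]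
  rintro ⟨f, hf⟩ ε hε
  obtain ⟨g, hgf, hg⟩ := Metric.dense_iff.1 hP f ε hε
  let h : C(HCube, HCube) :=
    ⟨fun x ↦ mix (f x) (g x) (projIcc 0 1 zero_le_one (n * u x)), continuous_pi fun i ↦
      Icc.continuous_convexComb_prod.comp (f := fun x ↦
        (f x i, g x i, projIcc (0 : ℝ) 1 zero_le_one (n * u x)))
        (by have := continuous_projIcc (a := (0 : ℝ)) (b := 1) (h := zero_le_one); fun_prop)⟩
  have hhM : EqOn h id M := fun x hx ↦ by
    rw [← hf hx]
    funext i
    simp [h, mix, hu x hx]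
  refine ⟨⟨h, hhM⟩, ?_, hcongr g hg h fun x hx ↦ ?_⟩
  · rw [Metric.mem_ball, ContinuousMap.dist_lt_iff hε] at hgf
    exact (ContinuousMap.dist_lt_iff hε).2 fun x ↦ (dist_mix_le _ _ _).trans_lt (hgf x)
  · funext i
    have hx' : 1 ≤ n * u x := hx
    simp [h, mix, projIcc_of_right_le zero_le_one hx']

theorem dense_separating (C : Set HCube) {δ : ℝ} (hδ : 0 < δ) :
    Dense {f : C(HCube, HCube) | ∀ x ∈ C, ∀ y ∈ C, δ ≤ dist x y → f x ≠ f y} := by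
  refine Metric.dense_iff.2 fun f ε hε ↦ ?_
  obtain ⟨N, hN⟩ := dist_splice_lt hε
  refine ⟨⟨fun x ↦ splice N (f x) x, by fun_prop⟩, ?_, fun x _ y _ hxy h ↦ ?_⟩
  · rw [Metric.mem_ball, dist_comm]
    exact ContinuousMap.dist_lt_of_nonempty fun x ↦ hN N le_rfl _ _
  · rw [splice_right_injective h, dist_self] at hxy
    exact absurd hxy (not_le.2 hδ)

theorem isOpen_separating {C : Set HCube} (hC : IsCompact C) (δ : ℝ) :
    IsOpen {f : C(HCube, HCube) | ∀ x ∈ C, ∀ y ∈ C, δ ≤ dist x y → f x ≠ f y} := by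
  have hcomp : IsCompact ((C ×ˢ C) ∩ {p : HCube × HCube | δ ≤ dist p.1 p.2}) :=
    (hC.prod hC).inter_right (isClosed_le continuous_const continuous_dist)
  have hcont : Continuous fun f : C(HCube, HCube) ↦
      (f.comp ContinuousMap.fst).prodMk (f.comp ContinuousMap.snd) :=
    ContinuousMap.continuous_of_continuous_uncurry _ (by
      change Continuous fun p : C(HCube, HCube) × HCube × HCube ↦ (p.1 p.2.1, p.1 p.2.2)
      fun_prop)
  convert (ContinuousMap.isOpen_setOfPred_mapsTo hcomp
    (isClosed_diagonal (X := HCube)).isOpen_compl).preimage hcont using 1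
  ext f
  exact ⟨fun h p hp ↦ h _ hp.1.1 _ hp.1.2 hp.2,
    fun h x hx y hy hxy ↦ h (x := (x, y)) ⟨⟨hx, hy⟩, hxy⟩⟩

theorem dense_avoiding_coordinate (C : Set HCube) (N : ℕ) :
    Dense (⋃ m ≥ N, {f : C(HCube, HCube) | MapsTo f C {x | x m ≠ 1}}) := by
  refine Metric.dense_iff.2 fun f ε hε ↦ ?_
  obtain ⟨N', hN⟩ := dist_splice_lt hε
  refine ⟨⟨fun x ↦ splice (max N N') (f x) 0, by fun_prop⟩, ?_,
    mem_iUnion₂.2 ⟨max N N', le_max_left _ _, fun x _ ↦ ?_⟩⟩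
  · rw [Metric.mem_ball, dist_comm]
    exact ContinuousMap.dist_lt_of_nonempty fun x ↦ hN _ (le_max_right _ _) _ _
  · change splice _ _ _ _ ≠ 1
    simp [splice]

theorem isOpen_avoiding_coordinate {C : Set HCube} (hC : IsCompact C) (N : ℕ) :
    IsOpen (⋃ m ≥ N, {f : C(HCube, HCube) | MapsTo f C {x | x m ≠ 1}}) :=
  isOpen_biUnion fun m _ ↦ ContinuousMap.isOpen_setOfPred_mapsTo hC
    (isOpen_compl_singleton.preimage (continuous_apply m))

theorem eventually_one_le_natCast_mul {a : ℝ} (ha : 0 < a) :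
    ∀ᶠ n : ℕ in Filter.atTop, 1 ≤ n * a :=
  (tendsto_natCast_atTop_atTop.atTop_mul_const ha).eventually_ge_atTop 1

/-- A closed subset `M` of a `Z`-set `L` is the trace on `L` of a copy of `Q` which is of type `Z`;
the copy can be parametrized by an embedding fixing `M` pointwise. -/
theorem exists_embedding_inter_eq {L M : Set HCube} (hL : IsZSet L) (hM : IsClosed M)
    (hML : M ⊆ L) :
    ∃ e : C(HCube, HCube), EqOn e id M ∧ Function.Injective e ∧ range e ∩ L = M ∧
      IsZType (range e) := by
  obtain ⟨u, hu0, huM⟩ := exists_zeroLocus_eq hM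
  let C (n : ℕ) : Set HCube := {x | 1 ≤ n * u x}
  have hC (n : ℕ) : IsCompact (C n) :=
    (isClosed_le continuous_const (by fun_prop)).isCompact
  have huM' (x : HCube) (hx : x ∈ M) : u x = 0 := (huM x).2 hx
  have hCM (x : HCube) (hx : x ∉ M) : ∀ᶠ n in Filter.atTop, x ∈ C n :=
    eventually_one_le_natCast_mul ((hu0 x).lt_of_ne fun h ↦ hx ((huM x).1 h.symm))
  have hX : IsClosed {f : C(HCube, HCube) | EqOn f id M} := by
    simp only [EqOn, ofPred_forall]
    exact isClosed_biInter fun x _ ↦ isClosed_eq (continuous_eval_const x)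
      continuous_const
  have : CompleteSpace {f : C(HCube, HCube) // EqOn f id M} := hX.completeSpace_coe
  have : Nonempty {f : C(HCube, HCube) // EqOn f id M} := ⟨⟨ContinuousMap.id _, fun _ _ ↦ rfl⟩⟩
  let X := {f : C(HCube, HCube) // EqOn f id M}
  have havoid (n : ℕ) : IsOpen {f : X | MapsTo f.1 (C n) Lᶜ} ∧
      Dense {f : X | MapsTo f.1 (C n) Lᶜ} :=
    ⟨(ContinuousMap.isOpen_setOfPred_mapsTo (hC n) hL.1.isOpen_compl).preimage
      continuous_subtype_val,
    dense_fixing_of_dense huM' n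
      ((isZType_iff_dense.1 hL.2).mono fun f hf ↦ MapsTo.mono_left hf (subset_univ _))
      fun f hf g hfg ↦ MapsTo.congr hf hfg⟩
  have hsep (n : ℕ) :
      IsOpen {f : X | ∀ x ∈ C n, ∀ y ∈ C n, (n + 1 : ℝ)⁻¹ ≤ dist x y → f.1 x ≠ f.1 y} ∧
      Dense {f : X | ∀ x ∈ C n, ∀ y ∈ C n, (n + 1 : ℝ)⁻¹ ≤ dist x y → f.1 x ≠ f.1 y} :=
    ⟨(isOpen_separating (hC n) _).preimage continuous_subtype_val,
    dense_fixing_of_dense huM' n (dense_separating (C n) (by positivity))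
      fun f hf g hfg x hx y hy hxy ↦ hfg hx ▸ hfg hy ▸ hf x hx y hy hxy⟩
  have hcoord (p : ℕ × ℕ) :
      IsOpen {f : X | f.1 ∈ ⋃ m ≥ p.2, {f : C(HCube, HCube) | MapsTo f (C p.1) {x | x m ≠ 1}}} ∧
      Dense {f : X | f.1 ∈ ⋃ m ≥ p.2, {f : C(HCube, HCube) | MapsTo f (C p.1) {x | x m ≠ 1}}} :=
    ⟨(isOpen_avoiding_coordinate (hC p.1) p.2).preimage continuous_subtype_val,
    dense_fixing_of_dense huM' p.1 (dense_avoiding_coordinate (C p.1) p.2) fun f hf g hfg ↦ by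
      obtain ⟨m, hm, hf⟩ := mem_iUnion₂.1 hf
      exact mem_iUnion₂.2 ⟨m, hm, MapsTo.congr hf hfg⟩⟩
  obtain ⟨⟨e, heM⟩, ⟨he₁, he₂⟩, he₃⟩ :=
    (((dense_iInter_of_isOpen (fun n ↦ (havoid n).1) fun n ↦ (havoid n).2).inter_of_Gδ
      (.iInter_of_isOpen fun n ↦ (havoid n).1) (.iInter_of_isOpen fun n ↦ (hsep n).1)
      (dense_iInter_of_isOpen (fun n ↦ (hsep n).1) fun n ↦ (hsep n).2)).inter_of_Gδ
      ((IsGδ.iInter_of_isOpen fun n ↦ (havoid n).1).inter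
        (.iInter_of_isOpen fun n ↦ (hsep n).1)) (.iInter_of_isOpen fun n ↦ (hcoord n).1)
      (dense_iInter_of_isOpen (fun n ↦ (hcoord n).1) fun n ↦ (hcoord n).2)).nonempty
  have heL (x : HCube) (hx : x ∉ M) : e x ∉ L := by
    obtain ⟨n, hn⟩ := (hCM x hx).exists
    exact mem_iInter.1 he₁ n hn
  refine ⟨e, heM, fun x y hxy ↦ ?_, ?_, ?_⟩
  · by_cases hx : x ∈ M <;> by_cases hy : y ∈ M
    · rwa [heM hx, heM hy] at hxy
    · exact absurd (hxy ▸ (heM hx).symm ▸ hML hx) (heL y hy)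
    · exact absurd (hxy.symm ▸ (heM hy).symm ▸ hML hy) (heL x hx)
    · by_contra hne
      have hlim := (tendsto_one_div_add_atTop_nhds_zero_nat (𝕜 := ℝ)).eventually_lt_const
        (dist_pos.2 hne)
      obtain ⟨n, ⟨hnx, hny⟩, hn⟩ := (((hCM x hx).and (hCM y hy)).and hlim).exists
      rw [one_div] at hn
      exact mem_iInter.1 he₂ n x hnx y hny hn.le hxy
  · ext y
    refine ⟨?_, fun hy ↦ ⟨⟨y, heM hy⟩, hML hy⟩⟩
    rintro ⟨⟨x, rfl⟩, hx⟩
    by_contra hy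
    have hxM : x ∈ M := by_contra fun h ↦ heL x h hx
    exact hy ((heM hxM).symm ▸ hxM)
  · refine (isZType_iUnion (A := fun o : Option ℕ ↦ o.elim M fun n ↦ e '' C n) ?_ ?_).mono ?_
    · rintro (_ | n)
      exacts [hM, ((hC n).image e.continuous).isClosed]
    · rintro (_ | n)
      · exact hL.2.mono hML
      · refine isZType_of_coordinates fun N ↦ ?_
        obtain ⟨m, hm, h⟩ := mem_iUnion₂.1 (mem_iInter.1 he₃ (n, N))
        exact ⟨m, hm, forall_mem_image.2 h⟩
    · rintro _ ⟨x, rfl⟩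
      by_cases hx : x ∈ M
      · exact mem_iUnion.2 ⟨none, (heM hx).symm ▸ hx⟩
      · obtain ⟨n, hn⟩ := (hCM x hx).exists
        exact mem_iUnion.2 ⟨some n, mem_image_of_mem e hn⟩

theorem exists_continuation {K L : Set HCube} (hK : IsZSet K) (hL : IsZSet L) {φ : K → L}
    (hφ : Continuous φ) :
    ∃ F : HCube → HCube, Continuous F ∧ (∀ x : K, F x = φ x) ∧
      range F ∩ L = Subtype.val '' range φ ∧ Nonempty (range F ≃ₜ HCube) ∧
      (range φ = univ → range F = univ) ∧ (range φ ≠ univ → IsZType (range F)) := by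
  have : CompactSpace K := isCompact_iff_compactSpace.1 hK.1.isCompact
  obtain ⟨Φ, hΦ, hsurj⟩ := exists_surjective_extension hK.1 hK.2.ne_univ
    (continuous_subtype_val.comp hφ)
  by_cases hφs : range φ = univ
  · have hr : range Φ = univ := hsurj.range_eq
    refine ⟨Φ, Φ.continuous, hΦ, ?_, ?_, fun _ ↦ hr, fun h ↦ absurd hφs h⟩
    · rw [hr, hφs, univ_inter, image_univ, Subtype.range_coe]
    · rw [hr]
      exact ⟨Homeomorph.Set.univ _⟩
  · have hM : IsClosed (Subtype.val '' range φ) :=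
      ((isCompact_range hφ).image continuous_subtype_val).isClosed
    obtain ⟨e, heM, hinj, hinter, hZ⟩ :=
      exists_embedding_inter_eq hL hM (Subtype.coe_image_subset _ _)
    have hr : range (e ∘ Φ) = range e := hsurj.range_comp e
    refine ⟨e ∘ Φ, e.continuous.comp Φ.continuous, fun x ↦ ?_, hr ▸ hinter, ?_,
      fun h ↦ absurd h hφs, fun _ ↦ hr ▸ hZ⟩
    · rw [Function.comp_apply, hΦ]
      exact heM ⟨φ x, mem_range_self x, rfl⟩
    · rw [hr]
      exact ⟨(e.continuous.isClosedEmbedding hinj).isEmbedding.toHomeomorph.symm⟩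

end HCube

/-- **Functor of continuation in the Hilbert cube: properties (b), (d)-(g).**
There is an assignment `(φ, L) ↦ E φ L`, sending a continuous map `φ : K → L` between
`Z`-sets of `Q` to a continuous map `Q → Q`, such that: `E φ L` extends `φ`;
`im(E φ L) ∩ L = im φ` and `closure (im (E φ L)) ∩ L = closure (im φ)` (the latter closure
computed in `L`); `im φ` is closed iff `im (E φ L)` is closed, and `im φ` is dense in `L`
iff `im (E φ L)` is dense in `Q`; `closure (im (E φ L))` is homeomorphic to `Q`; and if
`closure (im φ) ≠ L` then `closure (im (E φ L))` is a `Z`-set in `Q`, while if `im φ ≠ L`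
then `im (E φ L)` is of type `Z` in `Q`. -/
theorem continuation_functor_hilbert_cube_images :
    ∃ E : ∀ K L : Set HCube, (K → L) → (HCube → HCube),
      ∀ K L : Set HCube, IsZSet K → IsZSet L → ∀ φ : K → L, Continuous φ →
        Continuous (E K L φ) ∧
        (∀ x : K, E K L φ ↑x = ↑(φ x)) ∧
        (Set.range (E K L φ) ∩ L = Subtype.val '' Set.range φ) ∧
        (closure (Set.range (E K L φ)) ∩ L = Subtype.val '' closure (Set.range φ)) ∧
        (IsClosed (Set.range φ) ↔ IsClosed (Set.range (E K L φ))) ∧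
        (Dense (Set.range φ) ↔ Dense (Set.range (E K L φ))) ∧
        Nonempty (↥(closure (Set.range (E K L φ))) ≃ₜ HCube) ∧
        (closure (Set.range φ) ≠ Set.univ → IsZSet (closure (Set.range (E K L φ)))) ∧
        (Set.range φ ≠ Set.univ → IsZType (Set.range (E K L φ))) := by
  classical
  refine ⟨fun K L φ ↦ if h : IsZSet K ∧ IsZSet L ∧ Continuous φ then
    (HCube.exists_continuation h.1 h.2.1 h.2.2).choose else id, fun K L hK hL φ hφ ↦ ?_⟩
  beta_reduce
  rw [dif_pos ⟨hK, hL, hφ⟩]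
  obtain ⟨hF, hext, hinter, hhomeo, huniv, hZ⟩ :=
    (HCube.exists_continuation hK hL hφ).choose_spec
  set F := (HCube.exists_continuation hK hL hφ).choose
  have : CompactSpace K := isCompact_iff_compactSpace.1 hK.1.isCompact
  have hcF : IsClosed (range F) := (isCompact_range hF).isClosed
  have hcφ : IsClosed (range φ) := (isCompact_range hφ).isClosed
  rw [dense_iff_closure_eq, dense_iff_closure_eq, hcF.closure_eq, hcφ.closure_eq]
  refine ⟨hF, hext, hinter, hinter, iff_of_true hcφ hcF, ⟨huniv, fun h ↦ ?_⟩, hhomeo,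
    fun h ↦ ⟨hcF, hZ h⟩, hZ⟩
  by_contra hne
  exact (hZ hne).ne_univ h
end

section
/- Let Q = ℕ → [0,1] be the Hilbert cube with the product topology and the metric ρ(x,y) = Σₙ 2⁻ⁿ |xₙ − yₙ|. There exists an assignment E sending each pair (φ, L), where K and L are Z-sets in Q and φ : K → L is continuous, to a continuous map E(φ,L) : Q → Q extending φ, with the following additional property: for every Z-set L in Q and every bounded metric d on L inducing the subspace topology of L, there exists a metric d̂ on Q inducing the topology of Q such that d̂ restricted to L × L equals d, diam(Q, d̂) = max(1, diam(L,d)), and for every Z-set K in Q and all continuous φ, ψ : K → L one has sup_{x ∈ Q} d̂(E(φ,L)(x), E(ψ,L)(x)) = sup_{x ∈ K} d(φ(x), ψ(x)); moreover, if d is a complete metric then d̂ can be chosen complete. -/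
open Topology Set

/-- `ρ` is a metric on `S` inducing the given topology of `S`. -/
def IsCompatibleMetric {S : Type*} [TopologicalSpace S] (ρ : S → S → ℝ) : Prop :=
  (∀ x y, ρ x y = ρ y x) ∧ (∀ x y, ρ x y = 0 ↔ x = y) ∧
  (∀ x y z, ρ x z ≤ ρ x y + ρ y z) ∧
  (∀ U : Set S, IsOpen U ↔ ∀ x ∈ U, ∃ ε > (0 : ℝ), {y | ρ x y < ε} ⊆ U)

/-- `ρ` is a complete metric: every `ρ`-Cauchy sequence `ρ`-converges. -/
def IsCompleteMetricOn {S : Type*} (ρ : S → S → ℝ) : Prop :=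
  ∀ u : ℕ → S, (∀ ε > (0 : ℝ), ∃ N, ∀ m ≥ N, ∀ n ≥ N, ρ (u m) (u n) < ε) →
    ∃ x : S, ∀ ε > (0 : ℝ), ∃ N, ∀ n ≥ N, ρ (u n) x < ε

/-- The diameter of `S` with respect to `ρ`. -/
noncomputable def metrDiam {S : Type*} (ρ : S → S → ℝ) : ℝ :=
  sSup {r : ℝ | ∃ x y : S, r = ρ x y}

open Filter

section CompactMetrics

variable {X : Type*} [TopologicalSpace X] {D : X → X → ℝ}

theorem IsCompatibleMetric.self_eq_zero (h : IsCompatibleMetric D) (x : X) : D x x = 0 :=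
  (h.2.1 x x).2 rfl

theorem IsCompatibleMetric.nonneg (h : IsCompatibleMetric D) (x y : X) : 0 ≤ D x y := by
  have h1 := h.2.2.1 x y x
  rw [h.self_eq_zero, h.1 y x] at h1
  linarith

theorem IsCompatibleMetric.isOpen_ball (h : IsCompatibleMetric D) (x : X) (ε : ℝ) :
    IsOpen {y | D x y < ε} := by
  rw [h.2.2.2]
  intro y hy
  refine ⟨ε - D x y, sub_pos.2 hy, fun z hz ↦ ?_⟩
  have := h.2.2.1 x y z
  change D y z < ε - D x y at hz
  change D x z < ε
  linarith

theorem IsCompatibleMetric.ball_mem_nhds (h : IsCompatibleMetric D) (x : X) {ε : ℝ}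
    (hε : 0 < ε) : {y | D x y < ε} ∈ 𝓝 x :=
  (h.isOpen_ball x ε).mem_nhds (by simpa [h.self_eq_zero] using hε)

/-- A function that is Lipschitz with respect to a compatible metric is continuous. -/
theorem IsCompatibleMetric.continuous_of_abs_sub_le (h : IsCompatibleMetric D) {f : X → ℝ} {C : ℝ}
    (hf : ∀ x y, |f x - f y| ≤ C * D x y) : Continuous f := by
  rw [continuous_iff_continuousAt]
  intro x
  rw [ContinuousAt, Metric.tendsto_nhds]
  intro ε hε
  have hC : 0 < |C| + 1 := by positivity
  filter_upwards [h.ball_mem_nhds x (div_pos hε hC)] with y (hy : D x y < _)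
  rw [Real.dist_eq, abs_sub_comm]
  have h1 := hf x y
  have h0 := h.nonneg x y
  rw [lt_div_iff₀ hC] at hy
  nlinarith [le_abs_self C]

/-- A continuous metric on a compact space induces its topology. -/
theorem isCompatibleMetric_of_continuous [CompactSpace X]
    (hcont : Continuous fun p : X × X ↦ D p.1 p.2) (hsymm : ∀ x y, D x y = D y x)
    (hzero : ∀ x y, D x y = 0 ↔ x = y) (htri : ∀ x y z, D x z ≤ D x y + D y z) :
    IsCompatibleMetric D := by
  have hnn : ∀ x y, 0 ≤ D x y := fun x y ↦ by
    have h1 := htri x y x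
    rw [(hzero x x).2 rfl, hsymm y x] at h1
    linarith
  have hc : ∀ x, Continuous (D x) := fun x ↦ hcont.comp (by fun_prop : Continuous fun y ↦ (x, y))
  refine ⟨hsymm, hzero, htri, fun U ↦ ⟨fun hU x hx ↦ ?_, fun hU ↦ ?_⟩⟩
  · rcases (Uᶜ).eq_empty_or_nonempty with he | hne
    · exact ⟨1, one_pos, by simp [compl_empty_iff.1 he]⟩
    · obtain ⟨z, hz, hmin⟩ :=
        hU.isClosed_compl.isCompact.exists_isMinOn hne (hc x).continuousOn
      refine ⟨D x z, lt_of_le_of_ne (hnn x z) fun h0 ↦ hz ?_, fun y hy ↦ ?_⟩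
      · rwa [← (hzero x z).1 h0.symm]
      · by_contra hyU
        exact not_le_of_gt hy (isMinOn_iff.1 hmin y hyU)
  · rw [isOpen_iff_mem_nhds]
    intro x hx
    obtain ⟨ε, hε, hsub⟩ := hU x hx
    refine mem_of_superset ?_ hsub
    exact (isOpen_lt (hc x) continuous_const).mem_nhds (by simpa [(hzero x x).2 rfl] using hε)

/-- A compatible metric on a sequentially compact space is complete. -/
theorem IsCompatibleMetric.isCompleteMetricOn [SeqCompactSpace X] (h : IsCompatibleMetric D) :
    IsCompleteMetricOn D := by
  intro u hu
  obtain ⟨x, φ, hφ, hx⟩ := SeqCompactSpace.tendsto_subseq u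
  refine ⟨x, fun ε hε ↦ ?_⟩
  obtain ⟨N, hN⟩ := hu (ε / 2) (half_pos hε)
  refine ⟨N, fun n hn ↦ ?_⟩
  obtain ⟨m, hm, hmN⟩ :=
    ((hx.eventually (h.ball_mem_nhds x (half_pos hε))).and (eventually_ge_atTop N)).exists
  have h1 := hN n hn (φ m) (hmN.trans (hφ.id_le m))
  have h2 := h.2.2.1 (u n) (u (φ m)) x
  rw [h.1 (u (φ m)) x] at h2
  change D x (u (φ m)) < ε / 2 at hm
  linarith

/-- A compact metrizable space carries a continuous pseudometric with maximal value `1` that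
vanishes exactly on the diagonal and on the square of a given proper closed set. -/
theorem exists_pseudometric_collapsing [CompactSpace X] [TopologicalSpace.MetrizableSpace X]
    {A : Set X} (hA : IsClosed A) (hne : A.Nonempty) (hA' : A ≠ univ) :
    ∃ q : X → X → ℝ, Continuous (fun p : X × X ↦ q p.1 p.2) ∧ (∀ x y, q x y = q y x) ∧
      (∀ x y z, q x z ≤ q x y + q y z) ∧ (∀ x y, 0 ≤ q x y) ∧ (∀ x y, q x y ≤ 1) ∧
      (∃ x y, q x y = 1) ∧ (∀ x ∈ A, ∀ y ∈ A, q x y = 0) ∧ (∀ x, q x x = 0) ∧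
      (∀ x y, q x y = 0 → x = y ∨ x ∈ A ∧ y ∈ A) := by
  let _ := TopologicalSpace.metrizableSpaceMetric X
  set u : X → ℝ := fun x ↦ Metric.infDist x A with hu
  have hu0 : ∀ x, 0 ≤ u x := fun x ↦ Metric.infDist_nonneg
  have huA : ∀ x, u x = 0 ↔ x ∈ A := fun x ↦ (hA.mem_iff_infDist_zero hne).symm
  have hul : ∀ x y, u x ≤ dist x y + u y := fun x y ↦ by
    rw [add_comm]; exact Metric.infDist_le_infDist_add_dist
  set q : X → X → ℝ := fun x y ↦ min (dist x y) (u x + u y) with hq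
  have hqc : Continuous (fun p : X × X ↦ q p.1 p.2) := by
    have : Continuous u := Metric.continuous_infDist_pt A
    simp only [hq]
    fun_prop
  have hqs : ∀ x y, q x y = q y x := fun x y ↦ by simp only [hq, dist_comm, add_comm]
  have hq0 : ∀ x y, 0 ≤ q x y := fun x y ↦ le_min dist_nonneg (add_nonneg (hu0 x) (hu0 y))
  have hqt : ∀ x y z, q x z ≤ q x y + q y z := fun x y z ↦ by
    have h1 := dist_triangle x y z
    have h2 := hul x y
    have h3 := hul z y
    have := hu0 x
    have := hu0 y
    have := hu0 z
    rw [dist_comm z y] at h3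
    simp only [hq]
    rcases min_cases (dist x y) (u x + u y) with h | h <;>
    rcases min_cases (dist y z) (u y + u z) with h' | h' <;>
    rw [h.1, h'.1, min_le_iff] <;>
    first
      | (left; linarith)
      | (right; linarith)
  have hqz : ∀ x y, q x y = 0 → x = y ∨ x ∈ A ∧ y ∈ A := fun x y h ↦ by
    rcases min_cases (dist x y) (u x + u y) with h' | h'
    · exact Or.inl (dist_eq_zero.1 (h'.1.symm.trans h))
    · have h3 : u x + u y = 0 := h'.1.symm.trans h
      have := hu0 x
      have := hu0 y
      exact Or.inr ⟨(huA x).1 (by linarith), (huA y).1 (by linarith)⟩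
  have hqA : ∀ x ∈ A, ∀ y ∈ A, q x y = 0 := fun x hx y hy ↦ by
    simp [hq, (huA x).2 hx, (huA y).2 hy]
  have : Nonempty X := ⟨hne.some⟩
  obtain ⟨m, -, hm⟩ := isCompact_univ.exists_isMaxOn (univ_nonempty (α := X × X)) hqc.continuousOn
  have hM : ∀ x y, q x y ≤ q m.1 m.2 := fun x y ↦ hm (mem_univ (x, y))
  have hpos : 0 < q m.1 m.2 := by
    obtain ⟨x, hx⟩ := (ne_univ_iff_exists_notMem A).1 hA'
    refine lt_of_lt_of_le (lt_of_le_of_ne (hq0 x hne.some) fun h ↦ hx ?_) (hM x hne.some)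
    rcases hqz _ _ h.symm with h' | h'
    · rw [h']; exact hne.some_mem
    · exact h'.1
  refine ⟨fun x y ↦ q x y / q m.1 m.2, hqc.div_const _, fun x y ↦ congrArg (· / _) (hqs x y),
    fun x y z ↦ ?_, fun x y ↦ div_nonneg (hq0 x y) hpos.le,
    fun x y ↦ (div_le_one hpos).2 (hM x y), ⟨m.1, m.2, div_self hpos.ne'⟩,
    fun x hx y hy ↦ by simp [hqA x hx y hy], fun x ↦ ?_, fun x y h ↦ hqz x y ?_⟩
  · rw [← add_div]
    exact div_le_div_of_nonneg_right (hqt x y z) hpos.le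
  · have : q x x = 0 := by
      simp only [hq, dist_self]
      exact min_eq_left (add_nonneg (hu0 x) (hu0 x))
    simp [this]
  · simpa [hpos.ne'] using h

end CompactMetrics

section States

variable {X Y : Type*} [TopologicalSpace X] [CompactSpace X] [TopologicalSpace Y] [CompactSpace Y]

/-- The states of `C(X, ℝ)`: normalized linear functionals of norm at most one. -/
def StateSpace (X : Type*) [TopologicalSpace X] [CompactSpace X] : Type _ :=
  {Λ : C(X, ℝ) → ℝ // (∀ f g, Λ (f + g) = Λ f + Λ g) ∧ (∀ (c : ℝ) f, Λ (c • f) = c * Λ f) ∧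
    (∀ f, |Λ f| ≤ ‖f‖) ∧ Λ 1 = 1}

namespace StateSpace

instance : FunLike (StateSpace X) C(X, ℝ) ℝ where
  coe Λ := Λ.1
  coe_injective _ _ h := Subtype.ext h

instance : TopologicalSpace (StateSpace X) :=
  inferInstanceAs (TopologicalSpace (Subtype _))

instance : T2Space (StateSpace X) :=
  inferInstanceAs (T2Space (Subtype _))

theorem map_add (Λ : StateSpace X) (f g : C(X, ℝ)) : Λ (f + g) = Λ f + Λ g := Λ.2.1 f g

theorem map_smul (Λ : StateSpace X) (c : ℝ) (f : C(X, ℝ)) : Λ (c • f) = c * Λ f := Λ.2.2.1 c f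

theorem abs_apply_le (Λ : StateSpace X) (f : C(X, ℝ)) : |Λ f| ≤ ‖f‖ := Λ.2.2.2.1 f

theorem map_one (Λ : StateSpace X) : Λ 1 = 1 := Λ.2.2.2.2

theorem map_sub (Λ : StateSpace X) (f g : C(X, ℝ)) : Λ (f - g) = Λ f - Λ g := by
  have := Λ.map_add (f - g) g
  rw [sub_add_cancel] at this
  linarith

theorem continuous_eval (f : C(X, ℝ)) : Continuous fun Λ : StateSpace X ↦ Λ f :=
  (continuous_apply f).comp continuous_subtype_val

theorem continuous_of_eval {Z : Type*} [TopologicalSpace Z] {F : Z → StateSpace X}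
    (h : ∀ f, Continuous fun z ↦ F z f) : Continuous F :=
  Continuous.subtype_mk (continuous_pi h) _

theorem continuous_eval_pair : Continuous fun p : StateSpace X × C(X, ℝ) ↦ p.1 p.2 := by
  rw [continuous_iff_continuousAt]
  rintro ⟨Λ, f⟩
  rw [ContinuousAt, Metric.tendsto_nhds]
  intro ε hε
  have h1 : ∀ᶠ p : StateSpace X × C(X, ℝ) in 𝓝 (Λ, f), dist (p.1 f) (Λ f) < ε / 2 :=
    (((continuous_eval f).comp continuous_fst).tendsto (Λ, f)).eventually
      (Metric.ball_mem_nhds _ (half_pos hε))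
  have h2 : ∀ᶠ p : StateSpace X × C(X, ℝ) in 𝓝 (Λ, f), dist p.2 f < ε / 2 :=
    (continuous_snd.tendsto (Λ, f)).eventually (Metric.ball_mem_nhds _ (half_pos hε))
  filter_upwards [h1, h2] with p hp1 hp2
  have h3 := p.1.abs_apply_le (p.2 - f)
  rw [map_sub, ← dist_eq_norm, ← Real.dist_eq] at h3
  linarith [dist_triangle (p.1 p.2) (p.1 f) (Λ f)]

instance : CompactSpace (StateSpace X) := by
  refine isCompact_iff_compactSpace.1 (?_ : IsCompact
    ({Λ : C(X, ℝ) → ℝ | ∀ f g, Λ (f + g) = Λ f + Λ g} ∩ ({Λ | ∀ (c : ℝ) f, Λ (c • f) = c * Λ f} ∩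
      ({Λ | ∀ f, |Λ f| ≤ ‖f‖} ∩ {Λ | Λ 1 = 1}))))
  refine IsCompact.of_isClosed_subset
    (isCompact_univ_pi fun f : C(X, ℝ) ↦ isCompact_Icc (a := -‖f‖) (b := ‖f‖)) ?_
    fun Λ hΛ f _ ↦ abs_le.1 (hΛ.2.2.1 f)
  have hc : ∀ f, Continuous fun Λ : C(X, ℝ) → ℝ ↦ Λ f := fun f ↦ continuous_apply f
  refine IsClosed.inter ?_ (IsClosed.inter ?_ (IsClosed.inter ?_ ?_))
  · simp only [ofPred_forall]
    exact isClosed_iInter fun f ↦ isClosed_iInter fun g ↦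
      isClosed_eq (hc _) ((hc _).add (hc _))
  · simp only [ofPred_forall]
    exact isClosed_iInter fun c ↦ isClosed_iInter fun g ↦
      isClosed_eq (hc _) ((hc _).const_mul c)
  · simp only [ofPred_forall]
    exact isClosed_iInter fun f ↦ isClosed_le (hc _).abs continuous_const
  · exact isClosed_eq (hc _) continuous_const

instance [TopologicalSpace.MetrizableSpace X] :
    TopologicalSpace.MetrizableSpace (StateSpace X) := by
  let F : StateSpace X → ℕ → ℝ := fun Λ n ↦ Λ (TopologicalSpace.denseSeq C(X, ℝ) n)
  have hF : Continuous F := continuous_pi fun n ↦ continuous_eval _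
  refine (hF.isClosedEmbedding fun Λ M h ↦ ?_).isEmbedding.metrizableSpace
  have hc : ∀ Λ : StateSpace X, Continuous Λ := fun Λ ↦
    continuous_eval_pair.comp (by fun_prop : Continuous fun f ↦ (Λ, f))
  exact DFunLike.coe_injective ((hc Λ).ext_on (TopologicalSpace.denseRange_denseSeq _) (hc M)
    (by rintro _ ⟨n, rfl⟩; exact congrFun h n))

/-- Evaluation at a point. -/
def dirac (x : X) : StateSpace X :=
  ⟨fun f ↦ f x, fun _ _ ↦ rfl, fun _ _ ↦ rfl, fun f ↦ f.norm_coe_le_norm x, rfl⟩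

@[simp] theorem dirac_apply (x : X) (f : C(X, ℝ)) : dirac x f = f x := rfl

theorem continuous_dirac : Continuous (dirac : X → StateSpace X) :=
  continuous_of_eval fun f ↦ f.continuous

/-- The push-forward of a state under a continuous map. -/
def map (φ : C(X, Y)) (Λ : StateSpace X) : StateSpace Y :=
  ⟨fun f ↦ Λ (f.comp φ), fun f g ↦ Λ.map_add (f.comp φ) (g.comp φ),
    fun c f ↦ Λ.map_smul c (f.comp φ),
    fun f ↦ (Λ.abs_apply_le _).trans
      ((ContinuousMap.norm_le _ (norm_nonneg f)).2 fun x ↦ f.norm_coe_le_norm (φ x)),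
    Λ.map_one⟩

@[simp] theorem map_apply (φ : C(X, Y)) (Λ : StateSpace X) (f : C(Y, ℝ)) :
    map φ Λ f = Λ (f.comp φ) := rfl

theorem map_dirac (φ : C(X, Y)) (x : X) : map φ (dirac x) = dirac (φ x) := rfl

theorem continuous_map (φ : C(X, Y)) : Continuous (map φ) :=
  continuous_of_eval fun f ↦ continuous_eval (f.comp φ)

/-- The barycenter of a state on the state space. -/
def bary (Θ : StateSpace (StateSpace X)) : StateSpace X :=
  ⟨fun f ↦ Θ ⟨fun Λ ↦ Λ f, continuous_eval f⟩,
    fun f g ↦ by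
      rw [← Θ.map_add]
      exact congrArg Θ (ContinuousMap.ext fun Λ ↦ Λ.map_add f g),
    fun c f ↦ by
      rw [← Θ.map_smul]
      exact congrArg Θ (ContinuousMap.ext fun Λ ↦ Λ.map_smul c f),
    fun f ↦ (Θ.abs_apply_le _).trans
      ((ContinuousMap.norm_le _ (norm_nonneg f)).2 fun Λ ↦ Λ.abs_apply_le f),
    by
      rw [← Θ.map_one]
      exact congrArg Θ (ContinuousMap.ext fun Λ ↦ Λ.map_one)⟩

theorem bary_dirac (Λ : StateSpace X) : bary (dirac Λ) = Λ := rfl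

theorem continuous_bary : Continuous (bary : StateSpace (StateSpace X) → StateSpace X) :=
  continuous_of_eval fun _ ↦ continuous_eval _

end StateSpace

end States

section Kantorovich

open StateSpace

variable {X : Type*} [TopologicalSpace X] {d : X → X → ℝ}

/-- The `d`-nonexpansive functions that vanish at `x₀`. -/
def lipBall (d : X → X → ℝ) (x₀ : X) : Set C(X, ℝ) :=
  {f | f x₀ = 0 ∧ ∀ x y, |f x - f y| ≤ d x y}

theorem isCompact_lipBall (hd : IsCompatibleMetric d) (x₀ : X) : IsCompact (lipBall d x₀) := by
  refine ArzelaAscoli.isCompact_of_equicontinuous _ ?_ ?_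
  · have : ContinuousMap.toFun '' lipBall d x₀ =
        {f : X → ℝ | f x₀ = 0} ∩ {f | ∀ x y, |f x - f y| ≤ d x y} := by
      ext f
      constructor
      · rintro ⟨f, hf, rfl⟩
        exact hf
      · rintro ⟨h1, h2⟩
        exact ⟨⟨f, hd.continuous_of_abs_sub_le (C := 1) fun x y ↦ by
          rw [one_mul]; exact h2 x y⟩, ⟨h1, h2⟩, rfl⟩
    rw [this]
    refine IsCompact.of_isClosed_subset (isCompact_univ_pi fun x ↦
      isCompact_Icc (a := -d x x₀) (b := d x x₀)) ?_ fun f hf x _ ↦ ?_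
    · have hc : ∀ x, Continuous fun f : X → ℝ ↦ f x := fun x ↦ continuous_apply x
      refine IsClosed.inter (isClosed_eq (hc _) continuous_const) ?_
      simp only [ofPred_forall]
      exact isClosed_iInter fun x ↦ isClosed_iInter fun y ↦
        isClosed_le ((hc x).sub (hc y)).abs continuous_const
    · have h1 : f x₀ = 0 := hf.1
      have h2 := hf.2 x x₀
      rw [h1, sub_zero] at h2
      exact abs_le.1 h2
  · intro x
    rw [Metric.equicontinuousAt_iff_right]
    intro ε hε
    filter_upwards [hd.ball_mem_nhds x hε] with y (hy : d x y < ε) f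
    exact (f.2.2 x y).trans_lt hy

theorem zero_mem_lipBall (hd : IsCompatibleMetric d) (x₀ : X) : (0 : C(X, ℝ)) ∈ lipBall d x₀ :=
  ⟨rfl, fun x y ↦ by simpa using hd.nonneg x y⟩

variable [CompactSpace X]

/-- The Kantorovich distance of two states. -/
noncomputable def kantorovich (d : X → X → ℝ) (x₀ : X) (Λ M : StateSpace X) : ℝ :=
  sSup ((fun f ↦ |Λ f - M f|) '' lipBall d x₀)

theorem continuous_kantorovich (hd : IsCompatibleMetric d) (x₀ : X) :
    Continuous fun p : StateSpace X × StateSpace X ↦ kantorovich d x₀ p.1 p.2 := by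
  refine (isCompact_lipBall hd x₀).continuous_sSup
    (f := fun (p : StateSpace X × StateSpace X) f ↦ |p.1 f - p.2 f|) ?_
  have h1 : Continuous fun t : (StateSpace X × StateSpace X) × C(X, ℝ) ↦ t.1.1 t.2 :=
    continuous_eval_pair.comp (by fun_prop :
      Continuous fun t : (StateSpace X × StateSpace X) × C(X, ℝ) ↦ (t.1.1, t.2))
  have h2 : Continuous fun t : (StateSpace X × StateSpace X) × C(X, ℝ) ↦ t.1.2 t.2 :=
    continuous_eval_pair.comp (by fun_prop :
      Continuous fun t : (StateSpace X × StateSpace X) × C(X, ℝ) ↦ (t.1.2, t.2))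
  exact (h1.sub h2).abs

theorem kantorovich_le (hd : IsCompatibleMetric d) {x₀ : X} {Λ M : StateSpace X} {C : ℝ}
    (h : ∀ f ∈ lipBall d x₀, |Λ f - M f| ≤ C) : kantorovich d x₀ Λ M ≤ C :=
  csSup_le ⟨_, mem_image_of_mem _ (zero_mem_lipBall hd x₀)⟩ (by rintro _ ⟨f, hf, rfl⟩; exact h f hf)

theorem le_kantorovich (hd : IsCompatibleMetric d) {x₀ : X} (Λ M : StateSpace X) {f : C(X, ℝ)}
    (hf : f ∈ lipBall d x₀) : |Λ f - M f| ≤ kantorovich d x₀ Λ M := by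
  have hc : ∀ Λ : StateSpace X, Continuous Λ := fun Λ ↦
    continuous_eval_pair.comp (by fun_prop : Continuous fun f ↦ (Λ, f))
  exact le_csSup ((isCompact_lipBall hd x₀).image ((hc Λ).sub (hc M)).abs).bddAbove
    (mem_image_of_mem _ hf)

theorem kantorovich_nonneg (hd : IsCompatibleMetric d) (x₀ : X) (Λ M : StateSpace X) :
    0 ≤ kantorovich d x₀ Λ M :=
  (abs_nonneg _).trans (le_kantorovich hd Λ M (zero_mem_lipBall hd x₀))

theorem kantorovich_comm (x₀ : X) (Λ M : StateSpace X) :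
    kantorovich d x₀ Λ M = kantorovich d x₀ M Λ := by
  simp only [kantorovich, abs_sub_comm]

theorem kantorovich_self (hd : IsCompatibleMetric d) (x₀ : X) (Λ : StateSpace X) :
    kantorovich d x₀ Λ Λ = 0 :=
  le_antisymm (kantorovich_le hd fun f _ ↦ by simp) (kantorovich_nonneg hd x₀ Λ Λ)

theorem kantorovich_triangle (hd : IsCompatibleMetric d) (x₀ : X) (Λ M N : StateSpace X) :
    kantorovich d x₀ Λ N ≤ kantorovich d x₀ Λ M + kantorovich d x₀ M N :=
  kantorovich_le hd fun f hf ↦ (abs_sub_le _ (M f) _).trans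
    (add_le_add (le_kantorovich hd Λ M hf) (le_kantorovich hd M N hf))

theorem kantorovich_dirac (hd : IsCompatibleMetric d) (x₀ x y : X) :
    kantorovich d x₀ (dirac x) (dirac y) = d x y := by
  refine le_antisymm (kantorovich_le hd fun f hf ↦ hf.2 x y) ?_
  have hl : ∀ a b, |(d a y - d x₀ y) - (d b y - d x₀ y)| ≤ d a b := fun a b ↦ by
    have h1 := hd.2.2.1 a b y
    have h2 := hd.2.2.1 b a y
    rw [hd.1 b a] at h2
    rw [abs_le]
    constructor <;> linarith
  have hf : (⟨fun a ↦ d a y - d x₀ y, hd.continuous_of_abs_sub_le (C := 1) fun a b ↦ by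
      rw [one_mul]; exact hl a b⟩ : C(X, ℝ)) ∈ lipBall d x₀ := ⟨sub_self _, hl⟩
  refine le_trans ?_ (le_kantorovich hd (dirac x) (dirac y) hf)
  simp [hd.self_eq_zero, le_abs_self]

theorem kantorovich_le_of_bound (hd : IsCompatibleMetric d) {C : ℝ} (hC : ∀ x y, d x y ≤ C)
    (x₀ : X) (Λ M : StateSpace X) : kantorovich d x₀ Λ M ≤ C := by
  refine kantorovich_le hd fun f hf ↦ ?_
  have hne : (univ : Set X).Nonempty := ⟨x₀, mem_univ _⟩
  obtain ⟨a, -, ha⟩ := isCompact_univ.exists_isMinOn hne f.continuous.continuousOn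
  obtain ⟨b, -, hb⟩ := isCompact_univ.exists_isMaxOn hne f.continuous.continuousOn
  have hab : f b - f a ≤ C := (le_abs_self _).trans ((hf.2 b a).trans (hC b a))
  set g : C(X, ℝ) := f - ((f a + f b) / 2) • (1 : C(X, ℝ)) with hg
  have hgn : ‖g‖ ≤ C / 2 := by
    refine (ContinuousMap.norm_le _ ?_).2 fun x ↦ ?_
    · have := hC a a
      rw [hd.self_eq_zero] at this
      linarith
    · have h1 : f a ≤ f x := isMinOn_iff.1 ha x (mem_univ x)
      have h2 : f x ≤ f b := isMaxOn_iff.1 hb x (mem_univ x)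
      rw [Real.norm_eq_abs, abs_le]
      simp only [hg, ContinuousMap.sub_apply, ContinuousMap.smul_apply, ContinuousMap.one_apply,
        smul_eq_mul, mul_one]
      constructor <;> linarith
  have h1 : Λ f - M f = Λ g - M g := by
    simp only [hg, StateSpace.map_sub, StateSpace.map_smul, StateSpace.map_one]
    ring
  rw [h1]
  have := (Λ.abs_apply_le g).trans hgn
  have := (M.abs_apply_le g).trans hgn
  linarith [abs_sub (Λ g) (M g)]

theorem abs_mul_sub_mul_le {a b a' b' A B s t : ℝ} (hA : |a| ≤ A) (hB : |b'| ≤ B)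
    (h1 : |a - a'| ≤ s) (h2 : |b - b'| ≤ t) : |a * b - a' * b'| ≤ A * t + B * s := by
  have : a * b - a' * b' = a * (b - b') + b' * (a - a') := by ring
  rw [this]
  refine (abs_add_le _ _).trans ?_
  rw [abs_mul, abs_mul]
  have := abs_nonneg a
  have := abs_nonneg b'
  gcongr
  · linarith
  · linarith

/-- The algebra of Lipschitz functions with respect to a compatible metric. -/
def lipschitzSubalgebra (_hd : IsCompatibleMetric d) : Subalgebra ℝ C(X, ℝ) where
  carrier := {f | ∃ C, 0 ≤ C ∧ ∀ x y, |f x - f y| ≤ C * d x y}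
  mul_mem' := by
    rintro f g ⟨C, hC, hf⟩ ⟨C', hC', hg⟩
    refine ⟨‖f‖ * C' + ‖g‖ * C, by positivity, fun x y ↦ ?_⟩
    refine (abs_mul_sub_mul_le (f.norm_coe_le_norm x) (g.norm_coe_le_norm y)
      (hf x y) (hg x y)).trans (le_of_eq (by ring))
  add_mem' := by
    rintro f g ⟨C, hC, hf⟩ ⟨C', hC', hg⟩
    refine ⟨C + C', by positivity, fun x y ↦ ?_⟩
    have : (f + g) x - (f + g) y = (f x - f y) + (g x - g y) := by
      simp only [ContinuousMap.add_apply]; ring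
    rw [this, add_mul]
    exact (abs_add_le _ _).trans (add_le_add (hf x y) (hg x y))
  algebraMap_mem' r := ⟨0, le_rfl, fun x y ↦ by simp⟩

theorem separatesPoints_lipschitzSubalgebra (hd : IsCompatibleMetric d) :
    (lipschitzSubalgebra hd).SeparatesPoints := by
  intro x y hxy
  have hl : ∀ a b, |d a y - d b y| ≤ 1 * d a b := fun a b ↦ by
    have h1 := hd.2.2.1 a b y
    have h2 := hd.2.2.1 b a y
    rw [hd.1 b a] at h2
    rw [abs_le]
    constructor <;> linarith
  refine ⟨_, ⟨⟨fun a ↦ d a y, hd.continuous_of_abs_sub_le hl⟩, ⟨1, zero_le_one, hl⟩, rfl⟩, ?_⟩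
  change d x y ≠ d y y
  rw [hd.self_eq_zero]
  exact fun h ↦ hxy ((hd.2.1 x y).1 h)

theorem eq_of_kantorovich_eq_zero (hd : IsCompatibleMetric d) {x₀ : X} {Λ M : StateSpace X}
    (h : kantorovich d x₀ Λ M = 0) : Λ = M := by
  have hc : ∀ Λ : StateSpace X, Continuous Λ := fun Λ ↦
    continuous_eval_pair.comp (by fun_prop : Continuous fun f ↦ (Λ, f))
  have hdense : Dense (lipschitzSubalgebra hd : Set C(X, ℝ)) := by
    have := ContinuousMap.subalgebra_topologicalClosure_eq_top_of_separatesPoints _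
      (separatesPoints_lipschitzSubalgebra hd)
    rw [dense_iff_closure_eq, ← Subalgebra.topologicalClosure_coe, this, Algebra.coe_top]
  refine DFunLike.coe_injective ((hc Λ).ext_on hdense (hc M) ?_)
  rintro f ⟨C, hC, hf⟩
  set g : C(X, ℝ) := f - f x₀ • (1 : C(X, ℝ)) with hg
  have hgC : (C + 1)⁻¹ • g ∈ lipBall d x₀ := by
    refine ⟨by simp [hg], fun x y ↦ ?_⟩
    have : ((C + 1)⁻¹ • g) x - ((C + 1)⁻¹ • g) y = (C + 1)⁻¹ * (f x - f y) := by
      simp only [hg, ContinuousMap.smul_apply, ContinuousMap.sub_apply, ContinuousMap.one_apply,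
        smul_eq_mul]
      ring
    have hp : 0 < C + 1 := by positivity
    rw [this, abs_mul, abs_of_pos (inv_pos.2 hp), inv_mul_le_iff₀ hp]
    have := hd.nonneg x y
    linarith [hf x y]
  have h1 := le_kantorovich hd Λ M hgC
  rw [h, abs_nonpos_iff, StateSpace.map_smul, StateSpace.map_smul, ← mul_sub,
    mul_eq_zero_iff_left (by positivity), hg, StateSpace.map_sub, StateSpace.map_sub,
    StateSpace.map_smul, StateSpace.map_smul, StateSpace.map_one, StateSpace.map_one] at h1
  linarith

end Kantorovich

section Dugundji

variable {X : Type*} [MetricSpace X]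

/-- The unnormalized weights of Dugundji's extension formula for the points `a i`
of a set `A`. -/
noncomputable def dugundjiWeight (A : Set X) (a : ℕ → X) (i : ℕ) (x : X) : ℝ :=
  (1 / 2) ^ i * max 0 (2 * Metric.infDist x A - dist x (a i))

variable {A : Set X} {a : ℕ → X}

theorem dugundjiWeight_nonneg (i : ℕ) (x : X) : 0 ≤ dugundjiWeight A a i x :=
  mul_nonneg (by positivity) (le_max_left _ _)

theorem dist_lt_of_dugundjiWeight_ne_zero {i : ℕ} {x : X} (h : dugundjiWeight A a i x ≠ 0) :
    dist x (a i) < 2 * Metric.infDist x A := by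
  by_contra! hle
  exact h (by rw [dugundjiWeight, max_eq_left (by linarith), mul_zero])

theorem dugundjiWeight_le (ha : ∀ i, a i ∈ A) (i : ℕ) (x : X) :
    dugundjiWeight A a i x ≤ (1 / 2) ^ i * Metric.infDist x A := by
  have := Metric.infDist_le_dist_of_mem (x := x) (ha i)
  exact mul_le_mul_of_nonneg_left (max_le Metric.infDist_nonneg (by linarith)) (by positivity)

theorem continuous_dugundjiWeight (i : ℕ) : Continuous (dugundjiWeight A a i) := by
  have := Metric.continuous_infDist_pt A
  unfold dugundjiWeight
  fun_prop

theorem summable_dugundjiWeight_mul (ha : ∀ i, a i ∈ A) (x : X) {c : ℕ → ℝ} {C : ℝ}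
    (hc : ∀ i, |c i| ≤ C) : Summable fun i ↦ dugundjiWeight A a i x * c i := by
  refine Summable.of_norm_bounded
    (summable_geometric_two.mul_right (Metric.infDist x A * C)) fun i ↦ ?_
  rw [Real.norm_eq_abs, abs_mul, abs_of_nonneg (dugundjiWeight_nonneg i x), ← mul_assoc]
  have h := dugundjiWeight_le ha i x
  exact mul_le_mul h (hc i) (abs_nonneg _) ((dugundjiWeight_nonneg i x).trans h)

theorem continuous_tsum_dugundjiWeight_mul [CompactSpace X] (ha : ∀ i, a i ∈ A) {c : ℕ → ℝ} {C : ℝ}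
    (hc : ∀ i, |c i| ≤ C) : Continuous fun x ↦ ∑' i, dugundjiWeight A a i x * c i := by
  obtain ⟨B, hB⟩ := (isCompact_range (Metric.continuous_infDist_pt A)).bddAbove
  have hB' : ∀ x, Metric.infDist x A ≤ B := fun x ↦ hB (mem_range_self x)
  refine continuous_tsum (fun i ↦ (continuous_dugundjiWeight i).mul continuous_const)
    (summable_geometric_two.mul_right (B * C)) fun i x ↦ ?_
  rw [Real.norm_eq_abs, abs_mul, abs_of_nonneg (dugundjiWeight_nonneg i x), ← mul_assoc]
  have h := (dugundjiWeight_le ha i x).trans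
    (mul_le_mul_of_nonneg_left (hB' x) (by positivity))
  exact mul_le_mul h (hc i) (abs_nonneg _) ((dugundjiWeight_nonneg i x).trans h)

theorem abs_tsum_dugundjiWeight_mul_sub_le (ha : ∀ i, a i ∈ A) (x : X) {c : ℕ → ℝ} {C : ℝ}
    (hc : ∀ i, |c i| ≤ C) {t ε : ℝ}
    (h : ∀ i, dist x (a i) < 2 * Metric.infDist x A → |c i - t| ≤ ε) :
    |∑' i, dugundjiWeight A a i x * c i - t * ∑' i, dugundjiWeight A a i x * 1| ≤
      ε * ∑' i, dugundjiWeight A a i x * 1 := by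
  have hs1 := summable_dugundjiWeight_mul ha x (c := fun _ ↦ 1) (C := 1) (by simp)
  have hsc := summable_dugundjiWeight_mul ha x hc
  rw [← tsum_mul_left, ← tsum_mul_left, ← hsc.tsum_sub (hs1.mul_left t)]
  rw [← Real.norm_eq_abs]
  refine tsum_of_norm_bounded (hs1.mul_left ε).hasSum fun i ↦ ?_
  have : dugundjiWeight A a i x * c i - t * (dugundjiWeight A a i x * 1) =
    dugundjiWeight A a i x * (c i - t) := by ring
  rw [this, Real.norm_eq_abs, abs_mul, abs_of_nonneg (dugundjiWeight_nonneg i x), mul_one,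
    mul_comm ε]
  by_cases hw : dugundjiWeight A a i x = 0
  · simp [hw]
  · exact mul_le_mul_of_nonneg_left (h i (dist_lt_of_dugundjiWeight_ne_zero hw))
      (dugundjiWeight_nonneg i x)

theorem tsum_dugundjiWeight_pos (ha : ∀ i, a i ∈ A) {x : X} {i : ℕ}
    (hi : dist x (a i) < 2 * Metric.infDist x A) : 0 < ∑' i, dugundjiWeight A a i x * 1 := by
  refine (summable_dugundjiWeight_mul ha x (c := fun _ ↦ 1) (C := 1) (by simp)).tsum_pos
    (fun i ↦ by simpa using dugundjiWeight_nonneg i x) i ?_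
  rw [mul_one, dugundjiWeight]
  exact mul_pos (by positivity) (lt_max_of_lt_right (by linarith))

end Dugundji

open StateSpace in
/-- Dugundji's extension theorem: the embedding of a closed subspace in its state space extends
to the whole space. -/
theorem exists_continuous_extension_dirac {X P : Type*} [TopologicalSpace X] [CompactSpace X]
    [TopologicalSpace.MetrizableSpace X] [TopologicalSpace P] [CompactSpace P] [Nonempty P]
    {j : P → X} (hj : IsClosedEmbedding j) :
    ∃ r : X → StateSpace P, Continuous r ∧ ∀ p, r (j p) = dirac p := by
  let _ := TopologicalSpace.metrizableSpaceMetric X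
  have : TopologicalSpace.MetrizableSpace P := hj.isEmbedding.metrizableSpace
  set q : ℕ → P := TopologicalSpace.denseSeq P with hq
  set A := range j with hA
  have hne : A.Nonempty := range_nonempty j
  have ha : ∀ i, (j ∘ q) i ∈ A := fun i ↦ mem_range_self _
  set N : C(P, ℝ) → X → ℝ := fun f x ↦ ∑' i, dugundjiWeight A (j ∘ q) i x * f (q i) with hN
  have hb : ∀ (f : C(P, ℝ)) i, |f (q i)| ≤ ‖f‖ := fun f i ↦ f.norm_coe_le_norm _
  have hNc : ∀ f, Continuous (N f) := fun f ↦ continuous_tsum_dugundjiWeight_mul ha (hb f)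
  have hpos : ∀ x ∉ A, 0 < N 1 x := by
    intro x hx
    have hu : 0 < Metric.infDist x A := (hj.isClosed_range.notMem_iff_infDist_pos hne).1 hx
    obtain ⟨_, ⟨p, rfl⟩, hp⟩ := (Metric.infDist_lt_iff hne).1 (by linarith :
      Metric.infDist x A < 2 * Metric.infDist x A)
    have ho : IsOpen {p | dist x (j p) < 2 * Metric.infDist x A} :=
      isOpen_lt (continuous_const.dist hj.continuous) continuous_const
    obtain ⟨i, hi⟩ := (TopologicalSpace.denseRange_denseSeq P).exists_mem_open ho ⟨p, hp⟩
    exact tsum_dugundjiWeight_pos ha hi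
  have hest : ∀ (f : C(P, ℝ)) x, x ∉ A → ∀ t ε : ℝ,
      (∀ p, dist x (j p) < 2 * Metric.infDist x A → |f p - t| ≤ ε) →
      |N f x / N 1 x - t| ≤ ε := by
    intro f x hx t ε h
    have h1 := abs_tsum_dugundjiWeight_mul_sub_le ha x (hb f) (t := t) (ε := ε) fun i hi ↦ h _ hi
    have h2 := hpos x hx
    have h3 : N f x / N 1 x - t = (N f x - t * N 1 x) / N 1 x := by field_simp
    rw [h3, abs_div, abs_of_pos h2, div_le_iff₀ h2]
    exact h1
  have hst : ∀ x ∉ A, ∃ Λ : StateSpace P, ∀ f, Λ f = N f x / N 1 x := by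
    intro x hx
    refine ⟨⟨fun f ↦ N f x / N 1 x, fun f g ↦ ?_, fun c f ↦ ?_, fun f ↦ ?_,
      div_self (hpos x hx).ne'⟩, fun f ↦ rfl⟩
    · rw [← add_div]
      refine congrArg (· / N 1 x) ?_
      simp only [hN, ContinuousMap.add_apply, mul_add]
      exact (summable_dugundjiWeight_mul ha x (hb f)).tsum_add
        (summable_dugundjiWeight_mul ha x (hb g))
    · rw [← mul_div_assoc]
      refine congrArg (· / N 1 x) ?_
      simp only [hN, ContinuousMap.smul_apply, smul_eq_mul, ← tsum_mul_left]
      exact tsum_congr fun i ↦ by ring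
    · simpa using hest f x hx 0 ‖f‖ fun p _ ↦ by simpa using f.norm_coe_le_norm p
  have hex : ∀ x, ∃ Λ : StateSpace P,
      (∀ p, j p = x → Λ = dirac p) ∧ (x ∉ A → ∀ f, Λ f = N f x / N 1 x) := by
    intro x
    by_cases hx : x ∈ A
    · obtain ⟨p, rfl⟩ := hx
      exact ⟨dirac p, fun p' h ↦ by rw [hj.injective h], fun h ↦ absurd (mem_range_self p) h⟩
    · obtain ⟨Λ, hΛ⟩ := hst x hx
      exact ⟨Λ, fun p h ↦ absurd ⟨p, h⟩ hx, fun _ ↦ hΛ⟩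
  choose r hr1 hr2 using hex
  refine ⟨r, continuous_of_eval fun f ↦ ?_, fun p ↦ hr1 _ p rfl⟩
  rw [continuous_iff_continuousAt]
  intro x
  by_cases hx : x ∈ A
  · obtain ⟨p, rfl⟩ := hx
    rw [ContinuousAt, Metric.tendsto_nhds]
    intro ε hε
    have h1 : ∀ᶠ p' in 𝓝 p, |f p' - f p| < ε / 2 :=
      f.continuous.continuousAt.eventually (Metric.ball_mem_nhds _ (half_pos hε))
    rw [hj.isEmbedding.nhds_eq_comap, eventually_comap, Metric.eventually_nhds_iff] at h1
    obtain ⟨δ, hδ, h1⟩ := h1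
    rw [Metric.eventually_nhds_iff]
    refine ⟨δ / 3, by positivity, fun y hy ↦ ?_⟩
    rw [hr1 _ p rfl, dirac_apply, Real.dist_eq]
    by_cases hyA : y ∈ A
    · obtain ⟨p', rfl⟩ := hyA
      rw [hr1 _ p' rfl, dirac_apply]
      linarith [h1 (by linarith : dist (j p') (j p) < δ) p' rfl]
    · rw [hr2 y hyA]
      refine (hest f y hyA _ (ε / 2) fun p' hp' ↦ ?_).trans_lt (half_lt_self hε)
      have h2 := Metric.infDist_le_dist_of_mem (x := y) (mem_range_self (f := j) p)
      have h3 := dist_triangle_left (j p') (j p) y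
      exact (h1 (by linarith : dist (j p') (j p) < δ) p' rfl).le
  · have h1 : ContinuousAt (fun y ↦ N f y / N 1 y) x :=
      (hNc f).continuousAt.div (hNc 1).continuousAt (hpos x hx).ne'
    refine h1.congr ?_
    filter_upwards [hj.isClosed_range.isOpen_compl.mem_nhds hx] with y hy
    exact (hr2 y hy f).symm

section ZSets

theorem abs_sub_le_two_pow_mul_hDist (x y : HCube) (k : ℕ) :
    |(x k : ℝ) - y k| ≤ 2 ^ k * hDist x y := by
  have hle : ∀ n, |(x n : ℝ) - y n| ≤ 1 := fun n ↦ abs_sub_le_of_le_of_le (x n).2.1 (x n).2.2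
    (y n).2.1 (y n).2.2 |>.trans (by norm_num)
  have hnn : ∀ n, 0 ≤ (2 : ℝ)⁻¹ ^ n * |(x n : ℝ) - y n| := fun n ↦ by positivity
  have hs : Summable fun n ↦ (2 : ℝ)⁻¹ ^ n * |(x n : ℝ) - y n| :=
    Summable.of_nonneg_of_le hnn (fun n ↦ mul_le_of_le_one_right (by positivity) (hle n))
      (summable_geometric_of_lt_one (by norm_num) (by norm_num))
  have h := hs.le_tsum k fun n _ ↦ hnn n
  rw [inv_pow, inv_mul_le_iff₀ (by positivity)] at h
  simpa [hDist] using h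

variable {P : Type*} [TopologicalSpace P]

theorem ContinuousMap.tendsto_hCube [CompactSpace P] {F : ℕ → C(P, HCube)} {f : C(P, HCube)}
    (h : ∀ k, ∀ ε > (0 : ℝ), ∀ᶠ n in atTop, ∀ p, |(F n p k : ℝ) - f p k| < ε) :
    Tendsto F atTop (𝓝 f) := by
  rw [ContinuousMap.tendsto_iff_tendstoUniformly, tendstoUniformly_iff_tendsto, Pi.uniformity,
    tendsto_iInf]
  intro k
  rw [tendsto_comap_iff]
  refine (tendstoUniformly_iff_tendsto (F := fun n p ↦ F n p k) (f := fun p ↦ f p k)).1 ?_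
  rw [Metric.tendstoUniformly_iff]
  intro ε hε
  filter_upwards [h k ε hε] with n hn p
  rw [dist_comm, Subtype.dist_eq, Real.dist_eq]
  exact hn p

/-- Coordinatewise linear interpolation between two maps into the Hilbert cube. -/
theorem exists_interpolation (f g : C(P, HCube)) {w : C(P, ℝ)} (hw : ∀ p, w p ∈ Icc (0 : ℝ) 1) :
    ∃ F : C(P, HCube), ∀ p k, (F p k : ℝ) = f p k + w p * (g p k - f p k) := by
  refine ⟨⟨fun p k ↦ ⟨f p k + w p * (g p k - f p k), ?_⟩, ?_⟩, fun p k ↦ rfl⟩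
  · exact (convex_Icc (0 : ℝ) 1).add_smul_sub_mem (f p k).2 (g p k).2 (hw p)
  · refine continuous_pi fun k ↦ Continuous.subtype_mk ?_ _
    fun_prop

/-- The maps to the Hilbert cube that extend the inclusion of `L`, which is embedded by `e`. -/
def extensionsOfInclusion {L : Set HCube} (e : L → P) : Set C(P, HCube) :=
  {f | ∀ l, f (e l) = l}

variable {L : Set HCube} {e : L → P}

theorem isClosed_extensionsOfInclusion : IsClosed (extensionsOfInclusion e) := by
  simp only [extensionsOfInclusion, ofPred_forall]
  exact isClosed_iInter fun l ↦ isClosed_eq (ContinuousEvalConst.continuous_eval_const _)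
    continuous_const

/-- A family of modifications of `f` that are supported away from `e(L)` and tend to `f`
coordinatewise yields a sequence in the space of extensions tending to `f`. -/
theorem exists_seq_tendsto_extensions [CompactSpace P] [NormalSpace P] (he : IsClosedEmbedding e)
    {f : C(P, HCube)} (hf : f ∈ extensionsOfInclusion e) {A : Set P} (hA : IsClosed A)
    (hdisj : Disjoint (range e) A) {g : ℕ → C(P, HCube)}
    (hg : ∀ k, ∀ ε > (0 : ℝ), ∀ᶠ n in atTop, ∀ p, |(g n p k : ℝ) - f p k| < ε) :
    ∃ F : ℕ → extensionsOfInclusion e, Tendsto F atTop (𝓝 ⟨f, hf⟩) ∧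
      ∀ n, ∀ p ∈ A, (F n).1 p = g n p := by
  obtain ⟨w, hw0, hw1, hw⟩ := exists_continuous_zero_one_of_isClosed he.isClosed_range hA hdisj
  choose F hF using fun n ↦ exists_interpolation f (g n) hw
  refine ⟨fun n ↦ ⟨F n, fun l ↦ ?_⟩, ?_, fun n p hp ↦ ?_⟩
  · rw [← hf l]
    refine funext fun k ↦ Subtype.ext ?_
    simp [hF, hw0 (mem_range_self l)]
  · refine tendsto_subtype_rng.2 (ContinuousMap.tendsto_hCube fun k ε hε ↦ ?_)
    filter_upwards [hg k ε hε] with n hn p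
    rw [hF, add_sub_cancel_left, abs_mul, abs_of_nonneg (hw p).1]
    exact (mul_le_of_le_one_left (abs_nonneg _) (hw p).2).trans_lt (hn p)
  · refine funext fun k ↦ Subtype.ext ?_
    simp [hF, hw1 hp]

theorem dense_extensions_missing [CompactSpace P] [NormalSpace P] (hL : IsZSet L)
    (he : IsClosedEmbedding e) {A : Set P} (hA : IsClosed A) (hdisj : Disjoint (range e) A) :
    Dense {f : extensionsOfInclusion e | ∀ p ∈ A, f.1 p ∉ L} := by
  rintro ⟨f, hf⟩
  choose g hgc hgL hg using fun n : ℕ ↦ hL.2 (1 / (n + 1)) (by positivity) id continuous_id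
  obtain ⟨F, hF, hFA⟩ := exists_seq_tendsto_extensions he hf hA hdisj
    (g := fun n ↦ (⟨g n, hgc n⟩ : C(HCube, HCube)).comp f) fun k ε hε ↦ by
      obtain ⟨N, hN⟩ := exists_nat_one_div_lt (show 0 < ε / 2 ^ k by positivity)
      filter_upwards [eventually_ge_atTop N] with n hn p
      have h1 := abs_sub_le_two_pow_mul_hDist (f p) (g n (f p)) k
      have h2 : hDist (f p) (g n (f p)) < ε / 2 ^ k :=
        (hg n (f p)).trans_le ((Nat.one_div_le_one_div hn).trans hN.le)
      rw [lt_div_iff₀ (by positivity)] at h2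
      rw [abs_sub_comm]
      exact h1.trans_lt (by linarith)
  refine mem_closure_of_tendsto hF (Eventually.of_forall fun n p hp hmem ↦ ?_)
  rw [hFA n p hp] at hmem
  exact (hgL n).subset ⟨mem_range_self (f p), hmem⟩

theorem dense_extensions_injOn [CompactSpace P] [TopologicalSpace.MetrizableSpace P] [Nonempty P]
    (he : IsClosedEmbedding e) {A : Set P} (hA : IsClosed A) (hdisj : Disjoint (range e) A) :
    Dense {f : extensionsOfInclusion e | InjOn f.1 A} := by
  rintro ⟨f, hf⟩
  let _ := TopologicalSpace.metrizableSpaceMetric P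
  set a : ℕ → P := TopologicalSpace.denseSeq P
  let c : C(P, HCube) := ⟨fun p m ↦ ⟨min 1 (dist p (a m)),
    le_min zero_le_one dist_nonneg, min_le_left _ _⟩,
    continuous_pi fun m ↦ Continuous.subtype_mk (by fun_prop) _⟩
  have hc : Function.Injective c := by
    intro p p' h
    by_contra hne
    have hpos : 0 < min 1 (dist p p' / 2) := lt_min one_pos (half_pos (dist_pos.2 hne))
    obtain ⟨m, hm⟩ := (TopologicalSpace.denseRange_denseSeq P).exists_dist_lt p hpos
    have h1 : min 1 (dist p (a m)) = min 1 (dist p' (a m)) :=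
      congrArg Subtype.val (congrFun h m)
    obtain ⟨hm1, hm2⟩ := lt_min_iff.1 hm
    have h2 : dist p (a m) = dist p' (a m) := by
      rw [min_eq_right hm1.le] at h1
      rcases min_cases 1 (dist p' (a m)) with h' | h'
      · exact absurd (h1.trans h'.1) hm1.ne
      · exact h1.trans h'.1
    linarith [dist_triangle_right p p' (a m)]
  let g : ℕ → C(P, HCube) := fun n ↦ ⟨fun p k ↦ if k < n then f p k else c p (k - n),
    continuous_pi fun k ↦ by split_ifs <;> fun_prop⟩
  obtain ⟨F, hF, hFA⟩ := exists_seq_tendsto_extensions he hf hA hdisj (g := g) fun k ε hε ↦ by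
    filter_upwards [eventually_gt_atTop k] with n hn p
    simpa [g, hn] using hε
  refine mem_closure_of_tendsto hF (Eventually.of_forall fun n p hp p' hp' h ↦ hc ?_)
  rw [hFA n p hp, hFA n p' hp'] at h
  refine funext fun m ↦ ?_
  simpa [g] using congrFun h (n + m)

theorem isOpen_setOf_forall_apply_ne [LocallyCompactSpace P] {C : Set (P × P)}
    (hC : IsCompact C) : IsOpen {f : C(P, HCube) | ∀ c ∈ C, f c.1 ≠ f c.2} := by
  rw [isOpen_iff_eventually]
  intro f hf
  refine hC.eventually_forall_of_forall_eventually fun c hc ↦ ?_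
  have h1 : Continuous fun z : C(P, HCube) × (P × P) ↦ z.1 z.2.1 := by fun_prop
  have h2 : Continuous fun z : C(P, HCube) × (P × P) ↦ z.1 z.2.2 := by fun_prop
  exact (isOpen_ne_fun h1 h2).mem_nhds (hf c hc)

/-- An embedding of a `Z`-set `L` in a compact metrizable space `P` is, up to an embedding of
`P` in the Hilbert cube, the inclusion of `L`. -/
theorem IsZSet.exists_embedding [CompactSpace P] [TopologicalSpace.MetrizableSpace P]
    (hL : IsZSet L) (hne : L.Nonempty) (he : IsClosedEmbedding e) :
    ∃ j : P → HCube, IsClosedEmbedding j ∧ ∀ l, j (e l) = l := by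
  let _ := TopologicalSpace.metrizableSpaceMetric P
  have : Nonempty L := hne.to_subtype
  have : Nonempty P := ⟨e this.some⟩
  have hbaire : BaireSpace (extensionsOfInclusion e) := by
    let _ := TopologicalSpace.metrizableSpaceMetric HCube
    have : CompleteSpace (extensionsOfInclusion e) :=
      isClosed_extensionsOfInclusion.completeSpace_coe
    infer_instance
  have hne' : Nonempty (extensionsOfInclusion e) := by
    obtain ⟨f, hf⟩ := ContinuousMap.exists_extension' he
      (⟨Subtype.val, continuous_subtype_val⟩ : C(L, HCube))
    exact ⟨f, fun l ↦ congrFun hf l⟩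
  set A : ℕ → Set P := fun n ↦ {p | 1 / ((n : ℝ) + 1) ≤ Metric.infDist p (range e)}
  have hA : ∀ n, IsClosed (A n) := fun n ↦
    isClosed_le continuous_const (Metric.continuous_infDist_pt _)
  have hdisj : ∀ n, Disjoint (range e) (A n) := fun n ↦ by
    rw [Set.disjoint_left]
    intro p hp hpA
    change 1 / ((n : ℝ) + 1) ≤ _ at hpA
    rw [Metric.infDist_zero_of_mem hp] at hpA
    exact absurd hpA (not_le.2 (by positivity))
  have hmemA : ∀ p ∉ range e, ∀ᶠ n in atTop, p ∈ A n := fun p hp ↦ by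
    have hpos := (he.isClosed_range.notMem_iff_infDist_pos (range_nonempty e)).1 hp
    obtain ⟨N, hN⟩ := exists_nat_one_div_lt hpos
    filter_upwards [eventually_ge_atTop N] with n hn
    exact (Nat.one_div_le_one_div hn).trans hN.le
  set U : ℕ → Set (extensionsOfInclusion e) := fun n ↦ {f | ∀ p ∈ A n, f.1 p ∉ L}
  set C : ℕ → Set (P × P) := fun n ↦ A n ×ˢ A n ∩ {c | 1 / ((n : ℝ) + 1) ≤ dist c.1 c.2}
  set V : ℕ → Set (extensionsOfInclusion e) := fun n ↦ {f | ∀ c ∈ C n, f.1 c.1 ≠ f.1 c.2}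
  have hU : ∀ n, IsOpen (U n) := fun n ↦
    (ContinuousMap.isOpen_setOfPred_mapsTo (hA n).isCompact hL.1.isOpen_compl).preimage
      continuous_subtype_val
  have hV : ∀ n, IsOpen (V n) := fun n ↦
    (isOpen_setOf_forall_apply_ne (((hA n).prod (hA n)).inter
      (isClosed_le continuous_const continuous_dist)).isCompact).preimage continuous_subtype_val
  have hUd : ∀ n, Dense (U n) := fun n ↦ dense_extensions_missing hL he (hA n) (hdisj n)
  have hVd : ∀ n, Dense (V n) := fun n ↦
    (dense_extensions_injOn he (hA n) (hdisj n)).mono fun f hf c hc h ↦ by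
      have h1 : 1 / ((n : ℝ) + 1) ≤ dist c.1 c.2 := hc.2
      rw [hf hc.1.1 hc.1.2 h, dist_self] at h1
      exact absurd h1 (not_le.2 (by positivity))
  obtain ⟨f, hf⟩ := (dense_iInter_of_isOpen (fun n ↦ (hU n).inter (hV n))
    fun n ↦ (hUd n).inter_of_isOpen_left (hVd n) (hU n)).nonempty
  rw [mem_iInter] at hf
  have hfL : ∀ p ∉ range e, f.1 p ∉ L := fun p hp ↦ by
    obtain ⟨n, hn⟩ := (hmemA p hp).exists
    exact (hf n).1 p hn
  refine ⟨f.1, f.1.continuous.isClosedEmbedding fun p p' h ↦ ?_, f.2⟩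
  by_cases hp : p ∈ range e <;> by_cases hp' : p' ∈ range e
  · obtain ⟨l, rfl⟩ := hp
    obtain ⟨l', rfl⟩ := hp'
    rw [f.2, f.2] at h
    rw [Subtype.ext h]
  · obtain ⟨l, rfl⟩ := hp
    exact absurd (by rw [← h, f.2]; exact l.2) (hfL p' hp')
  · obtain ⟨l, rfl⟩ := hp'
    exact absurd (by rw [h, f.2]; exact l.2) (hfL p hp)
  · by_contra hne
    obtain ⟨N, hN⟩ := exists_nat_one_div_lt (dist_pos.2 hne)
    obtain ⟨n, ⟨hn1, hn2⟩, hn3⟩ :=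
      (((hmemA p hp).and (hmemA p' hp')).and (eventually_ge_atTop N)).exists
    exact (hf n).2 (p, p') ⟨⟨hn1, hn2⟩, (Nat.one_div_le_one_div hn3).trans hN.le⟩ h

end ZSets

theorem le_metrDiam {S : Type*} {ρ : S → S → ℝ} {C : ℝ} (h : ∀ x y, ρ x y ≤ C) (x y : S) :
    ρ x y ≤ metrDiam ρ :=
  le_csSup ⟨C, by rintro _ ⟨x, y, rfl⟩; exact h x y⟩ ⟨x, y, rfl⟩

theorem metrDiam_le {S : Type*} [Nonempty S] {ρ : S → S → ℝ} {C : ℝ} (h : ∀ x y, ρ x y ≤ C) :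
    metrDiam ρ ≤ C :=
  csSup_le ⟨_, Classical.arbitrary S, Classical.arbitrary S, rfl⟩
    (by rintro _ ⟨x, y, rfl⟩; exact h x y)

open StateSpace in
/-- Maps from a closed subset of the Hilbert cube to `X` extend to maps of the Hilbert cube to the
state space of `X`, nonexpansively for all Kantorovich metrics simultaneously. -/
theorem exists_stateSpace_extension {X : Type*} [TopologicalSpace X] [CompactSpace X] [Nonempty X]
    {K : Set HCube} (hK : IsClosed K) :
    ∃ F : (K → X) → HCube → StateSpace X,
      (∀ φ, Continuous φ → Continuous (F φ) ∧ ∀ x : K, F φ x = dirac (φ x)) ∧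
      ∀ d : X → X → ℝ, IsCompatibleMetric d → ∀ φ ψ, Continuous φ → Continuous ψ →
        ∀ C, 0 ≤ C → (∀ x, d (φ x) (ψ x) ≤ C) →
          ∀ x₀ x, kantorovich d x₀ (F φ x) (F ψ x) ≤ C := by
  classical
  rcases K.eq_empty_or_nonempty with rfl | hne
  · exact ⟨fun _ _ ↦ dirac (Classical.arbitrary X),
      fun φ _ ↦ ⟨continuous_const, fun x ↦ isEmptyElim x⟩,
      fun d hd φ ψ _ _ C hC _ x₀ x ↦ by rwa [kantorovich_self hd]⟩
  have : Nonempty K := hne.to_subtype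
  have : CompactSpace K := isCompact_iff_compactSpace.1 hK.isCompact
  obtain ⟨r, hr, hrK⟩ := exists_continuous_extension_dirac hK.isClosedEmbedding_subtypeVal
  refine ⟨fun φ x ↦ if h : Continuous φ then StateSpace.map ⟨φ, h⟩ (r x)
    else dirac (Classical.arbitrary X), fun φ hφ ↦ ?_, fun d hd φ ψ hφ hψ C hC hle x₀ x ↦ ?_⟩
  · simp only [dif_pos hφ]
    exact ⟨(continuous_map _).comp hr, fun x ↦ by rw [hrK, map_dirac]; rfl⟩
  · simp only [dif_pos hφ, dif_pos hψ]
    refine kantorovich_le hd fun f hf ↦ ?_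
    rw [map_apply, map_apply, ← StateSpace.map_sub]
    refine ((r x).abs_apply_le _).trans ((ContinuousMap.norm_le _ hC).2 fun k ↦ ?_)
    exact (hf.2 _ _).trans (hle k)

/-- The extension operator and the extended metrics for a fixed target `L`. -/
theorem IsZSet.exists_extension_operator {L : Set HCube} (hL : IsZSet L) :
    ∃ E : ∀ K : Set HCube, (K → L) → (HCube → HCube),
      (∀ K, IsZSet K → ∀ φ : K → L, Continuous φ →
        Continuous (E K φ) ∧ ∀ x : K, E K φ ↑x = ↑(φ x)) ∧
      ∀ d : L → L → ℝ, IsCompatibleMetric d → (∃ C : ℝ, ∀ x y : L, d x y ≤ C) →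
        ∃ dh : HCube → HCube → ℝ, IsCompatibleMetric dh ∧
          (∃ C : ℝ, ∀ x y : HCube, dh x y ≤ C) ∧
          (∀ x y : L, dh ↑x ↑y = d x y) ∧
          metrDiam dh = max 1 (metrDiam d) ∧
          ∀ K : Set HCube, IsZSet K → ∀ φ ψ : K → L, Continuous φ → Continuous ψ →
            (⨆ x : HCube, dh (E K φ x) (E K ψ x)) = ⨆ x : K, d (φ x) (ψ x) := by
  rcases L.eq_empty_or_nonempty with rfl | hne
  · refine ⟨fun _ _ x ↦ x, fun K _ φ _ ↦ ⟨continuous_id, fun x ↦ isEmptyElim (φ x)⟩,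
      fun d _ _ ↦ ?_⟩
    obtain ⟨q, hqc, hqs, hqt, -, hq1, ⟨a, b, hab⟩, -, hq0, hqz⟩ :=
      exists_pseudometric_collapsing (X := HCube) (isClosed_singleton (x := 0))
        (singleton_nonempty _) fun h ↦
          one_ne_zero (α := HCube) (mem_singleton_iff.1 (h ▸ mem_univ 1))
    refine ⟨q, isCompatibleMetric_of_continuous hqc hqs (fun x y ↦ ⟨fun h ↦ ?_, ?_⟩) hqt,
      ⟨1, hq1⟩, fun x ↦ isEmptyElim x, ?_, fun K _ φ ψ _ _ ↦ ?_⟩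
    · rcases hqz x y h with h | ⟨h, h'⟩
      · exact h
      · rw [mem_singleton_iff.1 h, mem_singleton_iff.1 h']
    · rintro rfl
      exact hq0 x
    · have h1 : metrDiam q = 1 :=
        le_antisymm (metrDiam_le hq1) (hab.symm.le.trans (le_metrDiam hq1 a b))
      have h2 : metrDiam d = 0 := by simp [metrDiam]
      rw [h1, h2, max_eq_left zero_le_one]
    · have : IsEmpty K := ⟨fun x ↦ isEmptyElim (φ x)⟩
      simp [hq0]
  have : Nonempty L := hne.to_subtype
  have : CompactSpace L := isCompact_iff_compactSpace.1 hL.1.isCompact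
  obtain ⟨l₀⟩ := ‹Nonempty L›
  have hdirac : Function.Injective (StateSpace.dirac : L → StateSpace L) := by
    let _ := TopologicalSpace.metrizableSpaceMetric L
    intro x y h
    have : dist x y = dist y y := congrArg
      (fun Λ : StateSpace L ↦ Λ (⟨fun z ↦ dist z y, by fun_prop⟩ : C(L, ℝ))) h
    rwa [dist_self, dist_eq_zero] at this
  obtain ⟨j', hj', hjL⟩ := hL.exists_embedding hne
    (P := StateSpace L × unitInterval) (e := fun l ↦ (StateSpace.dirac l, 0))
    ((StateSpace.continuous_dirac.prodMk continuous_const).isClosedEmbedding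
      fun x y h ↦ hdirac (congrArg Prod.fst h))
  set j : StateSpace L → HCube := fun Λ ↦ j' (Λ, 0)
  have hj : IsClosedEmbedding j :=
    (hj'.continuous.comp (continuous_id.prodMk continuous_const)).isClosedEmbedding
      fun Λ M h ↦ congrArg Prod.fst (hj'.injective h)
  have hjne : range j ≠ univ := by
    intro h
    obtain ⟨Λ, hΛ⟩ := h ▸ mem_univ (j' (StateSpace.dirac l₀, 1))
    exact zero_ne_one (congrArg Prod.snd (hj'.injective hΛ))
  have : Nonempty (StateSpace L) := ⟨StateSpace.dirac l₀⟩
  obtain ⟨r, hr, hrj⟩ := exists_continuous_extension_dirac hj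
  set s : HCube → StateSpace L := fun x ↦ (r x).bary
  have hs : Continuous s := StateSpace.continuous_bary.comp hr
  have hsj : ∀ Λ, s (j Λ) = Λ := fun Λ ↦ by simp only [s, hrj, StateSpace.bary_dirac]
  obtain ⟨q, hqc, hqs, hqt, hqnn, hq1, ⟨a, b, hab⟩, hqA, hq0, hqz⟩ :=
    exists_pseudometric_collapsing hj.isClosed_range (range_nonempty j) hjne
  have hF : ∀ K : Set HCube, ∃ F : (K → L) → HCube → StateSpace L, IsZSet K →
      (∀ φ, Continuous φ → Continuous (F φ) ∧ ∀ x : K, F φ x = StateSpace.dirac (φ x)) ∧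
      ∀ d : L → L → ℝ, IsCompatibleMetric d → ∀ φ ψ, Continuous φ → Continuous ψ →
        ∀ C, 0 ≤ C → (∀ x, d (φ x) (ψ x) ≤ C) →
          ∀ x₀ x, kantorovich d x₀ (F φ x) (F ψ x) ≤ C := fun K ↦ by
    by_cases hK : IsZSet K
    · obtain ⟨F, hF⟩ := exists_stateSpace_extension (X := L) hK.1
      exact ⟨F, fun _ ↦ hF⟩
    · exact ⟨fun _ _ ↦ StateSpace.dirac l₀, fun h ↦ absurd h hK⟩
  choose F hF using hF
  refine ⟨fun K φ x ↦ j (F K φ x), fun K hK φ hφ ↦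
    ⟨hj.continuous.comp ((hF K hK).1 φ hφ).1, fun x ↦ ?_⟩, fun d hd ⟨C, hC⟩ ↦ ?_⟩
  · change j (F K φ x) = φ x
    rw [((hF K hK).1 φ hφ).2 x]
    exact hjL (φ x)
  set W : StateSpace L → StateSpace L → ℝ := kantorovich d l₀
  set dh : HCube → HCube → ℝ := fun x y ↦ max (W (s x) (s y)) (q x y) with hdh
  have hWle : ∀ Λ M, W Λ M ≤ metrDiam d :=
    kantorovich_le_of_bound hd (le_metrDiam hC) l₀
  have hdhj : ∀ Λ M, dh (j Λ) (j M) = W Λ M := fun Λ M ↦ by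
    simp only [hdh, hsj]
    rw [hqA _ (mem_range_self Λ) _ (mem_range_self M)]
    exact max_eq_left (kantorovich_nonneg hd l₀ Λ M)
  have hdhL : ∀ x y : L, dh x y = d x y := fun x y ↦ by
    rw [← hjL x, ← hjL y]
    exact (hdhj _ _).trans (kantorovich_dirac hd l₀ x y)
  have hdhle : ∀ x y, dh x y ≤ max 1 (metrDiam d) := fun x y ↦
    max_le ((hWle _ _).trans (le_max_right _ _)) ((hq1 x y).trans (le_max_left _ _))
  refine ⟨dh, isCompatibleMetric_of_continuous ?_ (fun x y ↦ ?_) (fun x y ↦ ⟨fun h ↦ ?_, ?_⟩)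
    (fun x y z ↦ ?_), ⟨_, hdhle⟩, hdhL, le_antisymm (metrDiam_le hdhle) (max_le ?_ ?_),
    fun K hK φ ψ hφ hψ ↦ ?_⟩
  · exact ((continuous_kantorovich hd l₀).comp
      (by fun_prop : Continuous fun p : HCube × HCube ↦ (s p.1, s p.2))).max hqc
  · simp only [hdh, W, kantorovich_comm l₀ (s x), hqs x]
  · have h1 : W (s x) (s y) ≤ 0 := (le_max_left _ _).trans h.le
    have h2 : q x y ≤ 0 := (le_max_right _ _).trans h.le
    rcases hqz x y (le_antisymm h2 (hqnn x y)) with h3 | ⟨⟨Λ, rfl⟩, ⟨M, rfl⟩⟩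
    · exact h3
    · rw [hsj, hsj] at h1
      rw [eq_of_kantorovich_eq_zero hd (le_antisymm h1 (kantorovich_nonneg hd l₀ Λ M))]
  · rintro rfl
    simp [hdh, W, kantorovich_self hd, hq0]
  · exact max_le
      ((kantorovich_triangle hd l₀ _ (s y) _).trans (add_le_add (le_max_left _ _) (le_max_left _ _)))
      ((hqt x y z).trans (add_le_add (le_max_right _ _) (le_max_right _ _)))
  · exact hab.symm.le.trans ((le_max_right _ _).trans (le_metrDiam hdhle a b))
  · have : Nonempty L := ⟨l₀⟩
    exact metrDiam_le fun x y ↦ (hdhL x y).symm.le.trans (le_metrDiam hdhle x y)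
  · simp only [hdhj]
    have hnn : ∀ x : K, 0 ≤ d (φ x) (ψ x) := fun x ↦ hd.nonneg _ _
    refine le_antisymm (ciSup_le fun x ↦ ?_) (Real.iSup_le (fun x ↦ ?_) ?_)
    · exact (hF K hK).2 d hd φ ψ hφ hψ _ (Real.iSup_nonneg hnn)
        (fun x ↦ le_ciSup (f := fun x : K ↦ d (φ x) (ψ x))
          ⟨C, by rintro _ ⟨x, rfl⟩; exact hC _ _⟩ x) l₀ x
    · rw [← kantorovich_dirac hd l₀, ← ((hF K hK).1 φ hφ).2 x, ← ((hF K hK).1 ψ hψ).2 x]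
      exact le_ciSup (f := fun x ↦ W (F K φ x) (F K ψ x))
        ⟨_, by rintro _ ⟨x, rfl⟩; exact hWle _ _⟩ (x : HCube)
    · exact Real.iSup_nonneg fun x ↦ kantorovich_nonneg hd l₀ _ _

/-- **Functor of continuation in the Hilbert cube: property (i), extension of metrics.**
There is an assignment `(φ, L) ↦ E φ L` sending continuous maps between `Z`-sets of `Q`
to continuous self-maps of `Q` extending them, such that every compatible bounded metric `d`
on a `Z`-set `L` extends to a compatible metric `d̂` on `Q` with
`diam (Q,d̂) = max 1 (diam (L,d))`, for which `φ ↦ E φ L` is isometric with respect to the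
sup-metrics, and `d̂` can be chosen complete whenever `d` is complete. -/
theorem continuation_functor_hilbert_cube_metric :
    ∃ E : ∀ K L : Set HCube, (K → L) → (HCube → HCube),
      (∀ K L : Set HCube, IsZSet K → IsZSet L → ∀ φ : K → L, Continuous φ →
        Continuous (E K L φ) ∧ ∀ x : K, E K L φ ↑x = ↑(φ x)) ∧
      (∀ L : Set HCube, IsZSet L → ∀ d : L → L → ℝ,
        IsCompatibleMetric d → (∃ C : ℝ, ∀ x y : L, d x y ≤ C) →
        ∃ dh : HCube → HCube → ℝ, IsCompatibleMetric dh ∧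
          (∃ C : ℝ, ∀ x y : HCube, dh x y ≤ C) ∧
          (∀ x y : L, dh ↑x ↑y = d x y) ∧
          metrDiam dh = max 1 (metrDiam d) ∧
          (∀ K : Set HCube, IsZSet K → ∀ φ ψ : K → L, Continuous φ → Continuous ψ →
            (⨆ x : HCube, dh (E K L φ x) (E K L ψ x)) = ⨆ x : K, d (φ x) (ψ x)) ∧
          (IsCompleteMetricOn d → IsCompleteMetricOn dh)) := by
  have h : ∀ L : Set HCube, ∃ E : ∀ K : Set HCube, (K → L) → (HCube → HCube), IsZSet L → _ :=
    fun L ↦ by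
      by_cases hL : IsZSet L
      · obtain ⟨E, hE⟩ := hL.exists_extension_operator
        exact ⟨E, fun _ ↦ hE⟩
      · exact ⟨fun _ _ x ↦ x, fun h ↦ absurd h hL⟩
  choose E hE using h
  refine ⟨fun K L ↦ E L K, fun K L hK hL ↦ (hE L hL).1 K hK, fun L hL d hd hC ↦ ?_⟩
  obtain ⟨dh, h1, h2, h3, h4, h5⟩ := (hE L hL).2 d hd hC
  exact ⟨dh, h1, h2, h3, h4, h5, fun _ ↦ h1.isCompleteMetricOn⟩
end
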